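/- arXiv:2603.29277 — 3 statements merged into one kernel-verified Lean document; each statement's English description precedes it below -/
import Mathlib

section
/- Let r ≥ 3, q ≥ C(r,2), and let α_1,…,α_q be nonnegative rationals with α := α_1 + … + α_q ≤ 1. Let n be a positive integer divisible by r such that α_i·n is a nonnegative integer for every i and (1−α)n/r is an integer. Let G be the complete (r+1)-partite graph on n vertices with parts V_1,…,V_{r+1} where |V_1| = … = |V_r| = (1−α)n/r and |V_{r+1}| = αn, and partition V_{r+1} into sets Y_1,…,Y_q with |Y_k| = α_k·n. Fix a bijection g from the 2-element subsets of {1,…,r} to {1,…,C(r,2)}; color every edge between V_i and V_j (1 ≤ i < j ≤ r) with color g({i,j}), and color every edge incident to Y_k with color k. Then for every K_r-tiling T of G and every color i ∈ {1,…,q}, the number of edges of color i contained in T equals (n/r)(1−2α) + α_i·n·(r−1) if 1 ≤ i ≤ C(r,2), and equals α_i·n·(r−1) if C(r,2) < i ≤ q. In particular, this count does not depend on the choice of the K_r-tiling T. -/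
open Finset

variable {V : Type*}

/-- A `Kᵣ`-tiling of the vertex set `W`: a collection of pairwise-disjoint `r`-cliques of `G`
whose union is `W`. -/
def IsKrTilingOn [DecidableEq V] (G : SimpleGraph V) (r : ℕ)
    (T : Finset (Finset V)) (W : Finset V) : Prop :=
  (∀ K ∈ T, G.IsNClique r K) ∧
  (∀ K ∈ T, ∀ K' ∈ T, K ≠ K' → Disjoint K K') ∧
  T.biUnion id = W

/-- A perfect `Kᵣ`-tiling of `G`. -/
def IsKrTiling [Fintype V] [DecidableEq V] (G : SimpleGraph V) (r : ℕ)
    (T : Finset (Finset V)) : Prop :=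
  IsKrTilingOn G r T Finset.univ

/-- The number of edges of color `c` lying inside the cliques of `T`. -/
def tilingColorCount [DecidableEq V] {q : ℕ} (f : Sym2 V → Fin q)
    (T : Finset (Finset V)) (c : Fin q) : ℕ :=
  ∑ K ∈ T, (K.sym2.filter fun e => ¬ e.IsDiag ∧ f e = c).card

/-- The total number of edges lying inside the cliques of `T`. -/
def tilingEdgeCount [DecidableEq V] (T : Finset (Finset V)) : ℕ :=
  ∑ K ∈ T, (K.sym2.filter fun e => ¬ e.IsDiag).card


theorem ecc_A {n r q : ℕ} (part : Fin n → Fin (r + 1)) (ycol : Fin n → Fin q)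
    (f : Sym2 (Fin n) → Fin q)
    (hf2 : ∀ u v, part v = Fin.last r → part u ≠ Fin.last r → f s(u, v) = ycol v)
    (K : Finset (Fin n)) (hK : K.card = r)
    (hinj : ∀ u ∈ K, ∀ v ∈ K, part u = part v → u = v) (c : Fin q) :
    (K.sym2.filter fun e => (¬ e.IsDiag ∧ f e = c) ∧ ∃ v ∈ e, part v = Fin.last r).card
      = (r - 1) * (K.filter fun v => part v = Fin.last r ∧ ycol v = c).card := by
  by_cases h : ∃ v ∈ K, part v = Fin.last r ∧ ycol v = c
  · obtain ⟨v, hv, hl, hc⟩ := h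
    have h1 : (K.filter fun v => part v = Fin.last r ∧ ycol v = c) = {v} := by
      ext w
      simp only [mem_filter, mem_singleton]
      constructor
      · rintro ⟨hw, hwl, -⟩
        exact hinj _ hw _ hv (hwl.trans hl.symm)
      · rintro rfl
        exact ⟨hv, hl, hc⟩
    have h2 : (K.sym2.filter fun e => (¬ e.IsDiag ∧ f e = c) ∧ ∃ v ∈ e, part v = Fin.last r)
        = (K.erase v).image (fun w => s(w, v)) := by
      ext e
      induction e using Sym2.ind with
      | _ a b =>
      simp only [mem_filter, Finset.mk_mem_sym2_iff, Sym2.mk_isDiag_iff, Sym2.mem_iff, mem_image,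
        mem_erase]
      constructor
      · rintro ⟨⟨ha, hb⟩, ⟨hab, -⟩, w, hw, hwl⟩
        rcases hw with rfl | rfl
        · have : w = v := hinj _ ha _ hv (hwl.trans hl.symm)
          subst this
          exact ⟨b, ⟨fun h => hab h.symm, hb⟩, Sym2.eq_swap⟩
        · have : w = v := hinj _ hb _ hv (hwl.trans hl.symm)
          subst this
          exact ⟨a, ⟨hab, ha⟩, rfl⟩
      · rintro ⟨w, ⟨hwv, hw⟩, he⟩
        have hwl : part w ≠ Fin.last r := fun h => hwv (hinj _ hw _ hv (h.trans hl.symm))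
        have hfe : f s(a, b) = c := by rw [← he, hf2 w v hl hwl, hc]
        rw [Sym2.eq_iff] at he
        rcases he with ⟨rfl, rfl⟩ | ⟨rfl, rfl⟩
        · exact ⟨⟨hw, hv⟩, ⟨hwv, hfe⟩, v, Or.inr rfl, hl⟩
        · exact ⟨⟨hv, hw⟩, ⟨fun h => hwv h.symm, hfe⟩, v, Or.inl rfl, hl⟩
    rw [h1, h2, card_image_of_injective, card_erase_of_mem hv, hK]
    · simp
    · intro a b hab
      rcases Sym2.eq_iff.1 hab with ⟨h, -⟩ | ⟨h, h'⟩
      · exact h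
      · exact h.trans h'
  · have h1 : (K.filter fun v => part v = Fin.last r ∧ ycol v = c) = ∅ := by
      rw [Finset.filter_eq_empty_iff]
      intro v hv h'
      exact h ⟨v, hv, h'⟩
    rw [h1, card_empty, mul_zero, card_eq_zero, Finset.filter_eq_empty_iff]
    intro e
    induction e using Sym2.ind with
    | _ a b =>
    simp only [Finset.mk_mem_sym2_iff, Sym2.mk_isDiag_iff, Sym2.mem_iff]
    rintro ⟨ha, hb⟩ ⟨⟨hab, hfe⟩, w, hw, hwl⟩
    rcases hw with rfl | rfl
    · refine h ⟨w, ha, hwl, ?_⟩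
      rw [← hf2 b w hwl fun hh => hab (hinj _ ha _ hb (hwl.trans hh.symm)), Sym2.eq_swap, hfe]
    · refine h ⟨w, hb, hwl, ?_⟩
      rw [← hf2 a w hwl fun hh => hab (hinj _ ha _ hb (hh.trans hwl.symm)), hfe]

theorem ecc_lt {r : ℕ} {x : Fin (r + 1)} (h : x ≠ Fin.last r) : (x : ℕ) < r := by
  have := Fin.val_lt_last h
  simpa using this

theorem ecc_B {n r q : ℕ} (part : Fin n → Fin (r + 1))
    (g : Sym2 (Fin (r + 1)) → Fin q)
    (hginj : ∀ i j i' j' : Fin (r + 1), (i : ℕ) < r → (j : ℕ) < r → (i' : ℕ) < r →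
      (j' : ℕ) < r → i ≠ j → i' ≠ j' → g s(i, j) = g s(i', j') → s(i, j) = s(i', j'))
    (f : Sym2 (Fin n) → Fin q)
    (hf1 : ∀ u v, (part u : ℕ) < r → (part v : ℕ) < r → part u ≠ part v →
      f s(u, v) = g s(part u, part v))
    (K : Finset (Fin n)) (hK : K.card = r)
    (hinj : ∀ u ∈ K, ∀ v ∈ K, part u = part v → u = v) (i j : Fin (r + 1))
    (hi : (i : ℕ) < r) (hj : (j : ℕ) < r) (hij : i ≠ j) :
    (K.sym2.filter fun e => (¬ e.IsDiag ∧ f e = g s(i, j)) ∧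
        ¬ ∃ v ∈ e, part v = Fin.last r).card + 1
      = (K.filter fun v => part v = i).card + (K.filter fun v => part v = j).card := by
  have key : ∀ a ∈ K, ∀ b ∈ K, a ≠ b → f s(a, b) = g s(i, j) →
      (¬ ∃ v ∈ s(a, b), part v = Fin.last r) →
      (part a = i ∧ part b = j) ∨ (part a = j ∧ part b = i) := by
    intro a ha b hb hab hfe hl
    have ha' : part a ≠ Fin.last r := fun h => hl ⟨a, by simp, h⟩
    have hb' : part b ≠ Fin.last r := fun h => hl ⟨b, by simp, h⟩
    have hp : part a ≠ part b := fun h => hab (hinj _ ha _ hb h)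
    rw [hf1 a b (ecc_lt ha') (ecc_lt hb') hp] at hfe
    exact Sym2.eq_iff.1 (hginj _ _ _ _ (ecc_lt ha') (ecc_lt hb') hi hj hp hij hfe)
  have single : ∀ u ∈ K, (K.filter fun v => part v = part u) = {u} := by
    intro u hu
    ext w
    simp only [mem_filter, mem_singleton]
    exact ⟨fun h => hinj _ h.1 _ hu h.2, by rintro rfl; exact ⟨hu, rfl⟩⟩
  have cov : (∃ u ∈ K, part u = i) ∨ (∃ u ∈ K, part u = j) := by
    by_contra hcon
    have hsub : K.image part ⊆ (univ.erase i).erase j := by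
      intro x hx
      obtain ⟨u, hu, rfl⟩ := mem_image.1 hx
      simp only [mem_erase, mem_univ, and_true]
      exact ⟨fun h => hcon (Or.inr ⟨u, hu, h⟩), fun h => hcon (Or.inl ⟨u, hu, h⟩)⟩
    have h1 := card_le_card hsub
    rw [card_image_of_injOn (fun a ha b hb h => hinj a ha b hb h), hK,
      card_erase_of_mem (by simp [hij.symm]), card_erase_of_mem (by simp)] at h1
    simp at h1
    omega
  by_cases h1 : ∃ u ∈ K, part u = i
  · obtain ⟨u, hu, hui⟩ := h1
    by_cases h2 : ∃ u ∈ K, part u = j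
    · obtain ⟨w, hw, hwj⟩ := h2
      have e1 := single u hu
      have e2 := single w hw
      rw [hui] at e1
      rw [hwj] at e2
      have e3 : (K.sym2.filter fun e => (¬ e.IsDiag ∧ f e = g s(i, j)) ∧
        ¬ ∃ v ∈ e, part v = Fin.last r) = {s(u, w)} := by
        ext e
        induction e using Sym2.ind with
        | _ a b =>
        simp only [mem_filter, Finset.mk_mem_sym2_iff, Sym2.mk_isDiag_iff, mem_singleton]
        constructor
        · rintro ⟨⟨ha, hb⟩, ⟨hab, hfe⟩, hl⟩
          rcases key a ha b hb hab hfe hl with ⟨x, y⟩ | ⟨x, y⟩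
          · rw [hinj a ha u hu (x.trans hui.symm), hinj b hb w hw (y.trans hwj.symm)]
          · rw [hinj a ha w hw (x.trans hwj.symm), hinj b hb u hu (y.trans hui.symm), Sym2.eq_swap]
        · intro he
          have huw : u ≠ w := by
            rintro rfl
            exact hij (hui.symm.trans hwj)
          have hfe : f s(u, w) = g s(i, j) := by
            rw [hf1 u w (hui ▸ hi) (hwj ▸ hj) (by rw [hui, hwj]; exact hij), hui, hwj]
          have hl : ¬ ∃ v ∈ s(u, w), part v = Fin.last r := by
            rintro ⟨v, hv, hvl⟩
            rcases Sym2.mem_iff.1 hv with rfl | rfl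
            · rw [← hui, hvl] at hi; simp at hi
            · rw [← hwj, hvl] at hj; simp at hj
          rw [he]
          refine ⟨?_, ⟨?_, hfe⟩, hl⟩
          · rcases Sym2.eq_iff.1 he with ⟨rfl, rfl⟩ | ⟨rfl, rfl⟩
            · exact ⟨hu, hw⟩
            · exact ⟨hw, hu⟩
          · rcases Sym2.eq_iff.1 he with ⟨rfl, rfl⟩ | ⟨rfl, rfl⟩
            · exact huw
            · exact huw.symm
      rw [e1, e2, e3]
      simp
    · have e1 := single u hu
      rw [hui] at e1
      have e2 : (K.filter fun v => part v = j) = ∅ :=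
        Finset.filter_eq_empty_iff.2 fun v hv h => h2 ⟨v, hv, h⟩
      have e3 : (K.sym2.filter fun e => (¬ e.IsDiag ∧ f e = g s(i, j)) ∧
        ¬ ∃ v ∈ e, part v = Fin.last r) = ∅ := by
        rw [Finset.filter_eq_empty_iff]
        intro e
        induction e using Sym2.ind with
        | _ a b =>
        simp only [Finset.mk_mem_sym2_iff, Sym2.mk_isDiag_iff]
        rintro ⟨ha, hb⟩ ⟨⟨hab, hfe⟩, hl⟩
        rcases key a ha b hb hab hfe hl with ⟨x, y⟩ | ⟨x, y⟩
        · exact h2 ⟨b, hb, y⟩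
        · exact h2 ⟨a, ha, x⟩
      rw [e1, e2, e3]
      simp
  · obtain ⟨w, hw, hwj⟩ := cov.resolve_left h1
    have e2 := single w hw
    rw [hwj] at e2
    have e1 : (K.filter fun v => part v = i) = ∅ :=
      Finset.filter_eq_empty_iff.2 fun v hv h => h1 ⟨v, hv, h⟩
    have e3 : (K.sym2.filter fun e => (¬ e.IsDiag ∧ f e = g s(i, j)) ∧
      ¬ ∃ v ∈ e, part v = Fin.last r) = ∅ := by
      rw [Finset.filter_eq_empty_iff]
      intro e
      induction e using Sym2.ind with
      | _ a b =>
      simp only [Finset.mk_mem_sym2_iff, Sym2.mk_isDiag_iff]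
      rintro ⟨ha, hb⟩ ⟨⟨hab, hfe⟩, hl⟩
      rcases key a ha b hb hab hfe hl with ⟨x, y⟩ | ⟨x, y⟩
      · exact h1 ⟨a, ha, x⟩
      · exact h1 ⟨b, hb, y⟩
    rw [e1, e2, e3]
    simp

theorem ecc_surj {r q : ℕ} (g : Sym2 (Fin (r + 1)) → Fin q)
    (hginj : ∀ i j i' j' : Fin (r + 1), (i : ℕ) < r → (j : ℕ) < r → (i' : ℕ) < r →
      (j' : ℕ) < r → i ≠ j → i' ≠ j' → g s(i, j) = g s(i', j') → s(i, j) = s(i', j'))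
    (hgrange : ∀ i j : Fin (r + 1), (i : ℕ) < r → (j : ℕ) < r → i ≠ j →
      ((g s(i, j) : ℕ) < r * (r - 1) / 2)) (c : Fin q) (hc : (c : ℕ) < r * (r - 1) / 2) :
    ∃ i j : Fin (r + 1), (i : ℕ) < r ∧ (j : ℕ) < r ∧ i ≠ j ∧ g s(i, j) = c := by
  have hcs : ∀ x : Fin r, ((x.castSucc : Fin (r + 1)) : ℕ) < r := fun x => by simp
  have hrange : ∀ e : {e : Sym2 (Fin r) // ¬ e.IsDiag},
      (g (e.1.map Fin.castSucc) : ℕ) < r * (r - 1) / 2 := by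
    rintro ⟨e, he⟩
    induction e using Sym2.ind with
    | _ a b =>
    exact hgrange _ _ (hcs a) (hcs b) (fun h => he (Fin.castSucc_injective r h))
  let F : {e : Sym2 (Fin r) // ¬ e.IsDiag} → Fin (r * (r - 1) / 2) :=
    fun e => ⟨g (e.1.map Fin.castSucc), hrange e⟩
  have hF : Function.Injective F := by
    rintro ⟨e, he⟩ ⟨e', he'⟩ h
    have h' : g (e.map Fin.castSucc) = g (e'.map Fin.castSucc) := Fin.ext (Fin.mk.inj h)
    apply Subtype.ext
    apply Sym2.map.injective (Fin.castSucc_injective r)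
    clear h
    revert he he' h'
    induction e using Sym2.ind with
    | _ a b =>
    induction e' using Sym2.ind with
    | _ a' b' =>
    intro he he' h'
    exact hginj _ _ _ _ (hcs a) (hcs b) (hcs a') (hcs b')
      (fun h => he (Fin.castSucc_injective r h)) (fun h => he' (Fin.castSucc_injective r h)) h'
  have hbij : Function.Bijective F := by
    rw [Fintype.bijective_iff_injective_and_card]
    refine ⟨hF, ?_⟩
    rw [Sym2.card_subtype_not_diag, Fintype.card_fin, Fintype.card_fin, Nat.choose_two_right]
  obtain ⟨⟨e, he⟩, h⟩ := hbij.2 ⟨c, hc⟩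
  have h' : g (e.map Fin.castSucc) = c := Fin.ext (Fin.mk.inj h)
  clear h
  revert he h'
  induction e using Sym2.ind with
  | _ a b =>
  intro he h'
  exact ⟨_, _, hcs a, hcs b, fun h => he (Fin.castSucc_injective r h), h'⟩

theorem ecc_sum {n : ℕ} (T : Finset (Finset (Fin n)))
    (hd : ∀ K ∈ T, ∀ K' ∈ T, K ≠ K' → Disjoint K K') (hu : T.biUnion id = univ)
    (p : Fin n → Prop) [DecidablePred p] :
    ∑ K ∈ T, (K.filter p).card = (univ.filter p).card := by
  rw [← hu, Finset.filter_biUnion, card_biUnion]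
  · rfl
  · intro K hK K' hK' h
    exact Finset.disjoint_filter_filter (hd K hK K' hK' h)

/-- **Lemma (edge counting in Construction 1).** Let `r ≥ 3`, `q ≥ C(r,2)`, and let
`α_1,…,α_q ≥ 0` be rationals with sum `α ≤ 1`.  Let `n > 0` be divisible by `r` with
`α_i n ∈ ℕ` and `(1−α)n/r ∈ ℕ`.  Let `G` be the complete `(r+1)`-partite graph with parts
`V_1,…,V_{r+1}` of sizes `|V_1| = ⋯ = |V_r| = (1−α)n/r`, `V_{r+1}` partitioned into sets
`Y_1,…,Y_q` with `|Y_k| = α_k n`; edges between `V_i,V_j` (`i<j≤r`) get color `g({i,j})`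
where `g` is a bijection onto the first `C(r,2)` colors, and edges meeting `Y_k` get color
`k`.  Then every `K_r`-tiling has exactly `(n/r)(1−2α) + α_i n (r−1)` edges of color `i` for
`i ≤ C(r,2)`, and exactly `α_i n (r−1)` edges of color `i` for `i > C(r,2)`. -/
theorem edge_counting_construction_one (r q n : ℕ) (hr : 3 ≤ r)
    (hq : r * (r - 1) / 2 ≤ q)
    (α : Fin q → ℚ) (hα0 : ∀ i, 0 ≤ α i) (hα1 : ∑ i, α i ≤ 1)
    (hn0 : 0 < n) (hrn : r ∣ n)
    (hint : ∀ i, ∃ m : ℕ, α i * n = m)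
    (hint' : ∃ m : ℕ, (1 - ∑ i, α i) * n = r * m)
    -- the partition into parts `V_1, …, V_{r+1}` (`part v = j` means `v ∈ V_{j+1}`)
    (part : Fin n → Fin (r + 1))
    (hpart : ∀ j : Fin (r + 1), (j : ℕ) < r →
      ((Finset.univ.filter fun v => part v = j).card : ℚ) = (1 - ∑ i, α i) * n / r)
    -- the partition of `V_{r+1}` into `Y_1, …, Y_q` (`Y_k` is the set of `v` in the last
    -- part with `ycol v = k`)
    (ycol : Fin n → Fin q)
    (hY : ∀ k : Fin q,
      ((Finset.univ.filter fun v => part v = Fin.last r ∧ ycol v = k).card : ℚ) = α k * n)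
    -- `G` is the complete `(r+1)`-partite graph on these parts
    (G : SimpleGraph (Fin n)) (hG : ∀ u v, G.Adj u v ↔ part u ≠ part v)
    -- `g` is a bijection from the pairs inside `{1,…,r}` onto the first `C(r,2)` colors
    (g : Sym2 (Fin (r + 1)) → Fin q)
    (hginj : ∀ i j i' j' : Fin (r + 1), (i : ℕ) < r → (j : ℕ) < r → (i' : ℕ) < r →
      (j' : ℕ) < r → i ≠ j → i' ≠ j' → g s(i, j) = g s(i', j') → s(i, j) = s(i', j'))
    (hgrange : ∀ i j : Fin (r + 1), (i : ℕ) < r → (j : ℕ) < r → i ≠ j →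
      ((g s(i, j) : ℕ) < r * (r - 1) / 2))
    -- the coloring: edges between `V_i` and `V_j` (`i, j ≤ r`) get color `g({i,j})`,
    -- and edges incident to `Y_k` get color `k`
    (f : Sym2 (Fin n) → Fin q)
    (hf1 : ∀ u v, (part u : ℕ) < r → (part v : ℕ) < r → part u ≠ part v →
      f s(u, v) = g s(part u, part v))
    (hf2 : ∀ u v, part v = Fin.last r → part u ≠ Fin.last r → f s(u, v) = ycol v)
    -- conclusion: the color profile of any `K_r`-tiling is determined
    (T : Finset (Finset (Fin n))) (hT : IsKrTiling G r T) (c : Fin q) :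
    (tilingColorCount f T c : ℚ) =
      if (c : ℕ) < r * (r - 1) / 2 then
        (n : ℚ) / r * (1 - 2 * ∑ i, α i) + α c * n * ((r : ℚ) - 1)
      else α c * n * ((r : ℚ) - 1) := by
  obtain ⟨hcl, hd, hu⟩ := hT
  have hcard : ∀ K ∈ T, K.card = r := fun K hK => (hcl K hK).card_eq
  have hinj : ∀ K ∈ T, ∀ u ∈ K, ∀ v ∈ K, part u = part v → u = v := by
    intro K hK u hu' v hv h
    by_contra hne
    exact (hG u v).1 ((hcl K hK).isClique hu' hv hne) h
  have hr0 : (r : ℚ) ≠ 0 := by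
    have : r ≠ 0 := by omega
    exact_mod_cast this
  have hTn : (T.card : ℚ) * r = n := by
    have := ecc_sum T hd hu (fun _ => True)
    simp only [Finset.filter_true, card_univ, Fintype.card_fin] at this
    rw [Finset.sum_congr rfl hcard, sum_const, smul_eq_mul] at this
    exact_mod_cast this
  have hA : (∑ K ∈ T, (K.sym2.filter fun e => (¬ e.IsDiag ∧ f e = c) ∧
      ∃ v ∈ e, part v = Fin.last r).card : ℕ) = (α c * n * ((r : ℚ) - 1) : ℚ) := by
    rw [Finset.sum_congr rfl fun K hK => ecc_A part ycol f hf2 K (hcard K hK) (hinj K hK) c,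
      ← Finset.mul_sum, ecc_sum T hd hu, Nat.cast_mul, hY, Nat.cast_sub (by omega)]
    push_cast
    ring
  have hsplit : tilingColorCount f T c =
      ∑ K ∈ T, (K.sym2.filter fun e => (¬ e.IsDiag ∧ f e = c) ∧
        ∃ v ∈ e, part v = Fin.last r).card +
      ∑ K ∈ T, (K.sym2.filter fun e => (¬ e.IsDiag ∧ f e = c) ∧
        ¬ ∃ v ∈ e, part v = Fin.last r).card := by
    rw [← Finset.sum_add_distrib]
    unfold tilingColorCount
    refine Finset.sum_congr rfl fun K _ => ?_
    rw [← Finset.card_filter_add_card_filter_not (fun e => ∃ v ∈ e, part v = Fin.last r),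
      Finset.filter_filter, Finset.filter_filter]
  rw [hsplit, Nat.cast_add, hA]
  split_ifs with hc
  · obtain ⟨i, j, hi, hj, hij, rfl⟩ := ecc_surj g hginj hgrange c hc
    have hB := Finset.sum_congr (rfl : T = T) fun K hK =>
      ecc_B part g hginj f hf1 K (hcard K hK) (hinj K hK) i j hi hj hij
    rw [sum_add_distrib, sum_add_distrib, ecc_sum T hd hu, ecc_sum T hd hu, sum_const,
      smul_eq_mul, mul_one] at hB
    have hB' := congrArg (Nat.cast : ℕ → ℚ) hB
    rw [Nat.cast_add, Nat.cast_add, hpart i hi, hpart j hj] at hB'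
    rw [eq_sub_of_add_eq hB', ← hTn]
    field_simp
    ring
  · have hB : ∑ K ∈ T, (K.sym2.filter fun e => (¬ e.IsDiag ∧ f e = c) ∧
        ¬ ∃ v ∈ e, part v = Fin.last r).card = 0 := by
      refine Finset.sum_eq_zero fun K hK => ?_
      rw [card_eq_zero, Finset.filter_eq_empty_iff]
      intro e
      induction e using Sym2.ind with
      | _ a b =>
      simp only [Finset.mk_mem_sym2_iff, Sym2.mk_isDiag_iff]
      rintro ⟨ha, hb⟩ ⟨⟨hab, hfe⟩, hl⟩
      have ha' : part a ≠ Fin.last r := fun h => hl ⟨a, by simp, h⟩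
      have hb' : part b ≠ Fin.last r := fun h => hl ⟨b, by simp, h⟩
      have hp : part a ≠ part b := fun h => hab (hinj K hK _ ha _ hb h)
      rw [hf1 a b (ecc_lt ha') (ecc_lt hb') hp] at hfe
      exact hc (hfe ▸ hgrange _ _ (ecc_lt ha') (ecc_lt hb') hp)
    rw [hB]
    simp
end

section
/- Let r ≥ 3 and let F be a K_r-template in a q-edge-colored graph, with unbalanced cycle of length 2k ∈ {4,6}. Let F⁺ be the edge-colored graph obtained from F by replacing each of the r−2 center vertices with an independent set of size k (the cycle vertices remain unchanged) and replacing every edge with a complete bipartite graph all of whose edges receive the color of the original edge. Then there exist two K_r-tilings T¹ and T² of F⁺ and a color c ∈ {1,…,q} such that the number of edges of color c contained in T¹ differs from the number of edges of color c contained in T². -/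
open Finset

variable {V : Type*}

/-- Number of non-loop edges of color `c` inside `S`. -/
def colCount {α : Type*} [DecidableEq α] {q : ℕ} (F : Sym2 α → Fin q) (S : Finset α)
    (c : Fin q) : ℕ :=
  (S.sym2.filter fun e => ¬ e.IsDiag ∧ F e = c).card

lemma colCount_insert {α : Type*} [DecidableEq α] {q : ℕ} (F : Sym2 α → Fin q) (S : Finset α)
    (c : Fin q) (x : α) (hx : x ∉ S) :
    colCount F (insert x S) c =
      colCount F S c + ∑ y ∈ S, (if F s(y, x) = c then 1 else 0) := by
  unfold colCount
  have h : (insert x S).sym2.filter (fun e => ¬ e.IsDiag ∧ F e = c) =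
      (S.sym2.filter fun e => ¬ e.IsDiag ∧ F e = c) ∪
        (S.filter fun y => F s(y, x) = c).image (fun y => s(y, x)) := by
    ext e
    induction e using Sym2.ind with
    | _ u v =>
      simp only [mem_filter, mem_union, mem_image, Finset.mk_mem_sym2_iff, Sym2.mk_isDiag_iff,
        mem_insert, Sym2.eq_iff]
      constructor
      · rintro ⟨⟨hu | hu, hv | hv⟩, hne, hc⟩
        · exact absurd (hu.trans hv.symm) hne
        · subst hu
          exact Or.inr ⟨v, ⟨hv, by rw [Sym2.eq_swap]; exact hc⟩, Or.inr ⟨rfl, rfl⟩⟩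
        · subst hv
          exact Or.inr ⟨u, ⟨hu, hc⟩, Or.inl ⟨rfl, rfl⟩⟩
        · exact Or.inl ⟨⟨hu, hv⟩, hne, hc⟩
      · rintro (⟨⟨hu, hv⟩, hne, hc⟩ | ⟨y, ⟨hy, hc⟩, ⟨h1, h2⟩ | ⟨h1, h2⟩⟩)
        · exact ⟨⟨Or.inr hu, Or.inr hv⟩, hne, hc⟩
        · subst h1 h2
          exact ⟨⟨Or.inr hy, Or.inl rfl⟩, fun h => hx (h ▸ hy), hc⟩
        · subst h1 h2
          exact ⟨⟨Or.inl rfl, Or.inr hy⟩, fun h => hx (h ▸ hy), by rw [Sym2.eq_swap]; exact hc⟩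
  rw [h, card_union_of_disjoint, card_image_of_injective, card_filter (fun y => F s(y, x) = c)]
  · intro y z hyz
    simp only [Sym2.eq_iff] at hyz
    rcases hyz with ⟨h, -⟩ | ⟨h1, h2⟩
    · exact h
    · exact h1.trans h2
  · rw [disjoint_left]
    intro e he he'
    simp only [mem_image, mem_filter] at he he'
    obtain ⟨y, -, rfl⟩ := he'
    rw [Finset.mk_mem_sym2_iff] at he
    exact hx he.1.2

lemma matching_bij1 (k : ℕ) (hk : k = 2 ∨ k = 3) : Function.Bijective (Sum.elim
    (fun i : Fin k => (⟨2 * i, by omega⟩ : Fin (2 * k)))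
    (fun i : Fin k => (⟨2 * i + 1, by omega⟩ : Fin (2 * k)))) := by
  rcases hk with rfl | rfl <;> decide

lemma matching_bij2 (k : ℕ) (hk : k = 2 ∨ k = 3) : Function.Bijective (Sum.elim
    (fun i : Fin k => (⟨2 * i + 1, by omega⟩ : Fin (2 * k)))
    (fun i : Fin k => (⟨(2 * i + 2) % (2 * k), Nat.mod_lt _ (by omega)⟩ : Fin (2 * k)))) := by
  rcases hk with rfl | rfl <;> decide

section tile
variable {V : Type} [DecidableEq V] (K : Finset V) (k : ℕ)

/-- Layer `i` of the blown-up center. -/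
def layer (i : Fin k) : Finset ((↥K × Fin k) ⊕ Fin (2 * k)) :=
  (univ : Finset ↥K).image fun c => Sum.inl (c, i)

/-- The `i`-th clique. -/
def cliq (a b : Fin k → Fin (2 * k)) (i : Fin k) : Finset ((↥K × Fin k) ⊕ Fin (2 * k)) :=
  insert (Sum.inr (a i)) (insert (Sum.inr (b i)) (layer K k i))

lemma mem_cliq_inl (a b : Fin k → Fin (2 * k)) (i j : Fin k) (c : ↥K) :
    Sum.inl (c, j) ∈ cliq K k a b i ↔ i = j := by
  simp [cliq, layer]

lemma mem_cliq_inr (a b : Fin k → Fin (2 * k)) (i : Fin k) (j : Fin (2 * k)) :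
    Sum.inr j ∈ cliq K k a b i ↔ j = a i ∨ j = b i := by
  simp [cliq, layer]

lemma cliq_inj (a b : Fin k → Fin (2 * k)) (hab : Function.Injective (Sum.elim a b)) :
    ∀ i j, i ≠ j → Disjoint (cliq K k a b i) (cliq K k a b j) := by
  intro i j hij
  rw [disjoint_left]
  rintro (⟨c, l⟩ | l) h1 h2
  · rw [mem_cliq_inl] at h1 h2
    exact hij (h1.trans h2.symm)
  · rw [mem_cliq_inr] at h1 h2
    rcases h1 with h1 | h1 <;> rcases h2 with h2 | h2
    · have := @hab (Sum.inl i) (Sum.inl j) (h1.symm.trans h2)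
      simp_all
    · have := @hab (Sum.inl i) (Sum.inr j) (h1.symm.trans h2)
      simp_all
    · have := @hab (Sum.inr i) (Sum.inl j) (h1.symm.trans h2)
      simp_all
    · have := @hab (Sum.inr i) (Sum.inr j) (h1.symm.trans h2)
      simp_all

lemma tiling_of_matching (r : ℕ) (hr : 3 ≤ r) (hK : K.card = r - 2)
    (a b : Fin k → Fin (2 * k)) (hab : Function.Bijective (Sum.elim a b))
    (H : SimpleGraph ((↥K × Fin k) ⊕ Fin (2 * k)))
    (h1 : ∀ c c' i i', c ≠ c' → H.Adj (Sum.inl (c, i)) (Sum.inl (c', i')))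
    (h2 : ∀ c i j, H.Adj (Sum.inl (c, i)) (Sum.inr j))
    (h3 : ∀ i, H.Adj (Sum.inr (a i)) (Sum.inr (b i))) :
    IsKrTiling H r (univ.image (cliq K k a b)) := by
  refine ⟨?_, ?_, ?_⟩
  · intro Q hQ
    obtain ⟨i, -, rfl⟩ := mem_image.1 hQ
    constructor
    · rintro (⟨c, l⟩ | l) hx (⟨c', l'⟩ | l') hy hne
      · rw [mem_coe, mem_cliq_inl] at hx hy
        subst hx hy
        exact h1 _ _ _ _ (fun h => hne (by rw [h]))
      · exact h2 _ _ _
      · exact (h2 _ _ _).symm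
      · rw [mem_coe, mem_cliq_inr] at hx hy
        rcases hx with rfl | rfl <;> rcases hy with rfl | rfl
        · exact absurd rfl hne
        · exact h3 i
        · exact (h3 i).symm
        · exact absurd rfl hne
    · have hne : a i ≠ b i := fun h => by
        have := @hab.1 (Sum.inl i) (Sum.inr i) h
        simp at this
      have hl : (layer K k i).card = K.card := by
        unfold layer
        rw [card_image_of_injective]
        · simp
        · intro x y h
          simpa using h
      unfold cliq
      rw [card_insert_of_notMem, card_insert_of_notMem, hl]
      · omega
      · simp [layer]
      · simp [layer, hne]
  · intro Q hQ Q' hQ' hne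
    obtain ⟨i, -, rfl⟩ := mem_image.1 hQ
    obtain ⟨j, -, rfl⟩ := mem_image.1 hQ'
    exact cliq_inj K k a b hab.1 i j (fun h => hne (by rw [h]))
  · ext x
    simp only [mem_biUnion, mem_image, mem_univ, true_and, id, iff_true]
    rcases x with ⟨c, l⟩ | l
    · exact ⟨_, ⟨l, rfl⟩, (mem_cliq_inl ..).2 rfl⟩
    · obtain ⟨i | i, hi⟩ := hab.2 l
      · exact ⟨_, ⟨i, rfl⟩, (mem_cliq_inr ..).2 (Or.inl hi.symm)⟩
      · exact ⟨_, ⟨i, rfl⟩, (mem_cliq_inr ..).2 (Or.inr hi.symm)⟩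

lemma count_of_matching {q : ℕ} (f : Sym2 V → Fin q) (w : ℕ → V)
    (a b : Fin k → Fin (2 * k)) (hab : Function.Bijective (Sum.elim a b))
    (F' : Sym2 ((↥K × Fin k) ⊕ Fin (2 * k)) → Fin q)
    (hF2 : ∀ (c : ↥K) (i : Fin k) (j : Fin (2 * k)),
      F' s(Sum.inl (c, i), Sum.inr j) = f s((c : V), w j))
    (hF3 : ∀ j j' : Fin (2 * k), F' s(Sum.inr j, Sum.inr j') = f s(w j, w j')) (c : Fin q) :
    tilingColorCount F' (univ.image (cliq K k a b)) c =
      ∑ i, colCount F' (layer K k i) c +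
      ∑ j : Fin (2 * k), ∑ d : ↥K, (if f s((d : V), w j) = c then 1 else 0) +
      ∑ i, (if f s(w (a i), w (b i)) = c then 1 else 0) := by
  have hinj : Function.Injective (cliq K k a b) := by
    intro i j h
    by_contra hne
    have hd := cliq_inj K k a b hab.1 i j hne
    rw [h, disjoint_self_iff_empty] at hd
    have : Sum.inr (a j) ∈ cliq K k a b j := (mem_cliq_inr ..).2 (Or.inl rfl)
    rw [hd] at this
    simp at this
  have hD : ∀ D : Fin (2 * k) → ℕ, ∑ j, D j = ∑ i, D (a i) + ∑ i, D (b i) := by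
    intro D
    rw [← (Equiv.ofBijective _ hab).sum_comp, Fintype.sum_sum_type]
    simp
  have hlay : ∀ i j, ∑ y ∈ layer K k i, (if F' s(y, Sum.inr j) = c then 1 else 0) =
      ∑ d : ↥K, (if f s((d : V), w j) = c then 1 else 0) := by
    intro i j
    unfold layer
    rw [sum_image]
    · simp [hF2]
    · intro x _ y _ h
      simpa using h
  unfold tilingColorCount
  rw [sum_image (fun _ _ _ _ h => hinj h), hD, ← sum_add_distrib, ← sum_add_distrib,
    ← sum_add_distrib]
  refine sum_congr rfl fun i _ => ?_
  have hne : a i ≠ b i := fun h => by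
    have := @hab.1 (Sum.inl i) (Sum.inr i) h
    simp at this
  change colCount F' (cliq K k a b i) c = _
  unfold cliq
  rw [colCount_insert, colCount_insert, sum_insert, hlay, hlay, hF3, Sym2.eq_swap]
  · ring
  · simp [layer]
  · simp [layer]
  · simp [layer, hne]

end tile

/-- **Lemma (blowup of a template has tilings with distinct color profiles).**
Let `F` be a `K_r`-template in a `q`-edge-colored graph `(G, f)`: a clique `K` of size
`r − 2` (the center) together with an unbalanced cycle `w 0, …, w (2k−1)` (`k ∈ {2,3}`) in
the common neighborhood of `K`.  Let `F⁺` be the blowup of `F` in which every center vertex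
is replaced by an independent set of size `k` (here `H` on vertex type
`(↥K × Fin k) ⊕ Fin (2k)`, with the inherited coloring `F'`).  Then `F⁺` has two
`K_r`-tilings `T₁, T₂` and there is a color `c` appearing a different number of times in
`T₁` and in `T₂`. -/
theorem template_blowup_two_tilings (r q k : ℕ) (hr : 3 ≤ r) (hk : k = 2 ∨ k = 3)
    {V : Type} [Fintype V] [DecidableEq V]
    (G : SimpleGraph V) (f : Sym2 V → Fin q)
    (K : Finset V) (hK : G.IsNClique (r - 2) K)
    (w : ℕ → V)
    (hwinj : ∀ i < 2 * k, ∀ j < 2 * k, w i = w j → i = j)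
    (hwN : ∀ i < 2 * k, ∀ x ∈ K, G.Adj x (w i))
    (hwC : ∀ i < 2 * k, G.Adj (w i) (w ((i + 1) % (2 * k))))
    (hunbal :
      (↑((List.range k).map fun i => f s(w (2 * i), w (2 * i + 1))) : Multiset (Fin q)) ≠
      (↑((List.range k).map fun i =>
          f s(w (2 * i + 1), w ((2 * i + 2) % (2 * k)))) : Multiset (Fin q)))
    -- `H` is the blowup graph `F⁺`
    (H : SimpleGraph ((↥K × Fin k) ⊕ Fin (2 * k)))
    (hH : ∀ x y : (↥K × Fin k) ⊕ Fin (2 * k),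
      H.Adj x y ↔
        ((∃ (c : ↥K) (i : Fin k) (c' : ↥K) (i' : Fin k),
            x = Sum.inl (c, i) ∧ y = Sum.inl (c', i') ∧ (c : V) ≠ (c' : V)) ∨
         (∃ (c : ↥K) (i : Fin k) (j : Fin (2 * k)),
            x = Sum.inl (c, i) ∧ y = Sum.inr j) ∨
         (∃ (c : ↥K) (i : Fin k) (j : Fin (2 * k)),
            x = Sum.inr j ∧ y = Sum.inl (c, i)) ∨
         (∃ j j' : Fin (2 * k), x = Sum.inr j ∧ y = Sum.inr j' ∧
            (((j : ℕ) + 1) % (2 * k) = (j' : ℕ) ∨ ((j' : ℕ) + 1) % (2 * k) = (j : ℕ)))))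
    -- `F'` is the coloring of the blowup, inherited from `f`
    (F' : Sym2 ((↥K × Fin k) ⊕ Fin (2 * k)) → Fin q)
    (hF1 : ∀ (c c' : ↥K) (i i' : Fin k),
      F' s(Sum.inl (c, i), Sum.inl (c', i')) = f s((c : V), (c' : V)))
    (hF2 : ∀ (c : ↥K) (i : Fin k) (j : Fin (2 * k)),
      F' s(Sum.inl (c, i), Sum.inr j) = f s((c : V), w j))
    (hF3 : ∀ j j' : Fin (2 * k), F' s(Sum.inr j, Sum.inr j') = f s(w j, w j')) :
    ∃ T₁ T₂ : Finset (Finset ((↥K × Fin k) ⊕ Fin (2 * k))),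
      IsKrTiling H r T₁ ∧ IsKrTiling H r T₂ ∧
        ∃ c : Fin q, tilingColorCount F' T₁ c ≠ tilingColorCount F' T₂ c := by
  have hk0 : 0 < k := by omega
  let a₁ : Fin k → Fin (2 * k) := fun i => ⟨2 * i, by omega⟩
  let b₁ : Fin k → Fin (2 * k) := fun i => ⟨2 * i + 1, by omega⟩
  let b₂ : Fin k → Fin (2 * k) := fun i => ⟨(2 * i + 2) % (2 * k), Nat.mod_lt _ (by omega)⟩
  have hb1 : Function.Bijective (Sum.elim a₁ b₁) := matching_bij1 k hk
  have hb2 : Function.Bijective (Sum.elim b₁ b₂) := matching_bij2 k hk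
  have h1 : ∀ (c c' : ↥K) (i i' : Fin k), c ≠ c' → H.Adj (Sum.inl (c, i)) (Sum.inl (c', i')) :=
    fun c c' i i' h => (hH _ _).2
      (Or.inl ⟨c, i, c', i', rfl, rfl, fun h' => h (Subtype.ext h')⟩)
  have h2 : ∀ (c : ↥K) (i : Fin k) j, H.Adj (Sum.inl (c, i)) (Sum.inr j) :=
    fun c i j => (hH _ _).2 (Or.inr (Or.inl ⟨c, i, j, rfl, rfl⟩))
  refine ⟨univ.image (cliq K k a₁ b₁), univ.image (cliq K k b₁ b₂),
    tiling_of_matching K k r hr hK.2 _ _ hb1 H h1 h2 fun i => ?_,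
    tiling_of_matching K k r hr hK.2 _ _ hb2 H h1 h2 fun i => ?_, ?_⟩
  · refine (hH _ _).2 (Or.inr (Or.inr (Or.inr ⟨_, _, rfl, rfl, Or.inl ?_⟩)))
    exact Nat.mod_eq_of_lt (by simp only [a₁]; omega)
  · exact (hH _ _).2 (Or.inr (Or.inr (Or.inr ⟨_, _, rfl, rfl, Or.inl rfl⟩)))
  · by_contra hcon
    push Not at hcon
    apply hunbal
    ext c
    have := hcon c
    rw [count_of_matching K k f w _ _ hb1 F' hF2 hF3, count_of_matching K k f w _ _ hb2 F' hF2 hF3,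
      Nat.add_left_cancel_iff] at this
    have key : ∀ g : ℕ → Fin q, Multiset.count c (↑((List.range k).map g) : Multiset (Fin q)) =
        ∑ i : Fin k, (if g i = c then 1 else 0) := by
      intro g
      rcases hk with rfl | rfl
      · rw [Fin.sum_univ_two]
        simp [List.range_succ, List.count_cons]
        omega
      · rw [Fin.sum_univ_three]
        simp [List.range_succ, List.count_cons]
        omega
    rw [key, key]
    exact this
end

section
/- Let r ≥ 3 and q ≥ 2. For every ξ > 0 there exist ζ > 0 and n₀ such that the following holds for every n ≥ n₀ with r | n. Let (G,f) be a q-edge-colored graph on n vertices with minimum degree δ(G) ≥ ((r−1)/r + ξ)·n. Then at least one of the following holds: (1) there is a K_r-tiling T of G and a color c ∈ {1,…,q} such that c appears on at least a (1/q + ζ)-fraction of the edges of T; or (2) there is a subgraph G' of G (obtained by deleting vertices and edges) such that |V(G')| ≥ (1−ξ)n, δ(G') ≥ δ(G) − ξn, the coloring f restricted to G' contains no K_r-template, and the vertex set V(G) ∖ V(G') spans a K_r-tiling in G. -/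
open Finset

variable {V : Type*}

/-- `(G, f)` contains a `K_r`-template: a clique `K` of size `r − 2` together with an
unbalanced cycle of length `4` or `6` in the common neighborhood of `K`. -/
def HasKrTemplate {V : Type*} {q : ℕ} (G : SimpleGraph V) (f : Sym2 V → Fin q)
    (r : ℕ) : Prop :=
  ∃ (K : Finset V) (k : ℕ) (w : ℕ → V),
    G.IsNClique (r - 2) K ∧ (k = 2 ∨ k = 3) ∧
    (∀ i < 2 * k, ∀ j < 2 * k, w i = w j → i = j) ∧
    (∀ i < 2 * k, ∀ x ∈ K, G.Adj x (w i)) ∧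
    (∀ i < 2 * k, G.Adj (w i) (w ((i + 1) % (2 * k)))) ∧
    (↑((List.range k).map fun i => f s(w (2 * i), w (2 * i + 1))) : Multiset (Fin q)) ≠
      (↑((List.range k).map fun i =>
          f s(w (2 * i + 1), w ((2 * i + 2) % (2 * k)))) : Multiset (Fin q))



section HajnalSzemeredi
open scoped Classical

/-- colour class inside `S` -/
noncomputable def hsCls (S : Finset V) (f : V → ℕ) (c : ℕ) : Finset V := S.filter fun v => f v = c

def HsProper (H : SimpleGraph V) (S : Finset V) (f : V → ℕ) : Prop :=
  ∀ u ∈ S, ∀ v ∈ S, f u = f v → ¬ H.Adj u v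

/-- some vertex of class `c` can be moved to class `d` -/
def HsMv (H : SimpleGraph V) (S : Finset V) (f : V → ℕ) (c d : ℕ) : Prop :=
  c ≠ d ∧ ∃ y ∈ S, f y = c ∧ ∀ z ∈ S, f z = d → ¬ H.Adj y z

/-- class `c` reaches class `m` in `n` moves, through classes satisfying `P` -/
def HsAccN (H : SimpleGraph V) (S : Finset V) (f : V → ℕ) (m : ℕ) (P : ℕ → Prop) : ℕ → ℕ → Prop
  | 0, c => c = m ∧ P c
  | n + 1, c => P c ∧ ∃ c', HsMv H S f c c' ∧ HsAccN H S f m P n c'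

def HsAcc (H : SimpleGraph V) (S : Finset V) (f : V → ℕ) (m : ℕ) (P : ℕ → Prop) (c : ℕ) : Prop :=
  ∃ n, HsAccN H S f m P n c

variable {H : SimpleGraph V} {S : Finset V} {f : V → ℕ} {m : ℕ} {P : ℕ → Prop}

lemma HsAcc.base (h : P m) : HsAcc H S f m P m := ⟨0, rfl, h⟩

lemma HsAcc.step {c c' : ℕ} (h : P c) (hm : HsMv H S f c c') (ha : HsAcc H S f m P c') :
    HsAcc H S f m P c := by
  obtain ⟨n, hn⟩ := ha
  exact ⟨n + 1, h, c', hm, hn⟩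

lemma HsAcc.prop {c : ℕ} (h : HsAcc H S f m P c) : P c := by
  obtain ⟨n, hn⟩ := h
  cases n with
  | zero => exact hn.2
  | succ n => exact hn.1

lemma HsAcc.mono {f₁ : V → ℕ} {P₁ : ℕ → Prop}
    (hP : ∀ c, HsAcc H S f m P c → P₁ c)
    (hM : ∀ c d, P c → P d → HsMv H S f c d → HsMv H S f₁ c d) {c : ℕ}
    (h : HsAcc H S f m P c) : HsAcc H S f₁ m P₁ c := by
  obtain ⟨n, hn⟩ := h
  induction n generalizing c with
  | zero =>
    obtain ⟨rfl, h2⟩ := hn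
    exact HsAcc.base (hP _ (HsAcc.base h2))
  | succ n ih =>
    have hc : HsAcc H S f m P c := ⟨n + 1, hn⟩
    obtain ⟨h1, c', h2, h3⟩ := hn
    exact HsAcc.step (hP _ hc) (hM _ _ h1 (HsAcc.prop ⟨n, h3⟩) h2) (ih h3)

lemma HsAcc.through (U : ℕ) {c : ℕ} (h : HsAcc H S f m P c) :
    HsAcc H S f m (fun d => P d ∧ d ≠ U) c ∨
      (U = m ∨ ∃ c', HsMv H S f U c' ∧ HsAcc H S f m (fun d => P d ∧ d ≠ U) c') := by
  obtain ⟨n, hn⟩ := h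
  induction n generalizing c with
  | zero =>
    obtain ⟨rfl, h2⟩ := hn
    by_cases hU : U = c
    · exact Or.inr (Or.inl hU)
    · exact Or.inl (HsAcc.base ⟨h2, fun h => hU h.symm⟩)
  | succ n ih =>
    obtain ⟨h1, c', h2, h3⟩ := hn
    rcases ih h3 with h | h
    · by_cases hU : c = U
      · subst hU
        exact Or.inr (Or.inr ⟨c', h2, h⟩)
      · exact Or.inl (HsAcc.step ⟨h1, hU⟩ h2 h)
    · exact Or.inr h

lemma HsAcc.next {U : ℕ} (h : HsAcc H S f m P U) :
    U = m ∨ ∃ c', HsMv H S f U c' ∧ HsAcc H S f m (fun d => P d ∧ d ≠ U) c' := by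
  rcases HsAcc.through U h with h | h
  · exact absurd rfl h.prop.2
  · exact h

lemma hsAcc_rank (H : SimpleGraph V) (S : Finset V) (f : V → ℕ) (m : ℕ) (P : ℕ → Prop) :
    ∃ l : ℕ → ℕ, ∀ c, HsAcc H S f m P c → c ≠ m →
      ∃ c', HsMv H S f c c' ∧ HsAcc H S f m P c' ∧ l c' < l c := by
  refine ⟨fun c => sInf {n | HsAccN H S f m P n c}, fun c hc hcm => ?_⟩
  have hne : {n | HsAccN H S f m P n c}.Nonempty := hc
  have hmem := Nat.sInf_mem hne
  set k := sInf {n | HsAccN H S f m P n c} with hk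
  cases hk' : k with
  | zero =>
    rw [hk'] at hmem
    exact absurd hmem.1 hcm
  | succ n =>
    rw [hk'] at hmem
    obtain ⟨_, c', h2, h3⟩ := hmem
    have h4 : sInf {n | HsAccN H S f m P n c'} ≤ n := Nat.sInf_le (show n ∈ {n | _} from h3)
    refine ⟨c', h2, ⟨n, h3⟩, ?_⟩
    show sInf {n | HsAccN H S f m P n c'} < sInf {n | HsAccN H S f m P n c}
    omega

lemma hsCls_update [DecidableEq V] {y : V} (hy : y ∈ S) (c d : ℕ) :
    (hsCls S (Function.update f y c) d).card + (if d = f y then 1 else 0) =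
      (hsCls S f d).card + (if d = c then 1 else 0) := by
  unfold hsCls
  rw [Finset.card_filter, Finset.card_filter, ← Finset.add_sum_erase _ _ hy,
    ← Finset.add_sum_erase (a := y) S (fun i => if f i = d then 1 else 0) hy]
  have : ∑ x ∈ S.erase y, (if Function.update f y c x = d then 1 else 0) =
      ∑ x ∈ S.erase y, (if f x = d then 1 else 0) := by
    refine Finset.sum_congr rfl fun x hx => ?_
    rw [Function.update_of_ne (Finset.ne_of_mem_erase hx)]
  rw [this, Function.update_self]
  simp only [eq_comm (a := d)]
  omega

lemma hsProper_update [DecidableEq V] (hf : HsProper H S f) {y : V} {c : ℕ}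
    (hc : ∀ z ∈ S, f z = c → ¬ H.Adj y z) : HsProper H S (Function.update f y c) := by
  intro u hu v hv huv
  by_cases h1 : u = y
  · subst h1
    by_cases h2 : v = u
    · subst h2; exact H.loopless.irrefl _
    · rw [Function.update_self, Function.update_of_ne h2] at huv
      exact hc v hv huv.symm
  · by_cases h2 : v = y
    · subst h2
      rw [Function.update_self, Function.update_of_ne h1] at huv
      exact fun h => hc u hu huv h.symm
    · rw [Function.update_of_ne h1, Function.update_of_ne h2] at huv
      exact hf u hu v hv huv

/-- shifting along a ranked path -/
lemma hs_shift_rank [DecidableEq V] (l : ℕ → ℕ) (N : ℕ) : ∀ (f : V → ℕ) (c : ℕ), l c ≤ N →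
    HsProper H S f → P c →
    (∀ c', P c' → l c' ≤ l c → c' ≠ m → ∃ d, HsMv H S f c' d ∧ P d ∧ l d < l c') →
    ∃ f' : V → ℕ, HsProper H S f' ∧ (∀ v, ¬ P (f v) → f' v = f v) ∧ (∀ v, P (f v) → P (f' v)) ∧
      ∀ d, (hsCls S f' d).card + (if d = c then 1 else 0) =
        (hsCls S f d).card + (if d = m then 1 else 0) := by
  induction N with
  | zero =>
    intro f c hl hf hc hr
    by_cases hcm : c = m
    · subst hcm
      exact ⟨f, hf, fun _ _ => rfl, fun _ h => h, fun _ => rfl⟩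
    · obtain ⟨d, _, _, hd⟩ := hr c hc le_rfl hcm
      omega
  | succ N ih =>
    intro f c hl hf hc hr
    by_cases hcm : c = m
    · subst hcm
      exact ⟨f, hf, fun _ _ => rfl, fun _ h => h, fun _ => rfl⟩
    · obtain ⟨d, ⟨hcd, y, hy, hyc, hyd⟩, hPd, hd⟩ := hr c hc le_rfl hcm
      obtain ⟨f', h1, h2, h3, h4⟩ := ih (Function.update f y d) d (by omega)
        (hsProper_update hf hyd) hPd (by
          intro c' hc' hl' hm'
          obtain ⟨e, ⟨hne, x, hx, hxc, hxe⟩, hPe, hle⟩ := hr c' hc' (by omega) hm'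
          refine ⟨e, ⟨hne, x, hx, ?_, ?_⟩, hPe, hle⟩
          · rw [Function.update_of_ne, hxc]
            rintro rfl
            rw [hxc] at hyc; subst hyc; omega
          · intro z hz hze
            by_cases hzy : z = y
            · subst hzy
              rw [Function.update_self] at hze
              subst hze; omega
            · rw [Function.update_of_ne hzy] at hze
              exact hxe z hz hze)
      refine ⟨f', h1, ?_, ?_, ?_⟩
      · intro v hv
        have hvy : v ≠ y := by rintro rfl; rw [hyc] at hv; exact hv hc
        have := h2 v (by rwa [Function.update_of_ne hvy])
        rwa [Function.update_of_ne hvy] at this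
      · intro v hv
        apply h3
        by_cases hvy : v = y
        · subst hvy; rwa [Function.update_self]
        · rwa [Function.update_of_ne hvy]
      · intro e
        have := h4 e
        have h5 := hsCls_update (f := f) hy d e
        rw [hyc] at h5
        omega

lemma hs_shift [DecidableEq V] (hf : HsProper H S f) {c : ℕ} (hc : HsAcc H S f m P c) :
    ∃ f' : V → ℕ, HsProper H S f' ∧ (∀ v, ¬ P (f v) → f' v = f v) ∧ (∀ v, P (f v) → P (f' v)) ∧
      ∀ d, (hsCls S f' d).card + (if d = c then 1 else 0) =
        (hsCls S f d).card + (if d = m then 1 else 0) := by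
  obtain ⟨l, hl⟩ := hsAcc_rank H S f m P
  obtain ⟨f', h1, h2, h3, h4⟩ := hs_shift_rank (H := H) (S := S) (P := HsAcc H S f m P) (m := m)
    l (l c) f c le_rfl hf hc (fun c' hc' _ hm' => hl c' hc' hm')
  refine ⟨f', h1, fun v hv => h2 v fun h => hv h.prop, fun v hv => ?_, h4⟩
  by_cases h : HsAcc H S f m P (f v)
  · exact (h3 v h).prop
  · rw [h2 v h]; exact hv

end HajnalSzemeredi


section HajnalSzemeredi
open scoped Classical
variable {H : SimpleGraph V} {S : Finset V} {f : V → ℕ} {m : ℕ} {P : ℕ → Prop}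

lemma hs_terminal (A : Finset ℕ) (hA : ∀ c ∈ A, HsAcc H S f m (· ∈ A) c) (hm : m ∈ A)
    (hne : ∃ c ∈ A, c ≠ m) :
    ∃ U ∈ A, ∃ T ⊆ A, T.Nonempty ∧ U ∉ T ∧ m ∉ T ∧
      (∀ W ∈ T, ∀ c ∈ A, c ≠ W → HsAcc H S f m (fun d => d ∈ A ∧ d ≠ W) c) ∧
      (∀ W ∈ T, ∀ c ∈ A, c ∉ T → c ≠ U → ¬ HsMv H S f W c) := by
  let T : ℕ → Finset ℕ := fun U =>
    A.filter fun c => c ≠ U ∧ ¬ HsAcc H S f m (fun d => d ∈ A ∧ d ≠ U) c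
  have hex : (A.filter fun U => (T U).Nonempty).Nonempty := by
    obtain ⟨c, hc, hcm⟩ := hne
    refine ⟨m, Finset.mem_filter.2 ⟨hm, c, Finset.mem_filter.2 ⟨hc, hcm, ?_⟩⟩⟩
    rintro ⟨n, hn⟩
    induction n generalizing c with
    | zero => exact hcm hn.1
    | succ n ih =>
      obtain ⟨_, c', _, h3⟩ := hn
      have := HsAcc.prop ⟨n, h3⟩
      exact ih c' this.1 this.2 h3
  obtain ⟨U, hU, hmin⟩ := Finset.exists_min_image _ (fun U => (T U).card) hex
  rw [Finset.mem_filter] at hU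
  have hTmem : ∀ U c, c ∈ T U ↔ c ∈ A ∧ c ≠ U ∧ ¬ HsAcc H S f m (fun d => d ∈ A ∧ d ≠ U) c :=
    fun U c => Finset.mem_filter
  refine ⟨U, hU.1, T U, Finset.filter_subset _ _, hU.2, ?_, ?_, ?_, ?_⟩
  · intro h; exact ((hTmem _ _).1 h).2.1 rfl
  · intro h
    have := (hTmem _ _).1 h
    exact this.2.2 (HsAcc.base ⟨hm, this.2.1⟩)
  · intro W hW c hc hcW
    by_contra hcon
    have hWA := (hTmem _ _).1 hW
    have hcT : c ∈ T W := (hTmem _ _).2 ⟨hc, hcW, hcon⟩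
    have key : ∀ d, HsAcc H S f m (fun d => d ∈ A ∧ d ≠ U) d →
        HsAcc H S f m (fun d => d ∈ A ∧ d ≠ W) d := by
      intro d hd
      refine HsAcc.mono (fun e he => ⟨he.prop.1, ?_⟩) (fun _ _ _ _ h => h) hd
      rintro rfl
      exact hWA.2.2 he
    have hsub : T W ⊆ (T U).erase W := by
      intro d hd
      have hd' := (hTmem _ _).1 hd
      refine Finset.mem_erase.2 ⟨hd'.2.1, (hTmem _ _).2 ⟨hd'.1, ?_, fun h => hd'.2.2 (key _ h)⟩⟩
      rintro rfl
      rcases (hA d hd'.1).next with h | ⟨c', h1, h2⟩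
      · subst h
        exact hd'.2.2 (HsAcc.base ⟨hm, hd'.2.1⟩)
      · exact hd'.2.2 (HsAcc.step ⟨hd'.1, hd'.2.1⟩ h1 (key _ h2))
    have h1 := Finset.card_le_card hsub
    rw [Finset.card_erase_of_mem hW] at h1
    have h2 := hmin W (Finset.mem_filter.2 ⟨hWA.1, c, hcT⟩)
    have h3 : 0 < (T U).card := Finset.card_pos.2 ⟨W, hW⟩
    omega
  · intro W hW c hc hcT hcU hmv
    have hWA := (hTmem _ _).1 hW
    apply hWA.2.2
    refine HsAcc.step ⟨hWA.1, hWA.2.1⟩ hmv ?_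
    by_contra hcon
    exact hcT ((hTmem _ _).2 ⟨hc, hcU, hcon⟩)

/-- neighbours of `v` in `X` -/
noncomputable def hsDg (H : SimpleGraph V) (X : Finset V) (v : V) : ℕ := (X.filter (H.Adj v)).card

lemma hsDg_pos {X : Finset V} {v z : V} (hz : z ∈ X) (h : H.Adj v z) : 1 ≤ hsDg H X v :=
  Finset.card_pos.2 ⟨z, Finset.mem_filter.2 ⟨hz, h⟩⟩

lemma hsDg_sum_le (A D : Finset ℕ) (hD : D ⊆ A) (v : V) :
    ∑ c ∈ D, hsDg H (hsCls S f c) v + hsDg H (S.filter fun v => f v ∉ A) v ≤ hsDg H S v := by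
  unfold hsDg hsCls
  simp only [Finset.filter_filter, Finset.card_filter]
  rw [Finset.sum_comm, ← Finset.sum_add_distrib]
  refine Finset.sum_le_sum fun z _ => ?_
  by_cases h : H.Adj v z
  · simp only [h, and_true, if_true, Finset.sum_ite_eq]
    by_cases h2 : f z ∈ D
    · simp [h2, hD h2]
    · simp only [h2, if_false]; split_ifs <;> simp
  · simp [h]

lemma hsDg_swap (X Y : Finset V) : ∑ x ∈ X, hsDg H Y x = ∑ y ∈ Y, hsDg H X y := by
  unfold hsDg
  simp only [Finset.card_filter]
  rw [Finset.sum_comm]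
  simp only [H.adj_comm]

lemma hs_indep (B : Finset V) : ∃ I ⊆ B, (∀ x ∈ I, ∀ y ∈ I, ¬ H.Adj x y) ∧
    B.card ≤ ∑ y ∈ I, (hsDg H B y + 1) := by
  have hne : (B.powerset.filter fun I => ∀ x ∈ I, ∀ y ∈ I, ¬ H.Adj x y).Nonempty :=
    ⟨∅, by simp⟩
  obtain ⟨I, hI, hmax⟩ := Finset.exists_max_image _ Finset.card hne
  simp only [Finset.mem_filter, Finset.mem_powerset] at hI hmax
  refine ⟨I, hI.1, hI.2, ?_⟩
  have hcov : B ⊆ I.biUnion fun y => insert y (B.filter (H.Adj y)) := by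
    intro v hv
    by_contra hcon
    simp only [Finset.mem_biUnion, Finset.mem_insert, Finset.mem_filter, not_exists, not_and,
      not_or] at hcon
    have hvI : v ∉ I := fun h => (hcon v h).1 rfl
    have := hmax (insert v I) ⟨Finset.insert_subset hv hI.1, by
      intro x hx y hy
      rcases Finset.mem_insert.1 hx with hx' | hx'
      · rcases Finset.mem_insert.1 hy with hy' | hy'
        · rw [hx', hy']; exact H.loopless.irrefl _
        · rw [hx']; exact fun h => (hcon y hy').2 hv h.symm
      · rcases Finset.mem_insert.1 hy with hy' | hy'
        · rw [hy']; exact fun h => (hcon x hx').2 hv h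
        · exact hI.2 x hx' y hy'⟩
    rw [Finset.card_insert_of_notMem hvI] at this
    omega
  refine (Finset.card_le_card hcov).trans (Finset.card_biUnion_le.trans ?_)
  exact Finset.sum_le_sum fun y _ => Finset.card_insert_le _ _

/-- `z` is the only neighbour of `y` in its class -/
def HsSolo (H : SimpleGraph V) (S : Finset V) (f : V → ℕ) (y z : V) : Prop :=
  H.Adj y z ∧ ∀ z' ∈ S, f z' = f z → H.Adj y z' → z' = z

lemma hs_count {A T : Finset ℕ} {B : Finset V} {b s U : ℕ} (hB : B = S.filter fun v => f v ∉ A)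
    (hTA : T ⊆ A) (hUA : U ∈ A) (hUT : U ∉ T) (hTne : T.Nonempty)
    (hdeg : ∀ v ∈ S, hsDg H S v < A.card + b)
    (hF1 : ∀ y ∈ B, ∀ c ∈ A, ∃ z ∈ S, f z = c ∧ H.Adj y z)
    (hBc : B.card = b * s + 1)
    (hs : ∀ c ∈ T, (hsCls S f c).card = s)
    (hF4 : ∀ z ∈ S, f z ∈ T → ∀ c ∈ A, c ∉ T → c ≠ U → ∃ x ∈ S, f x = c ∧ H.Adj z x)
    (hsolo : ∀ z ∈ S, f z ∈ T → ∀ y ∈ B, HsSolo H S f y z → ∀ c ∈ A, c ≠ f z →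
      ∃ x ∈ S, f x = c ∧ H.Adj z x) :
    ∃ z ∈ S, f z ∈ T ∧ hsDg H B z ≤ b ∧ ∃ y₁ ∈ B, ∃ y₂ ∈ B, y₁ ≠ y₂ ∧ ¬ H.Adj y₁ y₂ ∧
      HsSolo H S f y₁ z ∧ HsSolo H S f y₂ z := by
  have hBS : B ⊆ S := hB ▸ Finset.filter_subset _ _
  have hone : ∀ v, ∀ D ⊆ A, (∀ c ∈ D, ∃ x ∈ S, f x = c ∧ H.Adj v x) →
      D.card + hsDg H B v ≤ hsDg H S v := by
    intro v D hD h
    have h1 := hsDg_sum_le (H := H) (S := S) (f := f) A D hD v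
    rw [← hB] at h1
    have h2 : D.card ≤ ∑ c ∈ D, hsDg H (hsCls S f c) v := by
      rw [Finset.card_eq_sum_ones]
      refine Finset.sum_le_sum fun c hc => ?_
      obtain ⟨x, hx, hxc, hadj⟩ := h c hc
      exact hsDg_pos (Finset.mem_filter.2 ⟨hx, hxc⟩) hadj
    omega
  have hsoloB : ∀ z ∈ S, f z ∈ T → ∀ y ∈ B, HsSolo H S f y z → hsDg H B z ≤ b := by
    intro z hz hzT y hy hyz
    have h1 := hone z (A.erase (f z)) (Finset.erase_subset _ _) (fun c hc =>
      hsolo z hz hzT y hy hyz c (Finset.mem_of_mem_erase hc) (Finset.ne_of_mem_erase hc))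
    rw [Finset.card_erase_of_mem (hTA hzT)] at h1
    have := hdeg z hz
    have : 0 < A.card := Finset.card_pos.2 ⟨_, hUA⟩
    omega
  have hnsB : ∀ z ∈ S, f z ∈ T → hsDg H B z ≤ T.card + b := by
    intro z hz hzT
    have h1 := hone z ((A \ T).erase U) ((Finset.erase_subset _ _).trans Finset.sdiff_subset)
      (fun c hc => by
        have h2 := Finset.mem_sdiff.1 (Finset.mem_of_mem_erase hc)
        exact hF4 z hz hzT c h2.1 h2.2 (Finset.ne_of_mem_erase hc))
    rw [Finset.card_erase_of_mem (Finset.mem_sdiff.2 ⟨hUA, hUT⟩), Finset.card_sdiff_of_subset hTA] at h1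
    have := hdeg z hz
    have h3 := Finset.card_lt_card (Finset.ssubset_iff_subset_ne.2 ⟨hTA, fun h => hUT (h ▸ hUA)⟩)
    omega
  -- t > b
  have htb : b < T.card := by
    obtain ⟨W, hW⟩ := hTne
    let SW := (hsCls S f W).filter fun z => ∃ y ∈ B, HsSolo H S f y z
    let DW := (hsCls S f W).filter fun z => ¬ ∃ y ∈ B, HsSolo H S f y z
    have hsum : SW.card + DW.card = s := by
      rw [← hs W hW]; exact Finset.card_filter_add_card_filter_not _
    have hy : ∀ y ∈ B, 2 ≤ 2 * hsDg H SW y + hsDg H DW y := by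
      intro y hy
      obtain ⟨z, hz, hzW, hyz⟩ := hF1 y hy W (hTA hW)
      by_cases h1 : 1 ≤ hsDg H SW y
      · omega
      have hSW0 : ∀ x ∈ S, f x = W → H.Adj y x → ¬ ∃ y ∈ B, HsSolo H S f y x := by
        intro x hx hxW hyx hex
        exact h1 (hsDg_pos (Finset.mem_filter.2 ⟨Finset.mem_filter.2 ⟨hx, hxW⟩, hex⟩) hyx)
      have hns : ¬ HsSolo H S f y z := fun h => hSW0 z hz hzW hyz ⟨y, hy, h⟩
      have hex : ∃ z' ∈ S, f z' = W ∧ H.Adj y z' ∧ z' ≠ z := by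
        by_contra hcon
        push Not at hcon
        exact hns ⟨hyz, fun z' h1 h2 h3 => hcon z' h1 (h2.trans hzW) h3⟩
      obtain ⟨z', hz', hzW', hyz', hne⟩ := hex
      have : 2 ≤ hsDg H DW y := by
        have hsub : ({z, z'} : Finset V) ⊆ DW.filter (H.Adj y) := by
          intro x hx
          simp only [Finset.mem_insert, Finset.mem_singleton] at hx
          rcases hx with rfl | rfl
          · exact Finset.mem_filter.2 ⟨Finset.mem_filter.2 ⟨Finset.mem_filter.2 ⟨hz, hzW⟩,
              hSW0 _ hz hzW hyz⟩, hyz⟩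
          · exact Finset.mem_filter.2 ⟨Finset.mem_filter.2 ⟨Finset.mem_filter.2 ⟨hz', hzW'⟩,
              hSW0 _ hz' hzW' hyz'⟩, hyz'⟩
        have := Finset.card_le_card hsub
        rwa [Finset.card_pair hne.symm] at this
      omega
    have h1 : ∑ y ∈ B, 2 ≤ ∑ y ∈ B, (2 * hsDg H SW y + hsDg H DW y) := Finset.sum_le_sum hy
    rw [Finset.sum_add_distrib, ← Finset.mul_sum, hsDg_swap, hsDg_swap B DW, Finset.sum_const,
      smul_eq_mul] at h1
    have h2 : ∑ z ∈ SW, hsDg H B z ≤ SW.card * b := by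
      rw [← smul_eq_mul]
      refine Finset.sum_le_card_nsmul _ _ _ fun z hz => ?_
      obtain ⟨hz1, y, hy, hyz⟩ := Finset.mem_filter.1 hz
      obtain ⟨hz2, hz3⟩ := Finset.mem_filter.1 hz1
      exact hsoloB z hz2 (hz3 ▸ hW) y hy hyz
    have h3 : ∑ z ∈ DW, hsDg H B z ≤ DW.card * (T.card + b) := by
      rw [← smul_eq_mul]
      refine Finset.sum_le_card_nsmul _ _ _ fun z hz => ?_
      obtain ⟨hz1, -⟩ := Finset.mem_filter.1 hz
      obtain ⟨hz2, hz3⟩ := Finset.mem_filter.1 hz1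
      exact hnsB z hz2 (hz3 ▸ hW)
    by_contra hcon
    push Not at hcon
    have h4 : DW.card * (T.card + b) ≤ DW.card * (2 * b) := Nat.mul_le_mul_left _ (by omega)
    rw [hBc, ← hsum] at h1
    nlinarith
  -- solo neighbours
  let AT := S.filter fun z => f z ∈ T
  have hAT : AT.card = T.card * s := by
    rw [← smul_eq_mul, ← Finset.sum_const, ← Finset.sum_congr rfl hs]
    unfold hsCls
    have := Finset.card_eq_sum_card_fiberwise (s := AT) (f := f) (t := T)
      (fun z hz => (Finset.mem_filter.1 hz).2)
    rw [this]
    refine Finset.sum_congr rfl fun c hc => ?_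
    congr 1
    ext z
    simp only [AT, Finset.mem_filter]
    constructor
    · rintro ⟨⟨h1, h2⟩, h3⟩; exact ⟨h1, h3⟩
    · rintro ⟨h1, h3⟩; exact ⟨⟨h1, h3 ▸ hc⟩, h3⟩
  have hsig : ∀ y ∈ B, T.card + hsDg H B y + 1 ≤ (AT.filter (HsSolo H S f y)).card + b := by
    intro y hy
    have h1 := hsDg_sum_le (H := H) (S := S) (f := f) A A (Finset.Subset.refl _) y
    rw [← hB] at h1
    have h2 := hdeg y (hBS hy)
    have h3 : ∑ c ∈ A, hsDg H (hsCls S f c) y = ∑ c ∈ A \ T, hsDg H (hsCls S f c) y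
      + ∑ c ∈ T, hsDg H (hsCls S f c) y := (Finset.sum_sdiff hTA).symm
    have h4 : (A \ T).card ≤ ∑ c ∈ A \ T, hsDg H (hsCls S f c) y := by
      rw [Finset.card_eq_sum_ones]
      refine Finset.sum_le_sum fun c hc => ?_
      obtain ⟨x, hx, hxc, hadj⟩ := hF1 y hy c (Finset.mem_sdiff.1 hc).1
      exact hsDg_pos (Finset.mem_filter.2 ⟨hx, hxc⟩) hadj
    have h5 : ∑ c ∈ T, 2 ≤ ∑ c ∈ T, (hsDg H (hsCls S f c) y +
        ((AT.filter (HsSolo H S f y)).filter fun z => f z = c).card) := by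
      refine Finset.sum_le_sum fun c hc => ?_
      obtain ⟨z, hz, hzc, hadj⟩ := hF1 y hy c (hTA hc)
      have h6 : 1 ≤ hsDg H (hsCls S f c) y := hsDg_pos (Finset.mem_filter.2 ⟨hz, hzc⟩) hadj
      by_cases hso : HsSolo H S f y z
      · have : 0 < ((AT.filter (HsSolo H S f y)).filter fun z => f z = c).card :=
          Finset.card_pos.2 ⟨z, by simp only [AT, Finset.mem_filter]; exact ⟨⟨⟨hz, hzc ▸ hc⟩, hso⟩, hzc⟩⟩
        omega
      · have hex : ∃ z' ∈ S, f z' = c ∧ H.Adj y z' ∧ z' ≠ z := by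
          by_contra hcon
          push Not at hcon
          exact hso ⟨hadj, fun z' h1 h2 h3 => hcon z' h1 (h2.trans hzc) h3⟩
        obtain ⟨z', hz', hzc', hadj', hne⟩ := hex
        have : 2 ≤ hsDg H (hsCls S f c) y := by
          have hsub : ({z, z'} : Finset V) ⊆ (hsCls S f c).filter (H.Adj y) := by
            intro x hx
            simp only [Finset.mem_insert, Finset.mem_singleton] at hx
            rcases hx with rfl | rfl
            · exact Finset.mem_filter.2 ⟨Finset.mem_filter.2 ⟨hz, hzc⟩, hadj⟩
            · exact Finset.mem_filter.2 ⟨Finset.mem_filter.2 ⟨hz', hzc'⟩, hadj'⟩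
          have := Finset.card_le_card hsub
          rwa [Finset.card_pair hne.symm] at this
        omega
    rw [Finset.sum_add_distrib, Finset.sum_const, smul_eq_mul,
      ← Finset.card_eq_sum_card_fiberwise (s := AT.filter (HsSolo H S f y)) (f := f) (t := T)
      (fun z hz => (Finset.mem_filter.1 (Finset.mem_filter.1 hz).1).2)] at h5
    rw [Finset.card_sdiff_of_subset hTA] at h4
    have := Finset.card_le_card hTA
    omega
  obtain ⟨I, hIB, hI, hIsum⟩ := hs_indep (H := H) B
  have hdB : ∀ y ∈ B, hsDg H B y + 1 ≤ b := by
    intro y hy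
    have h1 := hone y A (Finset.Subset.refl _) (hF1 y hy)
    have := hdeg y (hBS hy)
    omega
  have hIs : s < I.card := by
    have h1 : ∑ y ∈ I, (hsDg H B y + 1) ≤ I.card * b := by
      rw [← smul_eq_mul]
      exact Finset.sum_le_card_nsmul _ _ _ fun y hy => hdB y (hIB hy)
    by_contra hcon
    push Not at hcon
    have := Nat.mul_le_mul_right b hcon
    nlinarith
  have hbig : AT.card < ∑ y ∈ I, (AT.filter (HsSolo H S f y)).card := by
    have h1 : ∑ y ∈ I, (T.card + (hsDg H B y + 1)) ≤
        ∑ y ∈ I, ((AT.filter (HsSolo H S f y)).card + b) :=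
      Finset.sum_le_sum fun y hy => by have := hsig y (hIB hy); omega
    rw [Finset.sum_add_distrib (f := fun _ => T.card),
      Finset.sum_add_distrib (g := fun _ => b), Finset.sum_const, Finset.sum_const,
      smul_eq_mul, smul_eq_mul] at h1
    rw [hAT]
    obtain ⟨e, he⟩ := Nat.exists_eq_add_of_lt htb
    obtain ⟨e', he'⟩ := Nat.exists_eq_add_of_lt hIs
    rw [he] at h1 ⊢
    rw [he'] at h1
    nlinarith
  have hswap : ∑ y ∈ I, (AT.filter (HsSolo H S f y)).card =
      ∑ z ∈ AT, (I.filter fun y => HsSolo H S f y z).card := by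
    simp only [Finset.card_filter]
    exact Finset.sum_comm
  have hex : ∃ z ∈ AT, 1 < (I.filter fun y => HsSolo H S f y z).card := by
    by_contra hcon
    push Not at hcon
    have := Finset.sum_le_card_nsmul _ _ _ hcon
    rw [← hswap, smul_eq_mul, mul_one] at this
    omega
  obtain ⟨z, hz, hzc⟩ := hex
  obtain ⟨y₁, hy₁, y₂, hy₂, hne⟩ := Finset.one_lt_card.1 hzc
  rw [Finset.mem_filter] at hy₁ hy₂ hz
  exact ⟨z, hz.1, hz.2, hsoloB z hz.1 hz.2 y₁ (hIB hy₁.1) hy₁.2, y₁, hIB hy₁.1, y₂, hIB hy₂.1, hne,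
    hI y₁ hy₁.1 y₂ hy₂.1, hy₁.2, hy₂.2⟩

end HajnalSzemeredi


section HajnalSzemeredi
open scoped Classical
variable {H : SimpleGraph V} {S : Finset V} {f : V → ℕ} {m : ℕ} {P : ℕ → Prop}

def HsEq (H : SimpleGraph V) (S : Finset V) (C : Finset ℕ) (f : V → ℕ) (s : ℕ) : Prop :=
  (∀ v ∈ S, f v ∈ C) ∧ HsProper H S f ∧ ∀ c ∈ C, (hsCls S f c).card = s

lemma hsDg_mono {X Y : Finset V} (h : X ⊆ Y) (v : V) : hsDg H X v ≤ hsDg H Y v :=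
  Finset.card_le_card (Finset.filter_subset_filter _ h)

lemma hs_case_one [DecidableEq V] {A C : Finset ℕ} {B : Finset V} {s p : ℕ} {g : V → ℕ} {y z : V}
    {c : ℕ}
    (hfC : ∀ v ∈ S, f v ∈ C) (hf : HsProper H S f) (hAC : A ⊆ C)
    (hsz : ∀ c ∈ C, (hsCls S f c).card + (if c = m then 1 else 0) = s + (if c = p then 1 else 0))
    (hp : p ∉ A) (hm : m ∈ A) (hB : B = S.filter fun v => f v ∉ A)
    (hz : z ∈ S) (hzA : f z ∈ A) (hy : y ∈ B) (hsolo : HsSolo H S f y z)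
    (hg : HsEq H (B.erase y) (C \ A) g s)
    (hcA : c ∈ A) (hcz : c ≠ f z) (hzc : ∀ x ∈ S, f x = c → ¬ H.Adj z x)
    (hacc : HsAcc H S f m (fun d => d ∈ A ∧ d ≠ f z) c) : ∃ h, HsEq H S C h s := by
  have hyB : y ∈ S ∧ f y ∉ A := by rw [hB] at hy; exact Finset.mem_filter.1 hy
  have hyz : y ≠ z := by rintro rfl; exact hyB.2 hzA
  let f1 := Function.update (Function.update f z c) y (f z)
  have f1y : f1 y = f z := Function.update_self ..
  have f1z : f1 z = c := by
    show Function.update (Function.update f z c) y (f z) z = c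
    rw [Function.update_of_ne hyz.symm, Function.update_self]
  have f1o : ∀ v, v ≠ y → v ≠ z → f1 v = f v := by
    intro v h1 h2
    show Function.update (Function.update f z c) y (f z) v = f v
    rw [Function.update_of_ne h1, Function.update_of_ne h2]
  have hf1 : HsProper H S f1 := by
    refine hsProper_update (hsProper_update hf hzc) ?_
    intro x hx hxz hadj
    by_cases h : x = z
    · subst h; rw [Function.update_self] at hxz; exact hcz hxz
    · rw [Function.update_of_ne h] at hxz
      exact h (hsolo.2 x hx hxz hadj)
  have hM : ∀ d e, d ∈ A → d ≠ f z → e ≠ f z → e ≠ c → HsMv H S f d e → HsMv H S f1 d e := by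
    rintro d e hd hdz he hec ⟨hde, x, hx, hxd, hxe⟩
    refine ⟨hde, x, hx, ?_, ?_⟩
    · rw [f1o, hxd]
      · rintro rfl; exact hyB.2 (hxd ▸ hd)
      · rintro rfl; exact hdz hxd.symm
    · intro v hv hve
      by_cases h1 : v = y
      · subst h1; exact absurd (hve.symm.trans f1y) he
      by_cases h2 : v = z
      · subst h2; exact absurd (hve.symm.trans f1z) hec
      rw [f1o v h1 h2] at hve
      exact hxe v hv hve
  have hacc1 : HsAcc H S f1 m (fun d => d ∈ A ∧ d ≠ f z) c := by
    rcases hacc.next with h | ⟨c', h1, h2⟩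
    · subst h; exact HsAcc.base ⟨hcA, hcz⟩
    · refine HsAcc.step ⟨hcA, hcz⟩ (hM _ _ hcA hcz h2.prop.1.2 h2.prop.2 h1) ?_
      exact h2.mono (fun d hd => hd.prop.1) (fun d e hd he => hM d e hd.1.1 hd.1.2 he.1.2 he.2)
  obtain ⟨f2, h1, h2, h3, h4⟩ := hs_shift hf1 hacc1
  have hAA : ∀ v, f1 v ∈ A → f2 v ∈ A := by
    intro v hv
    by_cases h : f1 v = f z
    · rw [h2 v fun h' => h'.2 h]; exact hv
    · exact (h3 v ⟨hv, h⟩).1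
  have hAn : ∀ v, f1 v ∉ A → f2 v ∉ A := by
    intro v hv
    rw [h2 v fun h' => hv h'.1]; exact hv
  have hmemB : ∀ v ∈ S, f1 v ∉ A ↔ v ∈ B.erase y := by
    intro v hv
    rw [Finset.mem_erase, hB, Finset.mem_filter]
    by_cases h1 : v = y
    · subst h1; simp [f1y, hzA]
    by_cases h2 : v = z
    · subst h2; simp [f1z, hcA, hzA]
    rw [f1o v h1 h2]; simp [h1, hv]
  let h : V → ℕ := fun v => if f1 v ∈ A then f2 v else g v
  have hh1 : ∀ v, f1 v ∈ A → h v = f2 v := fun v hv => if_pos hv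
  have hh2 : ∀ v, f1 v ∉ A → h v = g v := fun v hv => if_neg hv
  have hgm : ∀ v ∈ S, f1 v ∉ A → g v ∈ C ∧ g v ∉ A := fun v hv h =>
    Finset.mem_sdiff.1 (hg.1 v ((hmemB v hv).1 h))
  refine ⟨h, ?_, ?_, ?_⟩
  · intro v hv
    by_cases hA : f1 v ∈ A
    · rw [hh1 v hA]; exact hAC (hAA v hA)
    · rw [hh2 v hA]; exact (hgm v hv hA).1
  · intro u hu v hv huv
    by_cases hu' : f1 u ∈ A <;> by_cases hv' : f1 v ∈ A
    · rw [hh1 u hu', hh1 v hv'] at huv; exact h1 u hu v hv huv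
    · rw [hh1 u hu', hh2 v hv'] at huv
      exact absurd (huv ▸ hAA u hu') (hgm v hv hv').2
    · rw [hh2 u hu', hh1 v hv'] at huv
      exact absurd (huv.symm ▸ hAA v hv') (hgm u hu hu').2
    · rw [hh2 u hu', hh2 v hv'] at huv
      exact hg.2.1 u ((hmemB u hu).1 hu') v ((hmemB v hv).1 hv') huv
  · intro d hd
    by_cases hdA : d ∈ A
    · have e1 : hsCls S h d = hsCls S f2 d := by
        unfold hsCls
        refine Finset.filter_congr fun v hv => ?_
        by_cases hA : f1 v ∈ A
        · rw [hh1 v hA]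
        · rw [hh2 v hA]
          constructor
          · intro e; exact absurd (e ▸ hdA) (hgm v hv hA).2
          · intro e; exact absurd (e ▸ hdA) (hAn v hA)
      rw [e1]
      have e2 := h4 d
      have e3 := hsCls_update (S := S) (f := Function.update f z c) hyB.1 (f z) d
      have e4 := hsCls_update (f := f) hz c d
      rw [Function.update_of_ne hyz] at e3
      have e5 := hsz d hd
      have e6 : d ≠ p := fun h => hp (h ▸ hdA)
      have e7 : d ≠ f y := fun h => hyB.2 (h ▸ hdA)
      rw [if_neg e6] at e5
      rw [if_neg e7] at e3
      change (hsCls S f2 d).card + _ = (hsCls S (Function.update (Function.update f z c) y (f z)) d).card + _ at e2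
      omega
    · have e1 : hsCls S h d = hsCls (B.erase y) g d := by
        unfold hsCls
        ext v
        simp only [Finset.mem_filter]
        constructor
        · rintro ⟨hv, e⟩
          by_cases hA : f1 v ∈ A
          · rw [hh1 v hA] at e; exact absurd (e ▸ hAA v hA) hdA
          · rw [hh2 v hA] at e; exact ⟨(hmemB v hv).1 hA, e⟩
        · rintro ⟨hv, e⟩
          have hvS : v ∈ S := by
            have := Finset.mem_of_mem_erase hv
            rw [hB] at this; exact (Finset.mem_filter.1 this).1
          exact ⟨hvS, by rw [hh2 v ((hmemB v hvS).2 hv)]; exact e⟩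
      rw [e1]
      exact hg.2.2 d (Finset.mem_sdiff.2 ⟨hd, hdA⟩)

lemma hs_case_two [DecidableEq V] {A C : Finset ℕ} {B : Finset V} {s p : ℕ} {g : V → ℕ}
    {y₁ y₂ z : V}
    (hfC : ∀ v ∈ S, f v ∈ C) (hf : HsProper H S f) (hAC : A ⊆ C)
    (hsz : ∀ c ∈ C, (hsCls S f c).card + (if c = m then 1 else 0) = s + (if c = p then 1 else 0))
    (hp : p ∉ A) (hm : m ∈ A) (hB : B = S.filter fun v => f v ∉ A)
    (hz : z ∈ S) (hzA : f z ∈ A) (hzm : f z ≠ m)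
    (hy₁ : y₁ ∈ B) (hsolo₁ : HsSolo H S f y₁ z)
    (hy₂ : y₂ ∈ B) (hsolo₂ : HsSolo H S f y₂ z) (hyy : y₁ ≠ y₂) (hnadj : ¬ H.Adj y₁ y₂)
    (hg : HsEq H (B.erase y₁) (C \ A) g s) (hzB : hsDg H B z ≤ (C \ A).card)
    (hA : ∀ c ∈ A, HsAcc H S f m (· ∈ A) c)
    (hterm : ∀ c ∈ A, c ≠ f z → HsAcc H S f m (fun d => d ∈ A ∧ d ≠ f z) c)
    (hnm : ∀ c ∈ A, c ≠ f z → ∃ x ∈ S, f x = c ∧ H.Adj z x) :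
    ∃ (h : V → ℕ) (X : ℕ), (∀ v ∈ S, h v ∈ C) ∧ HsProper H S h ∧ X ∈ C ∧
      (∀ c ∈ C, (hsCls S h c).card + (if c = m then 1 else 0) = s + (if c = X then 1 else 0)) ∧
      A.card + 1 ≤ (C.filter (HsAcc H S h m (· ∈ C))).card := by
  have hBm : ∀ v, v ∈ B ↔ v ∈ S ∧ f v ∉ A := by
    intro v; rw [hB, Finset.mem_filter]
  have hX : ∃ X ∈ C \ A, ∀ v ∈ B.erase y₁, g v = X → ¬ H.Adj z v := by
    by_contra hcon
    push Not at hcon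
    have h1 := hsDg_sum_le (H := H) (S := B.erase y₁) (f := g) (C \ A) (C \ A)
      (Finset.Subset.refl _) z
    have h2 : (C \ A).card ≤ ∑ c ∈ C \ A, hsDg H (hsCls (B.erase y₁) g c) z := by
      rw [Finset.card_eq_sum_ones]
      refine Finset.sum_le_sum fun c hc => ?_
      obtain ⟨v, hv, hvc, hadj⟩ := hcon c hc
      exact hsDg_pos (Finset.mem_filter.2 ⟨hv, hvc⟩) hadj
    have h3 : hsDg H (B.erase y₁) z < hsDg H B z := by
      apply Finset.card_lt_card
      rw [Finset.ssubset_iff_of_subset (Finset.filter_subset_filter _ (Finset.erase_subset _ _))]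
      exact ⟨y₁, Finset.mem_filter.2 ⟨hy₁, hsolo₁.1.symm⟩, by simp⟩
    omega
  obtain ⟨X, hXCA, hXz⟩ := hX
  obtain ⟨hXC, hXA⟩ := Finset.mem_sdiff.1 hXCA
  have hy₁S := (hBm y₁).1 hy₁
  have hy₂S := (hBm y₂).1 hy₂
  have hy₁z : y₁ ≠ z := by rintro rfl; exact hy₁S.2 hzA
  have hy₂z : y₂ ≠ z := by rintro rfl; exact hy₂S.2 hzA
  let h0 : V → ℕ := fun v => if v = y₁ then f z else if f v ∈ A then f v else g v
  let h := Function.update h0 z X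
  have hhz : h z = X := Function.update_self ..
  have h0o : ∀ v, v ≠ z → h v = h0 v := fun v hv => Function.update_of_ne hv ..
  have h0y : h0 y₁ = f z := if_pos rfl
  have h0A : ∀ v, f v ∈ A → h0 v = f v := by
    intro v hv
    have : v ≠ y₁ := by rintro rfl; exact hy₁S.2 hv
    simp only [h0, if_neg this, if_pos hv]
  have h0B : ∀ v ∈ B.erase y₁, h0 v = g v := by
    intro v hv
    obtain ⟨e1, e2⟩ := Finset.mem_erase.1 hv
    simp only [h0, if_neg e1, if_neg ((hBm v).1 e2).2]
  have hgB : ∀ v ∈ B.erase y₁, g v ∈ C ∧ g v ∉ A := fun v hv => Finset.mem_sdiff.1 (hg.1 v hv)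
  have hcl : ∀ v ∈ S, v = z ∨ v = y₁ ∨ (v ≠ z ∧ f v ∈ A ∧ h v = f v) ∨
      (v ≠ z ∧ v ∈ B.erase y₁ ∧ h v = g v ∧ g v ∈ C ∧ g v ∉ A) := by
    intro v hv
    by_cases e1 : v = z
    · exact Or.inl e1
    by_cases e2 : v = y₁
    · exact Or.inr (Or.inl e2)
    by_cases e3 : f v ∈ A
    · exact Or.inr (Or.inr (Or.inl ⟨e1, e3, by rw [h0o v e1, h0A v e3]⟩))
    · have : v ∈ B.erase y₁ := Finset.mem_erase.2 ⟨e2, (hBm v).2 ⟨hv, e3⟩⟩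
      exact Or.inr (Or.inr (Or.inr ⟨e1, this, by rw [h0o v e1, h0B v this], hgB v this⟩))
  have hhy : h y₁ = f z := by rw [h0o _ hy₁z, h0y]
  have hcls : ∀ v ∈ S, h v ∈ A → h v ≠ f z → f v = h v := by
    intro v hv e1 e2
    rcases hcl v hv with rfl | rfl | ⟨_, _, e⟩ | ⟨_, _, e, _, e'⟩
    · rw [hhz] at e1; exact absurd e1 hXA
    · exact absurd hhy e2
    · exact e.symm
    · rw [e] at e1; exact absurd e1 e'
  have hM : ∀ d e, d ∈ A → d ≠ f z → e ∈ A → e ≠ f z → HsMv H S f d e → HsMv H S h d e := by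
    rintro d e hd hdz he hez ⟨hde, x, hx, hxd, hxe⟩
    have hxz : x ≠ z := by rintro rfl; exact hdz hxd.symm
    refine ⟨hde, x, hx, by rw [h0o x hxz, h0A x (hxd ▸ hd), hxd], ?_⟩
    intro v hv hve
    exact hxe v hv (by rw [hcls v hv (hve ▸ he) (hve ▸ hez), hve])
  have hacc1 : ∀ c ∈ A, c ≠ f z → HsAcc H S h m (· ∈ C) c := by
    intro c hc hcz
    exact (hterm c hc hcz).mono (fun d hd => hAC hd.prop.1)
      (fun d e hd he => hM d e hd.1 hd.2 he.1 he.2)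
  have hacc2 : HsAcc H S h m (· ∈ C) (f z) := by
    rcases (hA _ hzA).next with e | ⟨c', e1, e2⟩
    · exact absurd e hzm
    · have e3 := e2.prop
      refine HsAcc.step (hAC hzA) ?_ (hacc1 c' e3.1 e3.2)
      obtain ⟨hne, x, hx, hxz, hxc⟩ := e1
      have hxz' : x ≠ z := by
        rintro rfl
        obtain ⟨w, hw, hwc, hadj⟩ := hnm c' e3.1 e3.2
        exact hxc w hw hwc hadj
      refine ⟨hne, x, hx, by rw [h0o x hxz', h0A x (hxz ▸ hzA), hxz], ?_⟩
      intro v hv hve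
      exact hxc v hv (by rw [hcls v hv (hve ▸ e3.1) (hve ▸ e3.2), hve])
  have hy₂e : y₂ ∈ B.erase y₁ := Finset.mem_erase.2 ⟨hyy.symm, hy₂⟩
  have hg₂ := hgB y₂ hy₂e
  have hacc3 : HsAcc H S h m (· ∈ C) (g y₂) := by
    refine HsAcc.step hg₂.1 ⟨fun e => hg₂.2 (e ▸ hzA), y₂, hy₂S.1, ?_, ?_⟩ hacc2
    · rw [h0o _ hy₂z, h0B _ hy₂e]
    · intro v hv hve hadj
      rcases hcl v hv with rfl | rfl | ⟨e1, _, e⟩ | ⟨_, _, e, _, e'⟩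
      · rw [hhz] at hve; exact hXA (hve ▸ hzA)
      · exact hnadj hadj.symm
      · exact e1 (hsolo₂.2 v hv (e.symm.trans hve) hadj)
      · rw [e] at hve; exact e' (hve ▸ hzA)
  refine ⟨h, X, ?_, ?_, hXC, ?_, ?_⟩
  · intro v hv
    rcases hcl v hv with rfl | rfl | ⟨_, e', e⟩ | ⟨_, _, e, e', _⟩
    · rw [hhz]; exact hXC
    · rw [hhy]; exact hAC hzA
    · rw [e]; exact hAC e'
    · rw [e]; exact e'
  · intro u hu v hv huv
    rcases hcl u hu with hu1 | hu1 | ⟨hu1, hu2, hu3⟩ | ⟨hu1, hu2, hu3, _, hu4⟩ <;>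
    rcases hcl v hv with hv1 | hv1 | ⟨hv1, hv2, hv3⟩ | ⟨hv1, hv2, hv3, _, hv4⟩
    · rw [hu1, hv1]; exact H.loopless.irrefl _
    · rw [hu1, hv1, hhz, hhy] at huv; exact absurd (huv ▸ hzA) hXA
    · rw [hu1, hhz, hv3] at huv; exact absurd (huv ▸ hv2) hXA
    · rw [hu1, hhz, hv3] at huv; rw [hu1]; exact hXz v hv2 huv.symm
    · rw [hu1, hv1, hhz, hhy] at huv; exact absurd (huv ▸ hzA) hXA
    · rw [hu1, hv1]; exact H.loopless.irrefl _
    · rw [hu1, hhy, hv3] at huv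
      rw [hu1]; exact fun e => hv1 (hsolo₁.2 v hv huv.symm e)
    · rw [hu1, hhy, hv3] at huv; exact absurd (huv ▸ hzA) hv4
    · rw [hv1, hhz, hu3] at huv; exact absurd (huv ▸ hu2) hXA
    · rw [hv1, hhy, hu3] at huv
      rw [hv1]; exact fun e => hu1 (hsolo₁.2 u hu huv e.symm)
    · rw [hu3, hv3] at huv; exact hf u hu v hv huv
    · rw [hu3, hv3] at huv; exact absurd (huv ▸ hu2) hv4
    · rw [hv1, hhz, hu3] at huv; rw [hv1]; exact fun e => hXz u hu2 huv e.symm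
    · rw [hv1, hhy, hu3] at huv; exact absurd (huv ▸ hzA) hu4
    · rw [hu3, hv3] at huv; exact absurd (huv.symm ▸ hv2) hu4
    · rw [hu3, hv3] at huv; exact hg.2.1 u hu2 v hv2 huv
  · intro c hc
    have e1 := hsCls_update (f := h0) hz X c
    rw [h0A z hzA] at e1
    change (hsCls S h c).card + _ = _ at e1
    by_cases hcA : c ∈ A
    · have e2 := hsz c hc
      have e3 : c ≠ p := fun e => hp (e ▸ hcA)
      have e4 : c ≠ X := fun e => hXA (e ▸ hcA)
      rw [if_neg e3] at e2
      rw [if_neg e4] at e1 ⊢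
      have e5 : (hsCls S h0 c).card = (hsCls S f c).card + (if c = f z then 1 else 0) := by
        by_cases e : c = f z
        · rw [if_pos e]
          have : hsCls S h0 c = insert y₁ (hsCls S f c) := by
            unfold hsCls
            ext v
            simp only [Finset.mem_filter, Finset.mem_insert]
            constructor
            · rintro ⟨hv, hvc⟩
              by_cases e6 : v = y₁
              · exact Or.inl e6
              by_cases e7 : f v ∈ A
              · rw [h0A v e7] at hvc; exact Or.inr ⟨hv, hvc⟩
              · have e8 : v ∈ B.erase y₁ := Finset.mem_erase.2 ⟨e6, (hBm v).2 ⟨hv, e7⟩⟩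
                rw [h0B v e8] at hvc
                exact absurd (hvc ▸ hcA) (hgB v e8).2
            · rintro (rfl | ⟨hv, hvc⟩)
              · exact ⟨hy₁S.1, by rw [h0y, e]⟩
              · exact ⟨hv, by rw [h0A v (hvc ▸ hcA), hvc]⟩
          rw [this, Finset.card_insert_of_notMem]
          intro e6
          exact hy₁S.2 ((Finset.mem_filter.1 e6).2 ▸ hcA)
        · rw [if_neg e, add_zero]
          congr 1
          unfold hsCls
          refine Finset.filter_congr fun v hv => ?_
          by_cases e6 : v = y₁
          · rw [e6, h0y]
            exact ⟨fun e' => absurd e'.symm e, fun e' => absurd (e' ▸ hcA) hy₁S.2⟩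
          by_cases e7 : f v ∈ A
          · rw [h0A v e7]
          · have e8 : v ∈ B.erase y₁ := Finset.mem_erase.2 ⟨e6, (hBm v).2 ⟨hv, e7⟩⟩
            rw [h0B v e8]
            exact ⟨fun e' => absurd (e' ▸ hcA) (hgB v e8).2, fun e' => absurd (e' ▸ hcA) e7⟩
      omega
    · have e3 : c ≠ m := fun e => hcA (e ▸ hm)
      have e4 : c ≠ f z := fun e => hcA (e ▸ hzA)
      have e5 : (hsCls S h0 c).card = s := by
        rw [← hg.2.2 c (Finset.mem_sdiff.2 ⟨hc, hcA⟩)]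
        congr 1
        unfold hsCls
        ext v
        simp only [Finset.mem_filter]
        constructor
        · rintro ⟨hv, hvc⟩
          by_cases e6 : v = y₁
          · rw [e6, h0y] at hvc; exact absurd hvc.symm e4
          by_cases e7 : f v ∈ A
          · rw [h0A v e7] at hvc; exact absurd (hvc ▸ e7) hcA
          · have e8 : v ∈ B.erase y₁ := Finset.mem_erase.2 ⟨e6, (hBm v).2 ⟨hv, e7⟩⟩
            rw [h0B v e8] at hvc; exact ⟨e8, hvc⟩
        · rintro ⟨hv, hvc⟩
          exact ⟨((hBm v).1 (Finset.mem_of_mem_erase hv)).1, by rw [h0B v hv, hvc]⟩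
      rw [if_neg e4] at e1
      rw [if_neg e3]
      omega
  · rw [← Finset.card_insert_of_notMem hg₂.2]
    apply Finset.card_le_card
    intro c hc
    rcases Finset.mem_insert.1 hc with rfl | hc
    · exact Finset.mem_filter.2 ⟨hg₂.1, hacc3⟩
    · refine Finset.mem_filter.2 ⟨hAC hc, ?_⟩
      by_cases e : c = f z
      · rw [e]; exact hacc2
      · exact hacc1 c hc e

lemma hs_near [DecidableEq V] {s : ℕ} {C : Finset ℕ}
    (IH : ∀ C' : Finset ℕ, C'.card < C.card → ∀ S' : Finset V, S'.card = C'.card * s →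
      (∀ v ∈ S', hsDg H S' v < C'.card) → ∃ g, HsEq H S' C' g s)
    (hdeg : ∀ v ∈ S, hsDg H S v < C.card) (N : ℕ) : ∀ (f : V → ℕ) (p m : ℕ),
    (∀ v ∈ S, f v ∈ C) → HsProper H S f → p ∈ C → m ∈ C →
    (∀ c ∈ C, (hsCls S f c).card + (if c = m then 1 else 0) = s + (if c = p then 1 else 0)) →
    C.card ≤ N + (C.filter (HsAcc H S f m (· ∈ C))).card → ∃ g, HsEq H S C g s := by
  have hpA : ∀ (f : V → ℕ) (p m : ℕ),
      (∀ v ∈ S, f v ∈ C) → HsProper H S f → p ∈ C → m ∈ C →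
      (∀ c ∈ C, (hsCls S f c).card + (if c = m then 1 else 0) = s + (if c = p then 1 else 0)) →
      HsAcc H S f m (· ∈ C) p → ∃ g, HsEq H S C g s := by
    intro f p m hfC hf hp hm hsz hacc
    obtain ⟨f', h1, h2, h3, h4⟩ := hs_shift hf hacc
    refine ⟨f', fun v hv => h3 v (hfC v hv), h1, fun c hc => ?_⟩
    have := h4 c
    have := hsz c hc
    omega
  induction N with
  | zero =>
    intro f p m hfC hf hp hm hsz hN
    have : C.filter (HsAcc H S f m (· ∈ C)) = C :=
      Finset.eq_of_subset_of_card_le (Finset.filter_subset _ _) (by omega)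
    have hp' := hp
    rw [← this] at hp'
    exact hpA f p m hfC hf hp hm hsz (Finset.mem_filter.1 hp').2
  | succ N ih =>
    intro f p m hfC hf hp hm hsz hN
    by_cases hpacc : HsAcc H S f m (· ∈ C) p
    · exact hpA f p m hfC hf hp hm hsz hpacc
    set A := C.filter (HsAcc H S f m (· ∈ C)) with hAdef
    have hAC : A ⊆ C := Finset.filter_subset _ _
    have hAm : ∀ c, c ∈ A ↔ c ∈ C ∧ HsAcc H S f m (· ∈ C) c := fun c => Finset.mem_filter
    have hmA : m ∈ A := (hAm m).2 ⟨hm, HsAcc.base hm⟩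
    have hpA' : p ∉ A := fun h => hpacc ((hAm p).1 h).2
    have hA : ∀ c ∈ A, HsAcc H S f m (· ∈ A) c := fun c hc =>
      ((hAm c).1 hc).2.mono (fun d hd => (hAm d).2 ⟨hd.prop, hd⟩) (fun _ _ _ _ h => h)
    let B := S.filter fun v => f v ∉ A
    have hB : B = S.filter fun v => f v ∉ A := rfl
    have hBm : ∀ v, v ∈ B ↔ v ∈ S ∧ f v ∉ A := fun v => Finset.mem_filter
    have hF1 : ∀ y ∈ B, ∀ c ∈ A, ∃ z ∈ S, f z = c ∧ H.Adj y z := by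
      intro y hy c hc
      by_contra hcon
      push Not at hcon
      obtain ⟨hyS, hyA⟩ := (hBm y).1 hy
      refine hyA ((hAm _).2 ⟨hfC y hyS, HsAcc.step (hfC y hyS) ?_ ((hAm c).1 hc).2⟩)
      exact ⟨fun h => hyA (h ▸ hc), y, hyS, rfl, hcon⟩
    have hab : A.card + (C \ A).card = C.card := by
      rw [Finset.card_sdiff_of_subset hAC]
      have := Finset.card_le_card hAC
      omega
    have hBc : B.card = (C \ A).card * s + 1 := by
      rw [Finset.card_eq_sum_card_fiberwise (s := B) (f := f) (t := C \ A)
        (fun v hv => Finset.mem_sdiff.2 ⟨hfC v ((hBm v).1 hv).1, ((hBm v).1 hv).2⟩)]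
      have : ∀ c ∈ C \ A, (B.filter fun v => f v = c).card = s + (if c = p then 1 else 0) := by
        intro c hc
        obtain ⟨h1, h2⟩ := Finset.mem_sdiff.1 hc
        have h3 := hsz c h1
        have h4 : c ≠ m := fun h => h2 (h ▸ hmA)
        rw [if_neg h4, add_zero] at h3
        rw [← h3]
        congr 1
        unfold hsCls
        ext v
        simp only [Finset.mem_filter, hBm]
        exact ⟨fun h => ⟨h.1.1, h.2⟩, fun h => ⟨⟨h.1, h.2 ▸ h2⟩, h.2⟩⟩
      rw [Finset.sum_congr rfl this, Finset.sum_add_distrib, Finset.sum_const, smul_eq_mul,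
        Finset.sum_ite_eq', if_pos (Finset.mem_sdiff.2 ⟨hp, hpA'⟩)]
    have hdB : ∀ v ∈ B, hsDg H B v < (C \ A).card := by
      intro v hv
      have h1 := hsDg_sum_le (H := H) (S := S) (f := f) A A (Finset.Subset.refl _) v
      rw [← hB] at h1
      have h2 : A.card ≤ ∑ c ∈ A, hsDg H (hsCls S f c) v := by
        rw [Finset.card_eq_sum_ones]
        refine Finset.sum_le_sum fun c hc => ?_
        obtain ⟨x, hx, hxc, hadj⟩ := hF1 v hv c hc
        exact hsDg_pos (Finset.mem_filter.2 ⟨hx, hxc⟩) hadj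
      have := hdeg v ((hBm v).1 hv).1
      omega
    have hIHB : ∀ y ∈ B, ∃ g, HsEq H (B.erase y) (C \ A) g s := by
      intro y hy
      have hApos : 0 < A.card := Finset.card_pos.2 ⟨m, hmA⟩
      refine IH _ (by omega) _ ?_ ?_
      · rw [Finset.card_erase_of_mem hy, hBc]; omega
      · intro v hv
        exact lt_of_le_of_lt (hsDg_mono (Finset.erase_subset _ _) v)
          (hdB v (Finset.mem_of_mem_erase hv))
    by_cases hne : ∃ c ∈ A, c ≠ m
    · obtain ⟨U, hUA, T, hTA, hTne, hUT, hmT, hterm, hF4⟩ := hs_terminal A hA hmA hne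
      by_cases hmov : ∃ z ∈ S, f z ∈ T ∧ ∃ y ∈ B, HsSolo H S f y z ∧ ∃ c ∈ A, c ≠ f z ∧
          ∀ x ∈ S, f x = c → ¬ H.Adj z x
      · obtain ⟨z, hz, hzT, y, hy, hso, c, hcA, hcz, hzc⟩ := hmov
        obtain ⟨g, hg⟩ := hIHB y hy
        exact hs_case_one hfC hf hAC hsz hpA' hmA hB hz (hTA hzT) hy hso hg hcA hcz hzc
          (hterm _ hzT c hcA hcz)
      · push Not at hmov
        obtain ⟨z, hz, hzT, hzB, y₁, hy₁, y₂, hy₂, hyy, hnadj, hs₁, hs₂⟩ :=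
          hs_count (H := H) (S := S) (f := f) (b := (C \ A).card) (s := s) hB hTA hUA hUT hTne
            (by rw [hab]; exact hdeg) hF1 hBc
            (by
              intro c hc
              have h1 := hsz c (hAC (hTA hc))
              have h2 : c ≠ m := fun h => hmT (h ▸ hc)
              have h3 : c ≠ p := fun h => hpA' (h ▸ hTA hc)
              rw [if_neg h2, if_neg h3] at h1
              exact h1)
            (by
              intro z hz hzT c hc hcT hcU
              by_contra hcon
              push Not at hcon
              exact hF4 _ hzT c hc hcT hcU ⟨fun h => hcT (h ▸ hzT), z, hz, rfl, hcon⟩)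
            (fun z hz hzT y hy hso c hc hcz => hmov z hz hzT y hy hso c hc hcz)
        obtain ⟨g, hg⟩ := hIHB y₁ hy₁
        obtain ⟨h, X, e1, e2, e3, e4, e5⟩ := hs_case_two hfC hf hAC hsz hpA' hmA hB hz (hTA hzT)
          (fun e => hmT (e ▸ hzT)) hy₁ hs₁ hy₂ hs₂ hyy hnadj hg hzB hA (hterm _ hzT)
          (hmov z hz hzT y₁ hy₁ hs₁)
        exact ih h X m e1 e2 e3 hm e4 (by omega)
    · exfalso
      push Not at hne
      have hA1 : A = {m} := by
        ext c
        simp only [Finset.mem_singleton]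
        exact ⟨hne c, fun h => h ▸ hmA⟩
      have hA1c : A.card = 1 := by rw [hA1, Finset.card_singleton]
      have h1 : B.card ≤ ∑ y ∈ B, hsDg H (hsCls S f m) y := by
        rw [Finset.card_eq_sum_ones]
        refine Finset.sum_le_sum fun y hy => ?_
        obtain ⟨x, hx, hxc, hadj⟩ := hF1 y hy m hmA
        exact hsDg_pos (Finset.mem_filter.2 ⟨hx, hxc⟩) hadj
      rw [hsDg_swap] at h1
      have h2 : ∑ y ∈ hsCls S f m, hsDg H B y ≤ (hsCls S f m).card * (C \ A).card := by
        rw [← smul_eq_mul]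
        refine Finset.sum_le_card_nsmul _ _ _ fun z hz => ?_
        have h3 := hdeg z (Finset.mem_filter.1 hz).1
        have h4 := hsDg_mono (H := H) (show B ⊆ S from Finset.filter_subset _ _) z
        omega
      have h3 := hsz m hm
      have h4 : m ≠ p := fun h => hpA' (h ▸ hmA)
      rw [if_pos rfl, if_neg h4] at h3
      have h5 : (hsCls S f m).card * (C \ A).card ≤ s * (C \ A).card :=
        Nat.mul_le_mul_right _ (by omega)
      rw [hBc] at h1
      nlinarith

end HajnalSzemeredi


section HajnalSzemeredi
open scoped Classical

lemma hs_base (S : Finset V) (C : Finset ℕ) (s : ℕ) (h : S.card = C.card * s) :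
    ∃ g : V → ℕ, (∀ v ∈ S, g v ∈ C) ∧ ∀ c ∈ C, (hsCls S g c).card = s := by
  induction C using Finset.induction_on generalizing S with
  | empty =>
    refine ⟨fun _ => 0, ?_, by simp⟩
    have : S = ∅ := by simpa using h
    simp [this]
  | insert c C hc ih =>
    rw [Finset.card_insert_of_notMem hc] at h
    obtain ⟨R, hR, hRc⟩ := Finset.exists_subset_card_eq (s := S) (n := s) (by nlinarith)
    obtain ⟨g, h1, h2⟩ := ih (S \ R) (by
      rw [Finset.card_sdiff_of_subset hR, h, hRc, add_mul, one_mul]; omega)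
    refine ⟨fun v => if v ∈ R then c else g v, ?_, ?_⟩
    · intro v hv
      by_cases hvR : v ∈ R
      · simp [hvR]
      · simp only [hvR, if_false]
        exact Finset.mem_insert_of_mem (h1 v (Finset.mem_sdiff.2 ⟨hv, hvR⟩))
    · intro d hd
      rcases Finset.mem_insert.1 hd with rfl | hd
      · rw [← hRc]
        congr 1
        ext v
        simp only [hsCls, Finset.mem_filter]
        constructor
        · rintro ⟨hv, hvd⟩
          by_contra hvR
          simp only [hvR, if_false] at hvd
          exact hc (hvd ▸ h1 v (Finset.mem_sdiff.2 ⟨hv, hvR⟩))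
        · intro hv
          exact ⟨hR hv, by simp [hv]⟩
      · rw [← h2 d hd]
        congr 1
        ext v
        have hcd : c ≠ d := fun e => hc (e ▸ hd)
        simp only [hsCls, Finset.mem_filter, Finset.mem_sdiff]
        by_cases hvR : v ∈ R <;> simp [hvR, hcd]

/-- `H` restricted to edges inside `X` -/
def hsRes (H : SimpleGraph V) (X : Finset V) : SimpleGraph V where
  Adj a b := H.Adj a b ∧ a ∈ X ∧ b ∈ X
  symm := ⟨fun _ _ h => ⟨h.1.symm, h.2.2, h.2.1⟩⟩
  loopless := ⟨fun _ h => h.1.ne rfl⟩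

lemma hs_main (s : ℕ) : ∀ (k : ℕ) (C : Finset ℕ), C.card = k → ∀ (H : SimpleGraph V) (S : Finset V),
    S.card = C.card * s → (∀ v ∈ S, hsDg H S v < C.card) → ∃ g, HsEq H S C g s := by
  intro k
  induction k using Nat.strong_induction_on with
  | _ k IH =>
  intro C hC H S hS hdeg
  have key : ∀ X : Finset V, X ⊆ S → ∃ g, HsEq (hsRes H X) S C g s := by
    intro X
    induction X using Finset.induction_on with
    | empty =>
      intro _
      obtain ⟨g, h1, h2⟩ := hs_base S C s hS
      exact ⟨g, h1, fun u _ v _ _ h => by simpa using h.2.1, h2⟩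
    | insert u X hu ih =>
      intro hX
      obtain ⟨g, h1, h2, h3⟩ := ih fun x hx => hX (Finset.mem_insert_of_mem hx)
      have huS : u ∈ S := hX (Finset.mem_insert_self _ _)
      have hle : ∀ v, hsDg (hsRes H (insert u X)) S v ≤ hsDg H S v := fun v =>
        Finset.card_le_card fun z hz => by
          rw [Finset.mem_filter] at hz ⊢
          exact ⟨hz.1, hz.2.1⟩
      have hdeg' : ∀ v ∈ S, hsDg (hsRes H (insert u X)) S v < C.card := fun v hv =>
        (hle v).trans_lt (hdeg v hv)
      have hnear := fun f p m => hs_near (H := hsRes H (insert u X)) (S := S) (s := s) (C := C)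
        (fun C' hC' S' hS' hd' => IH _ (hC ▸ hC') C' rfl _ S' hS' hd') hdeg' C.card f p m
      -- class without neighbours of u
      have hex : ∃ c ∈ C, ∀ z ∈ S, g z = c → ¬ (hsRes H (insert u X)).Adj u z := by
        by_contra hcon
        push Not at hcon
        have e1 := hsDg_sum_le (H := hsRes H (insert u X)) (S := S) (f := g) C C
          (Finset.Subset.refl _) u
        have e2 : C.card ≤ ∑ c ∈ C, hsDg (hsRes H (insert u X)) (hsCls S g c) u := by
          rw [Finset.card_eq_sum_ones]
          refine Finset.sum_le_sum fun c hc => ?_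
          obtain ⟨x, hx, hxc, hadj⟩ := hcon c hc
          exact hsDg_pos (Finset.mem_filter.2 ⟨hx, hxc⟩) hadj
        have e3 := hdeg' u huS
        omega
      obtain ⟨c, hc, hcn⟩ := hex
      have hgc : ∀ v ∈ S, Function.update g u c v ∈ C := by
        intro v hv
        by_cases hvu : v = u
        · subst hvu; simpa using hc
        · rw [Function.update_of_ne hvu]; exact h1 v hv
      refine hnear (Function.update g u c) c (g u) hgc ?_ hc (h1 u huS) ?_ (by omega)
      · intro a ha b hb hab hadj
        by_cases hau : a = u
        · subst hau
          have hba : b ≠ a := hadj.1.ne'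
          rw [Function.update_self, Function.update_of_ne hba] at hab
          exact hcn b hb hab.symm hadj
        · by_cases hbu : b = u
          · subst hbu
            rw [Function.update_self, Function.update_of_ne hau] at hab
            exact hcn a ha hab hadj.symm
          · rw [Function.update_of_ne hau, Function.update_of_ne hbu] at hab
            refine h2 a ha b hb hab ⟨hadj.1, ?_, ?_⟩
            · exact (Finset.mem_insert.1 hadj.2.1).resolve_left hau
            · exact (Finset.mem_insert.1 hadj.2.2).resolve_left hbu
      · intro d hd
        have := hsCls_update (S := S) (f := g) huS c d
        rw [h3 d hd] at this
        exact this
  obtain ⟨g, h1, h2, h3⟩ := key S (Finset.Subset.refl _)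
  exact ⟨g, h1, fun u hu v hv h hadj => h2 u hu v hv h ⟨hadj, hu, hv⟩, h3⟩

end HajnalSzemeredi


section HajnalSzemeredi
open scoped Classical

lemma hs_tiling [DecidableEq V] (G : SimpleGraph V) (r : ℕ) (hr : 1 ≤ r) (W : Finset V)
    (hd : r ∣ W.card)
    (h : ∀ v ∈ W, r * (W.filter fun u => u ≠ v ∧ ¬ G.Adj v u).card < W.card) :
    ∃ T, IsKrTilingOn G r T W := by
  obtain ⟨k, hk⟩ := hd
  obtain ⟨g, h1, h2, h3⟩ := hs_main r k (Finset.range k) (by simp) Gᶜ W (by simp [hk, mul_comm])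
    (by
      intro v hv
      have h1 := h v hv
      rw [hk] at h1
      have h2 := Nat.lt_of_mul_lt_mul_left h1
      have h3 : hsDg Gᶜ W v = (W.filter fun u => u ≠ v ∧ ¬ G.Adj v u).card := by
        unfold hsDg
        congr 1
        ext z
        simp only [Finset.mem_filter, SimpleGraph.compl_adj, ne_comm]
      rw [h3]
      simpa using h2)
  refine ⟨(Finset.range k).image fun c => hsCls W g c, ?_, ?_, ?_⟩
  · intro K hK
    obtain ⟨c, hc, rfl⟩ := Finset.mem_image.1 hK
    refine ⟨?_, h3 c hc⟩
    intro a ha b hb hab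
    simp only [hsCls, Finset.coe_filter, Set.mem_setOf_eq] at ha hb
    by_contra hn
    exact h2 a ha.1 b hb.1 (ha.2.trans hb.2.symm) ((SimpleGraph.compl_adj _ _ _).2 ⟨hab, hn⟩)
  · intro K hK K' hK' hne
    obtain ⟨c, hc, rfl⟩ := Finset.mem_image.1 hK
    obtain ⟨d, hd, rfl⟩ := Finset.mem_image.1 hK'
    rw [Finset.disjoint_left]
    intro a ha hb
    simp only [hsCls, Finset.mem_filter] at ha hb
    exact hne (by rw [← ha.2, ← hb.2])
  · ext v
    simp only [Finset.mem_biUnion, Finset.mem_image, id]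
    constructor
    · rintro ⟨K, ⟨c, hc, rfl⟩, hv⟩
      exact (Finset.mem_filter.1 hv).1
    · intro hv
      exact ⟨_, ⟨g v, h1 v hv, rfl⟩, Finset.mem_filter.2 ⟨hv, rfl⟩⟩

end HajnalSzemeredi


section Regularity
open scoped Classical

/-- the average of `g` over the cell labelled `b` -/
noncomputable def rgAvg {Ω β : Type*} [Fintype Ω] (g : Ω → ℝ) (Q : Ω → β) (b : β) : ℝ :=
  (∑ ω ∈ univ.filter (fun ω => Q ω = b), g ω) / ((univ.filter (fun ω => Q ω = b)).card : ℝ)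

variable {Ω β γ : Type*} [Fintype Ω]

lemma rgAvg_mul (g : Ω → ℝ) (Q : Ω → β) (b : β) :
    ((univ.filter (fun ω => Q ω = b)).card : ℝ) * rgAvg g Q b
      = ∑ ω ∈ univ.filter (fun ω => Q ω = b), g ω := by
  unfold rgAvg
  by_cases h : (univ.filter (fun ω => Q ω = b)).card = 0
  · rw [h]
    rw [Finset.card_eq_zero] at h
    rw [h]; simp
  · have : ((univ.filter (fun ω => Q ω = b)).card : ℝ) ≠ 0 := by exact_mod_cast h
    field_simp

lemma rg_proj [Fintype β] (g : Ω → ℝ) (Q : Ω → β) (h : β → ℝ) :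
    ∑ ω, h (Q ω) * rgAvg g Q (Q ω) = ∑ ω, h (Q ω) * g ω := by
  rw [← Finset.sum_fiberwise (s := univ) (g := Q) (f := fun ω => h (Q ω) * rgAvg g Q (Q ω)),
    ← Finset.sum_fiberwise (s := univ) (g := Q) (f := fun ω => h (Q ω) * g ω)]
  refine Finset.sum_congr rfl fun b _ => ?_
  have e1 : ∑ ω ∈ univ.filter (fun ω => Q ω = b), h (Q ω) * rgAvg g Q (Q ω)
      = ∑ ω ∈ univ.filter (fun ω => Q ω = b), h b * rgAvg g Q b :=
    Finset.sum_congr rfl fun ω hω => by rw [(Finset.mem_filter.1 hω).2]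
  have e2 : ∑ ω ∈ univ.filter (fun ω => Q ω = b), h (Q ω) * g ω
      = ∑ ω ∈ univ.filter (fun ω => Q ω = b), h b * g ω :=
    Finset.sum_congr rfl fun ω hω => by rw [(Finset.mem_filter.1 hω).2]
  rw [e1, e2, Finset.sum_const, ← Finset.mul_sum, ← rgAvg_mul g, nsmul_eq_mul]
  ring

noncomputable def rgEn (g : Ω → ℝ) (Q : Ω → β) : ℝ := ∑ ω, rgAvg g Q (Q ω) ^ 2

lemma rg_pyth [Fintype β] [Fintype γ] (g : Ω → ℝ) (Q' : Ω → β) (φ : β → γ) :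
    ∑ ω, (rgAvg g Q' (Q' ω) - rgAvg g (fun ω => φ (Q' ω)) (φ (Q' ω))) ^ 2
      = rgEn g Q' - rgEn g (fun ω => φ (Q' ω)) := by
  have h1 := rg_proj g Q' fun b => rgAvg g (fun ω => φ (Q' ω)) (φ b)
  have h2 := rg_proj g (fun ω => φ (Q' ω)) fun b => rgAvg g (fun ω => φ (Q' ω)) b
  unfold rgEn
  have h3 : ∀ x y : ℝ, (x - y) ^ 2 = x ^ 2 - 2 * (y * x) + y * y := fun x y => by ring
  simp only [h3, Finset.sum_add_distrib, Finset.sum_sub_distrib, ← Finset.mul_sum]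
  simp only [pow_two] at *
  linarith

lemma rgAvg_le_one {g : Ω → ℝ} (h1 : ∀ ω, g ω ≤ 1) (Q : Ω → β) (b : β) : rgAvg g Q b ≤ 1 := by
  unfold rgAvg
  refine div_le_one_of_le₀ ?_ (by positivity)
  calc _ ≤ ∑ ω ∈ univ.filter (fun ω => Q ω = b), (1 : ℝ) := Finset.sum_le_sum fun ω _ => h1 ω
    _ = _ := by simp

lemma rgAvg_nonneg {g : Ω → ℝ} (h0 : ∀ ω, 0 ≤ g ω) (Q : Ω → β) (b : β) : 0 ≤ rgAvg g Q b :=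
  div_nonneg (Finset.sum_nonneg fun ω _ => h0 ω) (by positivity)

lemma rgEn_le {g : Ω → ℝ} (h0 : ∀ ω, 0 ≤ g ω) (h1 : ∀ ω, g ω ≤ 1) (Q : Ω → β) :
    rgEn g Q ≤ Fintype.card Ω := by
  unfold rgEn
  calc _ ≤ ∑ ω : Ω, (1 : ℝ) := Finset.sum_le_sum fun ω _ => by
        have := rgAvg_le_one h1 Q (Q ω)
        have := rgAvg_nonneg h0 Q (Q ω)
        nlinarith
    _ = _ := by simp

lemma rg_gain [Fintype β] (g : Ω → ℝ) (Q' : Ω → β) (D : Finset Ω) (h : β → Prop)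
    (hD : ∀ ω, ω ∈ D ↔ h (Q' ω)) (a b : ℝ) (hab : b ≤ a)
    (hg : ∑ ω ∈ D, g ω ≤ b * D.card) :
    (D.card : ℝ) * (a - b) ^ 2 ≤ ∑ ω ∈ D, (rgAvg g Q' (Q' ω) - a) ^ 2 := by
  have h1 : ∑ ω ∈ D, rgAvg g Q' (Q' ω) = ∑ ω ∈ D, g ω := by
    have := rg_proj g Q' fun b => if h b then 1 else 0
    simp only [← hD, ite_mul, one_mul, zero_mul] at this
    simpa [Finset.sum_ite_mem] using this
  have h2 : ∑ ω ∈ D, (2 * (a - b) * (a - rgAvg g Q' (Q' ω)) - (a - b) ^ 2)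
      ≤ ∑ ω ∈ D, (rgAvg g Q' (Q' ω) - a) ^ 2 := Finset.sum_le_sum fun ω _ => by
    nlinarith [sq_nonneg ((a - rgAvg g Q' (Q' ω)) - (a - b))]
  refine le_trans ?_ h2
  rw [Finset.sum_sub_distrib, ← Finset.mul_sum, Finset.sum_sub_distrib, h1]
  simp only [Finset.sum_const, nsmul_eq_mul]
  nlinarith [mul_le_mul_of_nonneg_left hg (sub_nonneg.2 hab)]

end Regularity


section Regularity
open scoped Classical

noncomputable def rgPart {α : Type*} [Fintype V] (P : V → α) (i : α) : Finset V :=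
  univ.filter fun v => P v = i

noncomputable def rgE (g : V → V → ℝ) (A B : Finset V) : ℝ := ∑ u ∈ A, ∑ v ∈ B, g u v

/-- dense pair of parts which is not lower regular -/
def RgBad {α : Type*} [Fintype V] (g : V → V → ℝ) (P : V → α) (d e : ℝ) (i j : α) : Prop :=
  d * (rgPart P i).card * (rgPart P j).card ≤ rgE g (rgPart P i) (rgPart P j) ∧
  ∃ A ⊆ rgPart P i, ∃ B ⊆ rgPart P j, e * (rgPart P i).card ≤ A.card ∧
    e * (rgPart P j).card ≤ B.card ∧ rgE g A B < d / 2 * A.card * B.card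

noncomputable def rgEnP {α : Type*} [Fintype V] (g : V → V → ℝ) (P : V → α) : ℝ :=
  rgEn (fun ω : V × V => g ω.1 ω.2) fun ω => (P ω.1, P ω.2)

lemma rgEnP_inj {α β : Type*} [Fintype V] (g : V → V → ℝ) (P : V → α) (e : α → β)
    (he : Function.Injective e) : rgEnP g (fun v => e (P v)) = rgEnP g P := by
  unfold rgEnP rgEn rgAvg
  simp only [Prod.mk.injEq, he.eq_iff]

noncomputable def rgBadSum {α κ : Type*} [Fintype V] [Fintype α] [Fintype κ] (g : κ → V → V → ℝ)
    (P : V → α) (d e : ℝ) : ℝ :=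
  ∑ c, ∑ p : α × α, if RgBad (g c) P d e p.1 p.2 then
    ((rgPart P p.1).card : ℝ) * (rgPart P p.2).card else 0

lemma rg_cell {α : Type*} [Fintype V] (P : V → α) (p : α × α)
    [DecidablePred fun ω : V × V => (P ω.1, P ω.2) = p] :
    (univ.filter fun ω : V × V => (P ω.1, P ω.2) = p) = rgPart P p.1 ×ˢ rgPart P p.2 := by
  ext ω
  simp [rgPart, Prod.ext_iff]

lemma rg_step {α κ : Type*} [Fintype V] [Fintype α] [Fintype κ] (g : κ → V → V → ℝ)
    (P : V → α) (d e : ℝ) (hd : 0 < d) (he : 0 < e) :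
    ∃ P' : V → α × (κ × α × α → Bool × Bool),
      ∑ c, rgEnP (g c) P + e ^ 2 * (d / 2) ^ 2 * rgBadSum g P d e ≤ ∑ c, rgEnP (g c) P' := by
  have hch : ∀ x : κ × α × α, ∃ D : Finset V × Finset V,
      RgBad (g x.1) P d e x.2.1 x.2.2 → D.1 ⊆ rgPart P x.2.1 ∧ D.2 ⊆ rgPart P x.2.2 ∧
      e * (rgPart P x.2.1).card ≤ D.1.card ∧
      e * (rgPart P x.2.2).card ≤ D.2.card ∧ rgE (g x.1) D.1 D.2 < d / 2 * D.1.card * D.2.card := by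
    intro x
    by_cases h : RgBad (g x.1) P d e x.2.1 x.2.2
    · obtain ⟨_, A, hA, B, hB, h1, h2, h3⟩ := h
      exact ⟨(A, B), fun _ => ⟨hA, hB, h1, h2, h3⟩⟩
    · exact ⟨(∅, ∅), fun h' => absurd h' h⟩
  choose D hD using hch
  refine ⟨fun v => (P v, fun x => (decide (v ∈ (D x).1), decide (v ∈ (D x).2))), ?_⟩
  set P' : V → α × (κ × α × α → Bool × Bool) :=
    fun v => (P v, fun x => (decide (v ∈ (D x).1), decide (v ∈ (D x).2))) with hP'
  unfold rgBadSum
  rw [Finset.mul_sum, ← Finset.sum_add_distrib]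
  refine Finset.sum_le_sum fun c _ => ?_
  have hpy := rg_pyth (fun ω : V × V => g c ω.1 ω.2) (fun ω => (P' ω.1, P' ω.2))
    (fun b => (b.1.1, b.2.1))
  have hE : rgEnP (g c) P' - rgEnP (g c) P = ∑ ω : V × V,
      (rgAvg (fun ω : V × V => g c ω.1 ω.2) (fun ω => (P' ω.1, P' ω.2)) (P' ω.1, P' ω.2)
        - rgAvg (fun ω : V × V => g c ω.1 ω.2) (fun ω => (P ω.1, P ω.2)) (P ω.1, P ω.2)) ^ 2 :=
    hpy.symm
  rw [← Finset.sum_fiberwise (s := univ) (g := fun ω : V × V => (P ω.1, P ω.2))] at hE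
  rw [← le_sub_iff_add_le', hE, Finset.mul_sum]
  refine Finset.sum_le_sum fun p _ => ?_
  by_cases hb : RgBad (g c) P d e p.1 p.2
  swap
  · rw [if_neg hb, mul_zero]
    exact Finset.sum_nonneg fun _ _ => sq_nonneg _
  rw [if_pos hb]
  obtain ⟨h1, h2, h3, h4, h5⟩ := hD (c, p.1, p.2) hb
  have hdens := hb.1
  set A := (D (c, p.1, p.2)).1 with hA
  set B := (D (c, p.1, p.2)).2 with hB
  simp only at h1 h2 h3 h4 h5
  set a := rgAvg (fun ω : V × V => g c ω.1 ω.2) (fun ω => (P ω.1, P ω.2)) p with ha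
  by_cases hz : ((rgPart P p.1).card : ℝ) * (rgPart P p.2).card = 0
  · rw [hz, mul_zero]
    exact Finset.sum_nonneg fun _ _ => sq_nonneg _
  have hpos : 0 < ((rgPart P p.1).card : ℝ) * (rgPart P p.2).card :=
    lt_of_le_of_ne (by positivity) (Ne.symm hz)
  have had : d ≤ a := by
    have := rgAvg_mul (fun ω : V × V => g c ω.1 ω.2) (fun ω => (P ω.1, P ω.2)) p
    rw [rg_cell, Finset.card_product, Finset.sum_product] at this
    push_cast at this
    unfold rgE at hdens
    rw [← ha] at this
    rw [← this] at hdens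
    by_contra hlt
    push Not at hlt
    nlinarith
  have hgain := rg_gain (fun ω : V × V => g c ω.1 ω.2) (fun ω => (P' ω.1, P' ω.2)) (A ×ˢ B)
    (fun b => (b.1.2 (c, p.1, p.2)).1 = true ∧ (b.2.2 (c, p.1, p.2)).2 = true)
    (by intro ω; simp [hP', hA, hB]) a (d / 2) (by linarith)
    (by
      rw [Finset.sum_product, Finset.card_product]
      push_cast
      unfold rgE at h5
      linarith)
  rw [Finset.card_product] at hgain
  push_cast at hgain
  have hsub : ∑ ω ∈ A ×ˢ B, (rgAvg (fun ω : V × V => g c ω.1 ω.2) (fun ω => (P' ω.1, P' ω.2))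
        (P' ω.1, P' ω.2) - a) ^ 2 ≤ ∑ ω ∈ univ.filter (fun ω : V × V => (P ω.1, P ω.2) = p),
      (rgAvg (fun ω : V × V => g c ω.1 ω.2) (fun ω => (P' ω.1, P' ω.2)) (P' ω.1, P' ω.2)
        - rgAvg (fun ω : V × V => g c ω.1 ω.2) (fun ω => (P ω.1, P ω.2)) (P ω.1, P ω.2)) ^ 2 := by
    rw [Finset.sum_congr rfl (g := fun ω : V × V => (rgAvg (fun ω : V × V => g c ω.1 ω.2)
      (fun ω => (P' ω.1, P' ω.2)) (P' ω.1, P' ω.2) - a) ^ 2) (fun ω (hω : ω ∈ univ.filter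
        (fun ω : V × V => (P ω.1, P ω.2) = p)) => by rw [(Finset.mem_filter.1 hω).2])]
    rw [rg_cell]
    exact Finset.sum_le_sum_of_subset_of_nonneg (Finset.product_subset_product h1 h2)
      fun _ _ _ => sq_nonneg _
  refine le_trans ?_ (hgain.trans hsub)
  have e1 : (e * (rgPart P p.1).card) * (e * (rgPart P p.2).card) ≤ (A.card : ℝ) * B.card :=
    mul_le_mul h3 h4 (by positivity) (by positivity)
  have e2 : (d / 2) ^ 2 ≤ (a - d / 2) ^ 2 := by nlinarith
  calc e ^ 2 * (d / 2) ^ 2 * (((rgPart P p.1).card : ℝ) * (rgPart P p.2).card)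
      = ((e * (rgPart P p.1).card) * (e * (rgPart P p.2).card)) * (d / 2) ^ 2 := by ring
    _ ≤ _ := mul_le_mul e1 e2 (by positivity) (by positivity)

lemma rg_iter (q : ℕ) (d e δ : ℝ) (hd : 0 < d) (he : 0 < e) (hδ : 0 < δ) (t : ℕ) :
    ∃ B₁ B₂ : ℕ, ∀ (V : Type) [Fintype V] (g : Fin q → V → V → ℝ),
      (∀ c u v, 0 ≤ g c u v) → 
      (∃ M ≤ B₁, ∃ P : V → Fin M, rgBadSum g P d e ≤ δ * (Fintype.card V : ℝ) ^ 2) ∨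
      (∃ P : V → Fin B₂, t * (e ^ 2 * (d / 2) ^ 2 * δ * (Fintype.card V : ℝ) ^ 2)
        ≤ ∑ c, rgEnP (g c) P) := by
  induction t with
  | zero =>
    refine ⟨0, 1, fun V _ g h0 => Or.inr ⟨fun _ => 0, ?_⟩⟩
    rw [Nat.cast_zero, zero_mul]
    exact Finset.sum_nonneg fun c _ => Finset.sum_nonneg fun _ _ => sq_nonneg _
  | succ t ih =>
    obtain ⟨B₁, B₂, h⟩ := ih
    refine ⟨max B₁ B₂, Fintype.card (Fin B₂ × (Fin q × Fin B₂ × Fin B₂ → Bool × Bool)),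
      fun V _ g h0 => ?_⟩
    rcases h V g h0 with ⟨M, hM, P, hP⟩ | ⟨P, hP⟩
    · exact Or.inl ⟨M, le_max_of_le_left hM, P, hP⟩
    · by_cases hb : rgBadSum g P d e ≤ δ * (Fintype.card V : ℝ) ^ 2
      · exact Or.inl ⟨B₂, le_max_right _ _, P, hb⟩
      · right
        obtain ⟨P', hP'⟩ := rg_step g P d e hd he
        refine ⟨fun v => Fintype.equivFin _ (P' v), ?_⟩
        simp only [rgEnP_inj _ P' _ (Fintype.equivFin _).injective]
        refine le_trans ?_ hP'
        push Not at hb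
        have := mul_le_mul_of_nonneg_left hb.le (show 0 ≤ e ^ 2 * (d / 2) ^ 2 by positivity)
        push_cast
        linarith

lemma rg_main (q : ℕ) (d e δ : ℝ) (hd : 0 < d) (he : 0 < e) (hδ : 0 < δ) :
    ∃ B : ℕ, ∀ (V : Type) [Fintype V] [Nonempty V] (g : Fin q → V → V → ℝ),
      (∀ c u v, 0 ≤ g c u v) → (∀ c u v, g c u v ≤ 1) → 
      ∃ M ≤ B, ∃ P : V → Fin M, rgBadSum g P d e ≤ δ * (Fintype.card V : ℝ) ^ 2 := by
  have hk : 0 < e ^ 2 * (d / 2) ^ 2 * δ := by positivity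
  obtain ⟨t, ht⟩ := exists_nat_gt ((q : ℝ) / (e ^ 2 * (d / 2) ^ 2 * δ))
  rw [div_lt_iff₀ hk] at ht
  obtain ⟨B₁, B₂, h⟩ := rg_iter q d e δ hd he hδ t
  refine ⟨B₁, fun V _ _ g h0 h1 => ?_⟩
  rcases h V g h0 with h | ⟨P, hP⟩
  · exact h
  · exfalso
    have h2 : ∑ c, rgEnP (g c) P ≤ ∑ c : Fin q, (Fintype.card V : ℝ) ^ 2 :=
      Finset.sum_le_sum fun c _ => by
        have := rgEn_le (g := fun ω : V × V => g c ω.1 ω.2) (fun _ => h0 _ _ _) (fun _ => h1 _ _ _)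
          fun ω => (P ω.1, P ω.2)
        rw [Fintype.card_prod] at this
        push_cast at this
        rw [pow_two]
        exact this
    rw [Finset.sum_const, Finset.card_univ, Fintype.card_fin, nsmul_eq_mul] at h2
    have h3 : (0 : ℝ) < (Fintype.card V : ℝ) ^ 2 := by
      have : (0 : ℝ) < Fintype.card V := by exact_mod_cast Fintype.card_pos
      positivity
    nlinarith

end Regularity


section Regularity
open scoped Classical

noncomputable def rgInd (h : V → V → Prop) (u v : V) : ℝ := if h u v then 1 else 0

lemma rg_embed [Nonempty V] {ι : Type*} (Q : ι → Finset V) (R : ι → ι → Prop) (hR : ∀ a b, R a b → R b a)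
    (h : ι → ι → V → V → Prop) (hh : ∀ a b u v, h a b u v → h b a v u)
    (d ρ e : ℝ) (m : ℕ) (hd : 0 < d) (hd1 : d ≤ 1) (hρ : ρ = d / 4) (he : e = ρ ^ m / (m + 1))
    (I : Finset ι) : ∀ (j : ℕ), j + I.card ≤ m → 
    (∀ a ∈ I, 1 ≤ ρ ^ (m + 1) * (Q a).card) →
    (∀ a ∈ I, ∀ b ∈ I, R a b → ∀ A ⊆ Q a, ∀ B ⊆ Q b, e * (Q a).card ≤ A.card →
      e * (Q b).card ≤ B.card → d / 2 * A.card * B.card ≤ rgE (rgInd (h a b)) A B) →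
    ∀ Cd : ι → Finset V, (∀ a ∈ I, Cd a ⊆ Q a ∧ ρ ^ j * (Q a).card ≤ (Cd a).card) →
    ∃ x : ι → V, Set.InjOn x I ∧ (∀ a ∈ I, x a ∈ Cd a) ∧
      ∀ a ∈ I, ∀ b ∈ I, a ≠ b → R a b → h a b (x a) (x b) := by
  have hρ0 : 0 < ρ := by rw [hρ]; positivity
  have hρ1 : ρ ≤ 1 := by rw [hρ]; linarith
  have he0 : 0 < e := by rw [he]; positivity
  induction I using Finset.induction_on with
  | empty =>
    intro j hj h1 h2 Cd h3
    exact ⟨fun _ => Classical.arbitrary V, by simp, by simp, by simp⟩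
  | insert a₀ I ha₀ ih =>
    intro j hj hlarge hreg Cd hCd
    rw [Finset.card_insert_of_notMem ha₀] at hj
    have hjm : ρ ^ m ≤ ρ ^ j := pow_le_pow_of_le_one hρ0.le hρ1 (by omega)
    have hej : e ≤ ρ ^ j := by
      rw [he]
      refine (div_le_self (by positivity) ?_).trans hjm
      have : (0 : ℝ) ≤ m := by positivity
      linarith
    have hmem : a₀ ∈ insert a₀ I := Finset.mem_insert_self _ _
    have hmem' : ∀ b ∈ I, b ∈ insert a₀ I := fun b hb => Finset.mem_insert_of_mem hb
    have hQpos : ∀ a ∈ insert a₀ I, 0 < ((Q a).card : ℝ) := fun a ha => by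
      have := hlarge a ha
      by_contra hc
      have h0 : ((Q a).card : ℝ) = 0 := le_antisymm (not_lt.1 hc) (by positivity)
      rw [h0] at this
      linarith
    -- the exceptional vertices for b
    let X : ι → Finset V := fun b => (Cd a₀).filter fun v =>
      (((Cd b).filter (h a₀ b v)).card : ℝ) < d / 2 * (Cd b).card
    have hX : ∀ b ∈ I, R a₀ b → ((X b).card : ℝ) < e * (Q a₀).card := by
      intro b hb hRb
      by_contra hc
      push Not at hc
      have hXs : X b ⊆ Q a₀ := (Finset.filter_subset _ _).trans (hCd a₀ hmem).1
      have hCb := hCd b (hmem' b hb)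
      have h1 := hreg a₀ hmem b (hmem' b hb) hRb (X b) hXs (Cd b) hCb.1 hc
        ((mul_le_mul_of_nonneg_right hej (by positivity)).trans hCb.2)
      have hXne : (X b).Nonempty := by
        rw [← Finset.card_pos]
        have : (0 : ℝ) < (X b).card := lt_of_lt_of_le (mul_pos he0 (hQpos a₀ hmem)) hc
        exact_mod_cast this
      have h2 : rgE (rgInd (h a₀ b)) (X b) (Cd b) < ∑ v ∈ X b, d / 2 * (Cd b).card := by
        unfold rgE
        refine Finset.sum_lt_sum_of_nonempty hXne fun v hv => ?_
        have := (Finset.mem_filter.1 hv).2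
        rw [Finset.card_filter] at this
        push_cast at this
        exact this
      rw [Finset.sum_const, nsmul_eq_mul] at h2
      linarith
    have hex : ∃ v ∈ Cd a₀, ∀ b ∈ I, R a₀ b → 
        d / 2 * (Cd b).card ≤ (((Cd b).filter (h a₀ b v)).card : ℝ) := by
      by_contra hcon
      push Not at hcon
      have hsub : Cd a₀ ⊆ (I.filter (R a₀)).biUnion X := by
        intro v hv
        obtain ⟨b, hb, hRb, hlt⟩ := hcon v hv
        exact Finset.mem_biUnion.2 ⟨b, Finset.mem_filter.2 ⟨hb, hRb⟩, Finset.mem_filter.2 ⟨hv, hlt⟩⟩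
      have h1 : ((Cd a₀).card : ℝ) ≤ ∑ b ∈ I.filter (R a₀), ((X b).card : ℝ) := by
        have := (Finset.card_le_card hsub).trans Finset.card_biUnion_le
        exact_mod_cast this
      have h2 : ∑ b ∈ I.filter (R a₀), ((X b).card : ℝ)
          ≤ ∑ b ∈ I.filter (R a₀), e * (Q a₀).card := Finset.sum_le_sum fun b hb =>
        (hX b (Finset.mem_filter.1 hb).1 (Finset.mem_filter.1 hb).2).le
      rw [Finset.sum_const, nsmul_eq_mul] at h2
      have h3 : ((I.filter (R a₀)).card : ℝ) ≤ m := by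
        exact_mod_cast (Finset.card_filter_le _ _).trans (by omega)
      have h4 := (hCd a₀ hmem).2
      have h5 : (m : ℝ) * e < ρ ^ m := by
        rw [he, ← mul_div_assoc, div_lt_iff₀ (by positivity)]
        have : 0 < ρ ^ m := by positivity
        nlinarith
      have hq := hQpos a₀ hmem
      have h6 : ((I.filter (R a₀)).card : ℝ) * (e * (Q a₀).card) ≤ m * (e * (Q a₀).card) :=
        mul_le_mul_of_nonneg_right h3 (by positivity)
      have h7 : ρ ^ m * (Q a₀).card ≤ ρ ^ j * (Q a₀).card :=
        mul_le_mul_of_nonneg_right hjm hq.le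
      nlinarith
    obtain ⟨v, hv, hvg⟩ := hex
    obtain ⟨x, hx1, hx2, hx3⟩ := ih (j + 1) (by omega) (fun a ha => hlarge a (hmem' a ha))
      (fun a ha b hb => hreg a (hmem' a ha) b (hmem' b hb))
      (fun b => (if R a₀ b then (Cd b).filter (h a₀ b v) else Cd b).erase v) (by
        intro b hb
        have hCb := hCd b (hmem' b hb)
        refine ⟨(Finset.erase_subset _ _).trans ?_, ?_⟩
        · split_ifs
          · exact (Finset.filter_subset _ _).trans hCb.1
          · exact hCb.1
        · have h1 : d / 2 * (Cd b).card ≤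
              ((if R a₀ b then (Cd b).filter (h a₀ b v) else Cd b).card : ℝ) := by
            split_ifs with hRb
            · exact hvg b hb hRb
            · have : (0 : ℝ) ≤ (Cd b).card := by positivity
              nlinarith
          have h2 := Finset.pred_card_le_card_erase
            (s := if R a₀ b then (Cd b).filter (h a₀ b v) else Cd b) (a := v)
          have h3 : ((if R a₀ b then (Cd b).filter (h a₀ b v) else Cd b).card : ℝ) ≤
              (((if R a₀ b then (Cd b).filter (h a₀ b v) else Cd b).erase v).card : ℝ) + 1 := by
            exact_mod_cast (by omega)
          have h4 := hlarge b (hmem' b hb)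
          have h5 : ρ ^ (m + 1) * (Q b).card ≤ ρ ^ (j + 1) * (Q b).card :=
            mul_le_mul_of_nonneg_right (pow_le_pow_of_le_one hρ0.le hρ1 (by omega)) (by positivity)
          have h6 : ρ ^ (j + 1) * (Q b).card * 2 ≤ d / 2 * (Cd b).card := by
            have : d / 2 = 2 * ρ := by rw [hρ]; ring
            rw [this, pow_succ]
            nlinarith [hCb.2]
          linarith)
    have hne : ∀ b ∈ I, b ≠ a₀ := fun b hb e => ha₀ (e ▸ hb)
    refine ⟨Function.update x a₀ v, ?_, ?_, ?_⟩
    · intro a ha b hb hab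
      rcases Finset.mem_insert.1 ha with rfl | ha'
      · rcases Finset.mem_insert.1 hb with rfl | hb'
        · rfl
        · rw [Function.update_self, Function.update_of_ne (hne b hb')] at hab
          have := hx2 b hb'
          exact absurd hab.symm (Finset.mem_erase.1 this).1
      · rcases Finset.mem_insert.1 hb with rfl | hb'
        · rw [Function.update_self, Function.update_of_ne (hne a ha')] at hab
          have := hx2 a ha'
          exact absurd hab (Finset.mem_erase.1 this).1
        · rw [Function.update_of_ne (hne a ha'), Function.update_of_ne (hne b hb')] at hab
          exact hx1 ha' hb' hab
    · intro a ha
      rcases Finset.mem_insert.1 ha with rfl | ha'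
      · rw [Function.update_self]; exact hv
      · rw [Function.update_of_ne (hne a ha')]
        have := (Finset.mem_erase.1 (hx2 a ha')).2
        split_ifs at this
        · exact (Finset.mem_filter.1 this).1
        · exact this
    · have key : ∀ b ∈ I, R a₀ b → h a₀ b v (x b) := by
        intro b hb hRb
        have := (Finset.mem_erase.1 (hx2 b hb)).2
        rw [if_pos hRb] at this
        exact (Finset.mem_filter.1 this).2
      intro a ha b hb hab hRab
      rcases Finset.mem_insert.1 ha with rfl | ha'
      · have hb' := (Finset.mem_insert.1 hb).resolve_left (Ne.symm hab)
        rw [Function.update_self, Function.update_of_ne (hne b hb')]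
        exact key b hb' hRab
      · rcases Finset.mem_insert.1 hb with rfl | hb'
        · rw [Function.update_self, Function.update_of_ne (hne a ha')]
          exact hh _ _ _ _ (key a ha' (hR _ _ hRab))
        · rw [Function.update_of_ne (hne a ha'), Function.update_of_ne (hne b hb')]
          exact hx3 a ha' b hb' hab hRab

end Regularity


section Regularity
open scoped Classical

lemma rg_fib {α : Type*} [Fintype V] [Fintype α] (P : V → α) (g : V → V → ℝ) (R : α → α → Prop)
    [∀ i j, Decidable (R i j)] :
    ∑ ω : V × V, (if R (P ω.1) (P ω.2) then g ω.1 ω.2 else 0)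
      = ∑ p : α × α, if R p.1 p.2 then rgE g (rgPart P p.1) (rgPart P p.2) else 0 := by
  rw [← Finset.sum_fiberwise (s := univ) (g := fun ω : V × V => (P ω.1, P ω.2))]
  refine Finset.sum_congr rfl fun p _ => ?_
  rw [rg_cell]
  have : ∀ ω ∈ rgPart P p.1 ×ˢ rgPart P p.2,
      (if R (P ω.1) (P ω.2) then g ω.1 ω.2 else 0) = if R p.1 p.2 then g ω.1 ω.2 else 0 := by
    intro ω hω
    rw [Finset.mem_product] at hω
    rw [(Finset.mem_filter.1 hω.1).2, (Finset.mem_filter.1 hω.2).2]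
  rw [Finset.sum_congr rfl this]
  split_ifs
  · rw [Finset.sum_product]; rfl
  · simp

lemma rg_sq {α : Type*} [Fintype V] [Fintype α] (P : V → α) :
    ∑ p : α × α, ((rgPart P p.1).card : ℝ) * (rgPart P p.2).card = (Fintype.card V : ℝ) ^ 2 := by
  have := rg_fib P (fun _ _ => 1) (fun _ _ => True)
  simp only [if_true, rgE, Finset.sum_const, nsmul_eq_mul, mul_one, Finset.card_univ,
    Fintype.card_prod] at this
  push_cast at this
  rw [← this]; ring

lemma rg_one {α : Type*} [Fintype V] [Fintype α] (P : V → α) :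
    ∑ p : α, ((rgPart P p).card : ℝ) = (Fintype.card V : ℝ) := by
  have := Finset.card_eq_sum_card_fiberwise (f := P) (s := (univ : Finset V)) (t := univ) (by simp)
  rw [Finset.card_univ] at this
  rw [this]; push_cast; rfl

def RgGood {α : Type*} [Fintype V] (g : V → V → ℝ) (P : V → α) (d e σ : ℝ) (i j : α) : Prop :=
  σ ≤ (rgPart P i).card ∧
  d * (rgPart P i).card * (rgPart P j).card ≤ rgE g (rgPart P i) (rgPart P j) ∧
  ¬ RgBad g P d e i j

lemma rgE_le [Fintype V] {g : V → V → ℝ} (h1 : ∀ u v, g u v ≤ 1) (A B : Finset V) :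
    rgE g A B ≤ A.card * B.card := by
  unfold rgE
  calc _ ≤ ∑ u ∈ A, ∑ v ∈ B, (1 : ℝ) := Finset.sum_le_sum fun u _ => Finset.sum_le_sum fun v _ => h1 u v
    _ = _ := by simp

lemma rg_notgood {M q : ℕ} [Fintype V] (g : Fin q → V → V → ℝ)
    (h1 : ∀ c u v, g c u v ≤ 1) (P : V → Fin M) (d e σ : ℝ) (hd : 0 < d) (hσ : 0 ≤ σ) :
    ∑ c, ∑ ω : V × V, (if ¬ RgGood (g c) P d e σ (P ω.1) (P ω.2) then g c ω.1 ω.2 else 0)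
      ≤ q * (d * (Fintype.card V : ℝ) ^ 2) + rgBadSum g P d e + q * (M * σ * Fintype.card V) := by
  have key : ∀ c, ∑ ω : V × V, (if ¬ RgGood (g c) P d e σ (P ω.1) (P ω.2) then g c ω.1 ω.2 else 0)
      ≤ d * (Fintype.card V : ℝ) ^ 2 + (∑ p : Fin M × Fin M, if RgBad (g c) P d e p.1 p.2 then
        ((rgPart P p.1).card : ℝ) * (rgPart P p.2).card else 0) + M * σ * Fintype.card V := by
    intro c
    have hf := rg_fib P (g c) (fun i j => ¬ RgGood (g c) P d e σ i j)
    rw [hf]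
    have e3 : ∑ p : Fin M × Fin M, σ * ((rgPart P p.2).card : ℝ) = M * σ * Fintype.card V := by
      rw [Fintype.sum_prod_type]
      simp only [← Finset.mul_sum, rg_one]
      simp
      ring
    rw [← rg_sq P, ← e3, Finset.mul_sum, ← Finset.sum_add_distrib, ← Finset.sum_add_distrib]
    refine Finset.sum_le_sum fun p _ => ?_
    have p1 : (0 : ℝ) ≤ (rgPart P p.1).card := by positivity
    have p2 : (0 : ℝ) ≤ (rgPart P p.2).card := by positivity
    have hle := rgE_le (h1 c) (rgPart P p.1) (rgPart P p.2)
    have hmul := mul_nonneg p1 p2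
    have hdm : 0 ≤ d * (((rgPart P p.1).card : ℝ) * (rgPart P p.2).card) := by positivity
    have hσm : 0 ≤ σ * ((rgPart P p.2).card : ℝ) := by positivity
    by_cases hG : RgGood (g c) P d e σ p.1 p.2
    · rw [if_neg (by simpa using hG)]
      split_ifs <;> linarith
    rw [if_pos hG]
    by_cases hB : RgBad (g c) P d e p.1 p.2
    · rw [if_pos hB]; linarith
    · rw [if_neg hB]
      by_cases hs : σ ≤ (rgPart P p.1).card
      · have : ¬ d * (rgPart P p.1).card * (rgPart P p.2).card ≤
            rgE (g c) (rgPart P p.1) (rgPart P p.2) := fun h => hG ⟨hs, h, hB⟩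
        push Not at this
        linarith
      · push Not at hs
        have := mul_le_mul_of_nonneg_right hs.le p2
        linarith
  calc _ ≤ ∑ c : Fin q, (d * (Fintype.card V : ℝ) ^ 2 + (∑ p : Fin M × Fin M,
        if RgBad (g c) P d e p.1 p.2 then
        ((rgPart P p.1).card : ℝ) * (rgPart P p.2).card else 0) + M * σ * Fintype.card V) :=
        Finset.sum_le_sum fun c _ => key c
    _ = _ := by
      rw [Finset.sum_add_distrib, Finset.sum_add_distrib]
      simp [rgBadSum]

theorem rem_main (q m : ℕ) (ε : ℝ) (hε : 0 < ε) :
    ∃ n₀ : ℕ, ∀ (V : Type) [Fintype V], n₀ ≤ Fintype.card V → ∀ (G : SimpleGraph V)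
      (f : Sym2 V → Fin q), ∃ G' ≤ G,
      ((univ.filter fun p : V × V => G.Adj p.1 p.2 ∧ ¬ G'.Adj p.1 p.2).card : ℝ)
        ≤ ε * (Fintype.card V : ℝ) ^ 2 ∧
      ∀ (ι : Type) (I : Finset ι) (y : ι → V), I.card ≤ m → (∀ a ∈ I, ∃ z, G'.Adj (y a) z) →
        ∃ x : ι → V, Set.InjOn x I ∧ ∀ a ∈ I, ∀ b ∈ I, G'.Adj (y a) (y b) →
          G.Adj (x a) (x b) ∧ f s(x a, x b) = f s(y a, y b) := by
  set d : ℝ := min 1 (ε / (2 * (2 * q + 1))) with hdd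
  have hd : 0 < d := lt_min one_pos (by positivity)
  have hd1 : d ≤ 1 := min_le_left _ _
  have hd2 : 2 * (2 * q + 1) * d ≤ ε := by
    have : d ≤ ε / (2 * (2 * q + 1)) := min_le_right _ _
    rw [le_div_iff₀ (by positivity)] at this
    linarith
  set ρ : ℝ := d / 4 with hρ
  have hρ0 : 0 < ρ := by positivity
  set e : ℝ := ρ ^ m / (m + 1) with he
  have he0 : 0 < e := by positivity
  obtain ⟨B, hB⟩ := rg_main q d e d hd he0 hd
  obtain ⟨N, hN⟩ := exists_nat_ge ((B + 1 : ℝ) / d / ρ ^ (m + 1))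
  refine ⟨N + 1, fun V _ hV G f => ?_⟩
  have hne : Nonempty V := Fintype.card_pos_iff.1 (by omega)
  set n : ℝ := (Fintype.card V : ℝ) with hn
  have hn0 : 0 < n := by rw [hn]; exact_mod_cast Fintype.card_pos
  let h : Fin q → V → V → Prop := fun c u v => G.Adj u v ∧ f s(u, v) = c
  have hg1 : ∀ c u v, rgInd (h c) u v ≤ 1 := fun c u v => by unfold rgInd; split_ifs <;> norm_num
  have hg0 : ∀ c u v, 0 ≤ rgInd (h c) u v := fun c u v => by unfold rgInd; split_ifs <;> norm_num
  obtain ⟨M, hM, P, hP⟩ := hB V (fun c => rgInd (h c)) hg0 hg1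
  set σ : ℝ := d / (B + 1) * n with hσ
  have hσ0 : 0 < σ := by positivity
  have hng := rg_notgood (fun c => rgInd (h c)) hg1 P d e σ hd hσ0.le
  let Gd : V → V → Prop := fun u v => RgGood (rgInd (h (f s(u, v)))) P d e σ (P u) (P v)
  let G' : SimpleGraph V :=
    { Adj := fun u v => G.Adj u v ∧ Gd u v ∧ Gd v u
      symm := ⟨fun _ _ h => ⟨h.1.symm, h.2.2, h.2.1⟩⟩
      loopless := ⟨fun _ h => h.1.ne rfl⟩ }
  refine ⟨G', fun u v h => h.1, ?_, ?_⟩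
  · set X := univ.filter fun p : V × V => G.Adj p.1 p.2 ∧ ¬ Gd p.1 p.2 with hX
    have hXc : (X.card : ℝ) ≤ (2 * q + 1) * d * n ^ 2 := by
      have h1 : (X.card : ℝ) = ∑ c, ∑ ω : V × V,
          (if ¬ RgGood (rgInd (h c)) P d e σ (P ω.1) (P ω.2) then rgInd (h c) ω.1 ω.2 else 0) := by
        rw [Finset.sum_comm, hX, Finset.card_filter]
        push_cast
        refine Finset.sum_congr rfl fun ω _ => ?_
        rw [Finset.sum_eq_single (f s(ω.1, ω.2))]
        · simp only [rgInd, h, Gd, and_true]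
          by_cases h1 : G.Adj ω.1 ω.2 <;> simp [h1]
        · intro c _ hc
          simp only [rgInd, h, Ne.symm hc, and_false, if_false, ite_self]
        · simp
      rw [h1]
      refine hng.trans ?_
      have h2 : (M : ℝ) * σ ≤ d * n := by
        have : (M : ℝ) ≤ B + 1 := by exact_mod_cast (by omega)
        calc (M : ℝ) * σ ≤ (B + 1) * σ := mul_le_mul_of_nonneg_right this hσ0.le
          _ = d * n := by rw [hσ]; field_simp
      have h3 : (q : ℝ) * (M * σ * n) ≤ q * (d * n * n) :=
        mul_le_mul_of_nonneg_left (mul_le_mul_of_nonneg_right h2 hn0.le) (by positivity)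
      nlinarith
    have hsub : (univ.filter fun p : V × V => G.Adj p.1 p.2 ∧ ¬ G'.Adj p.1 p.2)
        ⊆ X ∪ X.image Prod.swap := by
      intro p hp
      rw [Finset.mem_filter] at hp
      obtain ⟨_, hp1, hp2⟩ := hp
      rw [Finset.mem_union]
      by_cases hgd : Gd p.1 p.2
      · right
        refine Finset.mem_image.2 ⟨p.swap, Finset.mem_filter.2 ⟨Finset.mem_univ _, hp1.symm, ?_⟩,
          Prod.swap_swap p⟩
        exact fun h' => hp2 ⟨hp1, hgd, h'⟩
      · left
        exact Finset.mem_filter.2 ⟨Finset.mem_univ _, hp1, hgd⟩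
    have h2 : (univ.filter fun p : V × V => G.Adj p.1 p.2 ∧ ¬ G'.Adj p.1 p.2).card
        ≤ X.card + X.card :=
      (Finset.card_le_card hsub).trans ((Finset.card_union_le _ _).trans
        (Nat.add_le_add_left Finset.card_image_le _))
    have h3 : ((univ.filter fun p : V × V => G.Adj p.1 p.2 ∧ ¬ G'.Adj p.1 p.2).card : ℝ)
        ≤ X.card + X.card := by exact_mod_cast h2
    have h4 := mul_le_mul_of_nonneg_right hd2 (sq_nonneg n)
    have h5 : ((X.card : ℝ) + X.card) ≤ ε * n ^ 2 := by linarith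
    refine le_trans (le_of_eq ?_) (h3.trans h5)
    congr!
  · intro ι I y hI hy
    have hlarge : ∀ a ∈ I, 1 ≤ ρ ^ (m + 1) * ((rgPart P (P (y a))).card : ℝ) := by
      intro a ha
      obtain ⟨z, hz⟩ := hy a ha
      have h1 := hz.2.1.1
      have h2 : 1 ≤ ρ ^ (m + 1) * σ := by
        have h3 : (B + 1 : ℝ) / d / ρ ^ (m + 1) ≤ n := by
          refine hN.trans ?_
          rw [hn]; exact_mod_cast (by omega)
        rw [div_le_iff₀ (by positivity), div_le_iff₀ hd] at h3
        rw [hσ, div_mul_eq_mul_div, mul_div_assoc', le_div_iff₀ (by positivity)]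
        linarith
      refine h2.trans (mul_le_mul_of_nonneg_left h1 (by positivity))
    obtain ⟨x, hx1, -, hx3⟩ := rg_embed (fun a => rgPart P (P (y a)))
      (fun a b => G'.Adj (y a) (y b)) (fun a b h => h.symm)
      (fun a b u v => h (f s(y a, y b)) u v)
      (by
        intro a b u v huv
        refine ⟨huv.1.symm, ?_⟩
        rw [Sym2.eq_swap, huv.2, Sym2.eq_swap]) d ρ e m hd hd1 hρ he I 0 (by omega) hlarge
      (by
        intro a ha b hb hab A hA B' hB' h1 h2
        by_contra hc
        push Not at hc
        exact hab.2.1.2.2 ⟨hab.2.1.2.1, A, hA, B', hB', h1, h2, hc⟩)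
      (fun a => rgPart P (P (y a))) (fun a ha => ⟨Finset.Subset.refl _, by simp⟩)
    exact ⟨x, hx1, fun a ha b hb hab => hx3 a ha b hb (fun e => hab.1.ne (by rw [e])) hab⟩

end Regularity


section Tilings

/-- number of edges inside `K` with property `p` -/
def tlCnt [DecidableEq V] (p : Sym2 V → Prop) [DecidablePred p] (K : Finset V) : ℕ :=
  (K.sym2.filter fun e => ¬ e.IsDiag ∧ p e).card

lemma tlCnt_insert [DecidableEq V] (p : Sym2 V → Prop) [DecidablePred p] (K : Finset V) (a : V)
    (ha : a ∉ K) : tlCnt p (insert a K) = (K.filter fun v => p s(a, v)).card + tlCnt p K := by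
  unfold tlCnt
  rw [Finset.sym2_insert, Finset.filter_union, Finset.card_union_of_disjoint]
  · congr 1
    rw [← Finset.card_image_of_injOn (f := fun v => s(a, v)) (s := K.filter fun v => p s(a, v))]
    · congr 1
      ext e
      simp only [Finset.mem_filter, Finset.mem_image, Finset.mem_insert]
      constructor
      · rintro ⟨⟨b, hb, rfl⟩, h1, h2⟩
        rcases hb with rfl | hb
        · exact absurd (Sym2.mk_isDiag_iff.2 rfl) h1
        · exact ⟨b, ⟨hb, h2⟩, rfl⟩
      · rintro ⟨b, ⟨hb, h2⟩, rfl⟩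
        refine ⟨⟨b, Or.inr hb, rfl⟩, ?_, h2⟩
        rw [Sym2.mk_isDiag_iff]
        exact fun h => ha (h ▸ hb)
    · intro u _ v _ h
      simp at h
      aesop
  · rw [Finset.disjoint_left]
    intro e h1 h2
    simp only [Finset.mem_filter, Finset.mem_image, Finset.mem_insert] at h1 h2
    obtain ⟨⟨b, hb, rfl⟩, _⟩ := h1
    have := h2.1
    rw [Finset.mk_mem_sym2_iff] at this
    exact ha this.1

lemma tlCnt_true [DecidableEq V] (K : Finset V) : tlCnt (fun _ => True) K = K.card.choose 2 := by
  induction K using Finset.induction_on with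
  | empty => simp [tlCnt]
  | insert a K ha ih =>
    rw [tlCnt_insert _ _ _ ha, ih, Finset.card_insert_of_notMem ha, Nat.choose_succ_succ' _ 1]
    simp

lemma tlCnt_image [DecidableEq V] {ι : Type*} [DecidableEq ι] (p : Sym2 V → Prop) [DecidablePred p]
    (x y : ι → V) (J : Finset ι)
    (h : ∀ a ∈ J, ∀ b ∈ J, a ≠ b → x a ≠ x b ∧ y a ≠ y b ∧ (p s(x a, x b) ↔ p s(y a, y b))) :
    tlCnt p (J.image x) = tlCnt p (J.image y) := by
  induction J using Finset.induction_on with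
  | empty => simp
  | insert a J ha ih =>
    have hJ : ∀ b ∈ J, x a ≠ x b ∧ y a ≠ y b ∧ (p s(x a, x b) ↔ p s(y a, y b)) := fun b hb =>
      h a (Finset.mem_insert_self _ _) b (Finset.mem_insert_of_mem hb) (fun e => ha (e ▸ hb))
    have hJ' := fun b hb b' hb' => h b (Finset.mem_insert_of_mem hb) b' (Finset.mem_insert_of_mem hb')
    have ix : Set.InjOn x J := fun b hb b' hb' e => by
      by_contra hne; exact (hJ' b hb b' hb' hne).1 e
    have iy : Set.InjOn y J := fun b hb b' hb' e => by
      by_contra hne; exact (hJ' b hb b' hb' hne).2.1 e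
    rw [Finset.image_insert, Finset.image_insert, tlCnt_insert, tlCnt_insert, ih hJ']
    · congr 1
      rw [Finset.filter_image, Finset.filter_image, Finset.card_image_of_injOn,
        Finset.card_image_of_injOn]
      · congr 1
        refine Finset.filter_congr fun b hb => (hJ b hb).2.2
      · exact iy.mono (Finset.coe_subset.2 (Finset.filter_subset _ _))
      · exact ix.mono (Finset.coe_subset.2 (Finset.filter_subset _ _))
    · intro hm
      obtain ⟨b, hb, e⟩ := Finset.mem_image.1 hm
      exact (hJ b hb).2.1 e.symm
    · intro hm
      obtain ⟨b, hb, e⟩ := Finset.mem_image.1 hm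
      exact (hJ b hb).1 e.symm

lemma tl_color_eq [DecidableEq V] {q : ℕ} (f : Sym2 V → Fin q) (T : Finset (Finset V)) (c : Fin q) :
    tilingColorCount f T c = ∑ K ∈ T, tlCnt (fun e => f e = c) K := rfl

variable [DecidableEq V] {G : SimpleGraph V} {r : ℕ}

lemma tl_union (hr : 1 ≤ r) {A B : Finset (Finset V)} {W W' : Finset V}
    (hA : IsKrTilingOn G r A W) (hB : IsKrTilingOn G r B W') (hd : Disjoint W W') :
    IsKrTilingOn G r (A ∪ B) (W ∪ W') ∧ Disjoint A B := by
  obtain ⟨a1, a2, a3⟩ := hA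
  obtain ⟨b1, b2, b3⟩ := hB
  have hsA : ∀ K ∈ A, K ⊆ W := fun K hK => a3 ▸ Finset.subset_biUnion_of_mem id hK
  have hsB : ∀ K ∈ B, K ⊆ W' := fun K hK => b3 ▸ Finset.subset_biUnion_of_mem id hK
  have hAB : ∀ K ∈ A, ∀ K' ∈ B, Disjoint K K' := fun K hK K' hK' =>
    Finset.disjoint_of_subset_left (hsA K hK) (Finset.disjoint_of_subset_right (hsB K' hK') hd)
  refine ⟨⟨?_, ?_, ?_⟩, ?_⟩
  · intro K hK
    rcases Finset.mem_union.1 hK with h | h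
    · exact a1 K h
    · exact b1 K h
  · intro K hK K' hK' hne
    rcases Finset.mem_union.1 hK with h | h <;> rcases Finset.mem_union.1 hK' with h' | h'
    · exact a2 K h K' h' hne
    · exact hAB K h K' h'
    · exact (hAB K' h' K h).symm
    · exact b2 K h K' h' hne
  · rw [Finset.union_biUnion, a3, b3]
  · rw [Finset.disjoint_left]
    intro K h h'
    have h1 := hAB K h K h'
    rw [disjoint_self, Finset.bot_eq_empty] at h1
    have h2 := (a1 K h).card_eq
    rw [h1] at h2
    simp at h2
    omega

lemma tl_color_union {q : ℕ} (f : Sym2 V → Fin q) {A B : Finset (Finset V)} (h : Disjoint A B)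
    (c : Fin q) : tilingColorCount f (A ∪ B) c = tilingColorCount f A c + tilingColorCount f B c := by
  unfold tilingColorCount
  rw [Finset.sum_union h]

lemma tl_edge {T : Finset (Finset V)} {W : Finset V} (hT : IsKrTilingOn G r T W) :
    tilingEdgeCount T = T.card * r.choose 2 ∧ T.card * r = W.card := by
  obtain ⟨a1, a2, a3⟩ := hT
  constructor
  · unfold tilingEdgeCount
    rw [Finset.sum_congr rfl (g := fun _ => r.choose 2), Finset.sum_const, smul_eq_mul]
    intro K hK
    have := tlCnt_true K
    rw [(a1 K hK).card_eq] at this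
    rw [← this]
    simp [tlCnt]
  · rw [← a3, Finset.card_biUnion (t := id) (fun K hK K' hK' hne => a2 K hK K' hK' hne),
      Finset.sum_congr rfl (g := fun _ => r), Finset.sum_const, smul_eq_mul]
    intro K hK
    exact (a1 K hK).card_eq

lemma tl_color_sum {q : ℕ} (f : Sym2 V → Fin q) (T : Finset (Finset V)) :
    ∑ c, tilingColorCount f T c = tilingEdgeCount T := by
  unfold tilingColorCount tilingEdgeCount
  rw [Finset.sum_comm]
  refine Finset.sum_congr rfl fun K _ => ?_
  rw [Finset.card_eq_sum_card_fiberwise (f := f) (t := univ) (by simp)]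
  refine Finset.sum_congr rfl fun c _ => ?_
  rw [Finset.filter_filter]

/-- tilings from indexed families -/
lemma tl_index {ι : Type*} [DecidableEq ι] (hr : 1 ≤ r) (x : ι → V) (k : ℕ) (J : ℕ → Finset ι)
    (I : Finset ι) (hx : Set.InjOn x I) (hJ : ∀ i < k, ∀ i' < k, i ≠ i' → Disjoint (J i) (J i'))
    (hI : (Finset.range k).biUnion J = I) (hc : ∀ i < k, (J i).card = r)
    (hadj : ∀ i < k, ∀ a ∈ J i, ∀ b ∈ J i, a ≠ b → G.Adj (x a) (x b)) :
    ∃ T, IsKrTilingOn G r T (I.image x) ∧ ∀ {q : ℕ} (f : Sym2 V → Fin q) (c : Fin q),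
      tilingColorCount f T c = ∑ i ∈ Finset.range k, tlCnt (fun e => f e = c) ((J i).image x) := by
  have hsub : ∀ i < k, J i ⊆ I := fun i hi => hI ▸
    Finset.subset_biUnion_of_mem J (Finset.mem_range.2 hi)
  have hdis : ∀ i < k, ∀ i' < k, i ≠ i' → Disjoint ((J i).image x) ((J i').image x) := by
    intro i hi i' hi' hne
    rw [Finset.disjoint_left]
    intro v hv hv'
    obtain ⟨a, ha, rfl⟩ := Finset.mem_image.1 hv
    obtain ⟨b, hb, e⟩ := Finset.mem_image.1 hv'
    have := hx (hsub i' hi' hb) (hsub i hi ha) e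
    subst this
    exact Finset.disjoint_left.1 (hJ i hi i' hi' hne) ha hb
  have hcard : ∀ i < k, ((J i).image x).card = r := fun i hi => by
    rw [Finset.card_image_of_injOn (hx.mono (by exact_mod_cast hsub i hi)), hc i hi]
  refine ⟨(Finset.range k).image fun i => (J i).image x, ⟨?_, ?_, ?_⟩, ?_⟩
  · intro K hK
    obtain ⟨i, hi, rfl⟩ := Finset.mem_image.1 hK
    rw [Finset.mem_range] at hi
    refine ⟨?_, hcard i hi⟩
    intro u hu v hv huv
    obtain ⟨a, ha, rfl⟩ := Finset.mem_image.1 (Finset.mem_coe.1 hu)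
    obtain ⟨b, hb, rfl⟩ := Finset.mem_image.1 (Finset.mem_coe.1 hv)
    exact hadj i hi a ha b hb fun e => huv (by rw [e])
  · intro K hK K' hK' hne
    obtain ⟨i, hi, rfl⟩ := Finset.mem_image.1 hK
    obtain ⟨i', hi', rfl⟩ := Finset.mem_image.1 hK'
    exact hdis i (Finset.mem_range.1 hi) i' (Finset.mem_range.1 hi') fun e => hne (by rw [e])
  · rw [← hI, Finset.biUnion_image, Finset.image_biUnion]
    rfl
  · intro q f c
    rw [tl_color_eq, Finset.sum_image]
    intro i hi i' hi' e
    by_contra hne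
    have h1 := hdis i (Finset.mem_range.1 hi) i' (Finset.mem_range.1 hi') hne
    have h2 := hcard i (Finset.mem_range.1 hi)
    simp only at e
    rw [← e, disjoint_self, Finset.bot_eq_empty] at h1
    rw [h1] at h2
    simp at h2
    omega

end Tilings


section Tilings
variable [DecidableEq V] {G G' : SimpleGraph V} {r : ℕ}

def tmJ (K : Finset V) (i a b : ℕ) : Finset ((ℕ × V) ⊕ ℕ) :=
  insert (Sum.inr a) (insert (Sum.inr b) (K.image fun u => Sum.inl (i, u)))

def tmI (K : Finset V) (k : ℕ) : Finset ((ℕ × V) ⊕ ℕ) :=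
  ((Finset.range k ×ˢ K).image Sum.inl) ∪ (Finset.range (2 * k)).image Sum.inr

def tmY (w : ℕ → V) : (ℕ × V) ⊕ ℕ → V := Sum.elim Prod.snd w

lemma tmI_card (K : Finset V) (k : ℕ) : (tmI K k).card ≤ k * (K.card + 2) := by
  unfold tmI
  refine (Finset.card_union_le _ _).trans ?_
  refine (Nat.add_le_add Finset.card_image_le Finset.card_image_le).trans ?_
  simp
  nlinarith

lemma tm_tiling {q : ℕ} (f : Sym2 V → Fin q) (hr : 2 ≤ r) (K : Finset V) (k : ℕ) (w : ℕ → V)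
    (hK : G'.IsNClique (r - 2) K) (hKw : ∀ i < 2 * k, ∀ x ∈ K, G'.Adj x (w i))
    (α β : ℕ → ℕ) (h1 : ∀ i < k, α i < 2 * k ∧ β i < 2 * k ∧ α i ≠ β i)
    (h2 : ∀ i < k, ∀ i' < k, i ≠ i' → α i ≠ α i' ∧ α i ≠ β i' ∧ β i ≠ α i' ∧ β i ≠ β i')
    (h3 : ∀ j < 2 * k, ∃ i < k, j = α i ∨ j = β i)
    (hw : ∀ i < k, G'.Adj (w (α i)) (w (β i)))
    (x : (ℕ × V) ⊕ ℕ → V) (hx : Set.InjOn x (tmI K k))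
    (hxy : ∀ a ∈ tmI K k, ∀ b ∈ tmI K k, G'.Adj (tmY w a) (tmY w b) →
          G.Adj (x a) (x b) ∧ f s(x a, x b) = f s(tmY w a, tmY w b)) :
    ∃ T, IsKrTilingOn G r T ((tmI K k).image x) ∧ ∀ c, tilingColorCount f T c
      = ∑ i ∈ Finset.range k, ((if f s(w (α i), w (β i)) = c then 1 else 0)
        + (K.filter fun v => f s(w (α i), v) = c).card + ((K.filter fun v => f s(w (β i), v) = c).card
        + tlCnt (fun e => f e = c) K)) := by
  have hsub : ∀ i < k, tmJ K i (α i) (β i) ⊆ tmI K k := by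
    intro i hi a ha
    have := h1 i hi
    simp only [tmJ, tmI, Finset.mem_insert, Finset.mem_image, Finset.mem_union, Finset.mem_product,
      Finset.mem_range] at ha ⊢
    rcases ha with rfl | rfl | ⟨u, hu, rfl⟩
    · exact Or.inr ⟨_, this.1, rfl⟩
    · exact Or.inr ⟨_, this.2.1, rfl⟩
    · exact Or.inl ⟨_, ⟨hi, hu⟩, rfl⟩
  have hadj' : ∀ i < k, ∀ a ∈ tmJ K i (α i) (β i), ∀ b ∈ tmJ K i (α i) (β i), a ≠ b → 
      G'.Adj (tmY w a) (tmY w b) := by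
    intro i hi a ha b hb hab
    have := h1 i hi
    simp only [tmJ, Finset.mem_insert, Finset.mem_image] at ha hb
    rcases ha with rfl | rfl | ⟨u, hu, rfl⟩ <;> rcases hb with rfl | rfl | ⟨v, hv, rfl⟩ <;>
      simp only [tmY, Sum.elim_inl, Sum.elim_inr]
    · exact absurd rfl hab
    · exact hw i hi
    · exact (hKw _ this.1 v hv).symm
    · exact (hw i hi).symm
    · exact absurd rfl hab
    · exact (hKw _ this.2.1 v hv).symm
    · exact hKw _ this.1 u hu
    · exact hKw _ this.2.1 u hu
    · exact hK.isClique hu hv fun e => hab (by rw [e])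
  obtain ⟨T, hT, hTc⟩ := tl_index (G := G) (r := r) (by omega) x k
    (fun i => tmJ K i (α i) (β i)) (tmI K k) hx
    (by
      intro i hi i' hi' hne
      have := h2 i hi i' hi' hne
      rw [Finset.disjoint_left]
      intro a ha hb
      simp only [tmJ, Finset.mem_insert, Finset.mem_image] at ha hb
      rcases ha with rfl | rfl | ⟨u, hu, rfl⟩ <;> rcases hb with hb | hb | ⟨v, hv, hb⟩ <;>
        simp_all)
    (by
      refine Finset.Subset.antisymm (Finset.biUnion_subset.2 fun i hi =>
        hsub i (Finset.mem_range.1 hi)) ?_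
      intro a ha
      simp only [tmI, Finset.mem_image, Finset.mem_union, Finset.mem_product,
        Finset.mem_range] at ha
      simp only [Finset.mem_biUnion, tmJ, Finset.mem_insert, Finset.mem_image, Finset.mem_range]
      rcases ha with ⟨⟨i, u⟩, ⟨hi, hu⟩, rfl⟩ | ⟨j, hj, rfl⟩
      · exact ⟨i, hi, Or.inr (Or.inr ⟨u, hu, rfl⟩)⟩
      · obtain ⟨i, hi, h | h⟩ := h3 j hj
        · exact ⟨i, hi, Or.inl (by rw [h])⟩
        · exact ⟨i, hi, Or.inr (Or.inl (by rw [h]))⟩)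
    (by
      intro i hi
      have := h1 i hi
      unfold tmJ
      rw [Finset.card_insert_of_notMem (by simp [this.2.2]), Finset.card_insert_of_notMem (by simp),
        Finset.card_image_of_injective _ (fun u v h => by simpa using h), hK.card_eq]
      omega)
    (by
      intro i hi a ha b hb hab
      exact (hxy a (hsub i hi ha) b (hsub i hi hb) (hadj' i hi a ha b hb hab)).1)
  refine ⟨T, hT, fun c => ?_⟩
  rw [hTc f c]
  refine Finset.sum_congr rfl fun i hi => ?_
  rw [Finset.mem_range] at hi
  have hi1 := h1 i hi
  rw [tlCnt_image (fun e => f e = c) x (tmY w) (tmJ K i (α i) (β i))]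
  · have himg : (tmJ K i (α i) (β i)).image (tmY w) = insert (w (α i)) (insert (w (β i)) K) := by
      unfold tmJ
      rw [Finset.image_insert, Finset.image_insert, Finset.image_image]
      simp [tmY, Function.comp_def]
    have hn1 : w (β i) ∉ K := fun h => (hKw _ hi1.2.1 _ h).ne rfl
    have hn2 : w (α i) ∉ insert (w (β i)) K := by
      rw [Finset.mem_insert, not_or]
      exact ⟨(hw i hi).ne, fun h => (hKw _ hi1.1 _ h).ne rfl⟩
    rw [himg, tlCnt_insert _ _ _ hn2, tlCnt_insert _ _ _ hn1, Finset.filter_insert]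
    congr 1
    split_ifs with hc
    · rw [Finset.card_insert_of_notMem (fun h => hn1 (Finset.mem_filter.1 h).1)]
      ring
    · simp
  · intro a ha b hb hab
    have had := hadj' i hi a ha b hb hab
    have := hxy a (hsub i hi ha) b (hsub i hi hb) had
    refine ⟨this.1.ne, had.ne, ?_⟩
    rw [this.2]

/-- colour-`c` switch -/
def IsSw {q : ℕ} (G : SimpleGraph V) (f : Sym2 V → Fin q) (r : ℕ) (c : Fin q) (W : Finset V)
    (A B : Finset (Finset V)) : Prop :=
  W.card ≤ 3 * r ∧ IsKrTilingOn G r A W ∧ IsKrTilingOn G r B W ∧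
    tilingColorCount f B c < tilingColorCount f A c

lemma tm_switch {q : ℕ} (f : Sym2 V → Fin q) (hr : 2 ≤ r) (K : Finset V) (k : ℕ) (w : ℕ → V)
    (hk : k = 2 ∨ k = 3)
    (hK : G'.IsNClique (r - 2) K) (hKw : ∀ i < 2 * k, ∀ x ∈ K, G'.Adj x (w i))
    (hw : ∀ i < 2 * k, G'.Adj (w i) (w ((i + 1) % (2 * k))))
    (hbal : (↑((List.range k).map fun i => f s(w (2 * i), w (2 * i + 1))) : Multiset (Fin q)) ≠
      (↑((List.range k).map fun i =>
          f s(w (2 * i + 1), w ((2 * i + 2) % (2 * k)))) : Multiset (Fin q)))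
    (x : (ℕ × V) ⊕ ℕ → V) (hx : Set.InjOn x (tmI K k))
    (hxy : ∀ a ∈ tmI K k, ∀ b ∈ tmI K k, G'.Adj (tmY w a) (tmY w b) →
          G.Adj (x a) (x b) ∧ f s(x a, x b) = f s(tmY w a, tmY w b)) :
    ∃ c A B, IsSw G f r c ((tmI K k).image x) A B := by
  have hcard : ((tmI K k).image x).card ≤ 3 * r := by
    refine Finset.card_image_le.trans ((tmI_card K k).trans ?_)
    rw [hK.card_eq]
    have : r - 2 + 2 = r := by omega
    rw [this]
    exact Nat.mul_le_mul_right _ (by omega)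
  obtain ⟨A, hA, hAc⟩ := tm_tiling f hr K k w hK hKw (fun i => 2 * i) (fun i => 2 * i + 1)
    (by intro i hi; omega) (by intro i hi i' hi' h; omega)
    (by intro j hj; exact ⟨j / 2, by omega, by omega⟩)
    (by
      intro i hi
      have := hw (2 * i) (by omega)
      rwa [Nat.mod_eq_of_lt (by omega)] at this) x hx hxy
  obtain ⟨B, hB, hBc⟩ := tm_tiling f hr K k w hK hKw (fun i => 2 * i + 1)
    (fun i => (2 * i + 2) % (2 * k))
    (by intro i hi; rcases hk with rfl | rfl <;> omega)
    (by intro i hi i' hi' h; rcases hk with rfl | rfl <;> omega)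
    (by rcases hk with rfl | rfl <;> decide)
    (by
      intro i hi
      exact hw (2 * i + 1) (by omega)) x hx hxy
  have hex : ∃ c, tilingColorCount f A c ≠ tilingColorCount f B c := by
    by_contra hcon
    push Not at hcon
    apply hbal
    ext c
    have h := hcon c
    rw [hAc, hBc] at h
    rw [Multiset.coe_count, Multiset.coe_count]
    rcases hk with rfl | rfl
    · simp [Finset.sum_range_succ] at h
      simp [List.range_succ, List.count_cons]
      omega
    · simp [Finset.sum_range_succ] at h
      simp [List.range_succ, List.count_cons]
      omega
  obtain ⟨c, hc⟩ := hex
  rcases lt_or_gt_of_ne hc with h | h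
  · exact ⟨c, B, A, hcard, hB, hA, h⟩
  · exact ⟨c, A, B, hcard, hA, hB, h⟩

lemma sw_iter {q : ℕ} (G : SimpleGraph V) (f : Sym2 V → Fin q) (hr : 1 ≤ r) (c : Fin q) (N : ℕ) :
    (∃ W A B, W.card ≤ 3 * r * N ∧ IsKrTilingOn G r A W ∧ IsKrTilingOn G r B W ∧
      tilingColorCount f B c + N ≤ tilingColorCount f A c) ∨
    (∃ S : Finset V, S.card ≤ 3 * r * N ∧ ∀ W A B, IsSw G f r c W A B → ¬ Disjoint S W) := by
  induction N with
  | zero =>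
    left
    refine ⟨∅, ∅, ∅, by simp, ⟨by simp, by simp, by simp⟩, ⟨by simp, by simp, by simp⟩, by simp⟩
  | succ N ih =>
    rcases ih with ⟨W, A, B, h1, h2, h3, h4⟩ | ⟨S, h1, h2⟩
    · by_cases h : ∃ W' A' B', IsSw G f r c W' A' B' ∧ Disjoint W W'
      · obtain ⟨W', A', B', ⟨g1, g2, g3, g4⟩, hd⟩ := h
        left
        obtain ⟨k1, k2⟩ := tl_union hr h2 g2 hd
        obtain ⟨l1, l2⟩ := tl_union hr h3 g3 hd
        refine ⟨W ∪ W', A ∪ A', B ∪ B', ?_, k1, l1, ?_⟩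
        · have := Finset.card_union_le W W'
          rw [mul_add]; omega
        · rw [tl_color_union f k2, tl_color_union f l2]
          omega
      · right
        push Not at h
        exact ⟨W, h1.trans (Nat.mul_le_mul_left _ (by omega)), h⟩
    · right
      exact ⟨S, h1.trans (Nat.mul_le_mul_left _ (by omega)), h2⟩

end Tilings


section Final
open scoped Classical

/-- every vertex has few non-neighbours (counting itself) -/
def FewNon {n : ℕ} (G : SimpleGraph (Fin n)) (b : ℝ) : Prop :=
  ∀ v, ((univ.filter fun u => ¬ G.Adj v u).card : ℝ) ≤ b

lemma fewNon_of {n : ℕ} (G : SimpleGraph (Fin n)) [DecidableRel G.Adj] (a : ℝ)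
    (h : a ≤ G.minDegree) : FewNon G (n - a) := by
  intro v
  have h1 : (univ.filter fun u => G.Adj v u).card = G.degree v := by
    rw [← SimpleGraph.card_neighborFinset_eq_degree, SimpleGraph.neighborFinset_eq_filter]
  have h2 := Finset.card_filter_add_card_filter_not (s := (univ : Finset (Fin n))) (fun u => G.Adj v u)
  rw [h1, Finset.card_univ, Fintype.card_fin] at h2
  have h3 : (G.minDegree : ℝ) ≤ G.degree v := by exact_mod_cast G.minDegree_le_degree v
  have h4 : (G.degree v : ℝ) + ((univ.filter fun u => ¬ G.Adj v u).card : ℝ) = n := by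
    exact_mod_cast h2
  have h5 : ((univ.filter fun u => ¬ G.Adj v u).card : ℝ) ≤ n - a := by linarith
  refine le_trans (le_of_eq ?_) h5
  congr!

lemma fin_tile {n r : ℕ} (hr : 1 ≤ r) (G : SimpleGraph (Fin n)) (b : ℝ) (hG : FewNon G b)
    (W : Finset (Fin n)) (hd : r ∣ W.card) (hb : r * b ≤ W.card) : ∃ T, IsKrTilingOn G r T W := by
  refine hs_tiling G r hr W hd fun v hv => ?_
  have h1 : (W.filter fun u => u ≠ v ∧ ¬ G.Adj v u).card < (univ.filter fun u => ¬ G.Adj v u).card := by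
    refine Finset.card_lt_card ⟨?_, ?_⟩
    · intro u hu
      rw [Finset.mem_filter] at hu ⊢
      exact ⟨Finset.mem_univ _, hu.2.2⟩
    · intro hs
      have := hs (Finset.mem_filter.2 ⟨Finset.mem_univ v, fun h => h.ne rfl⟩)
      rw [Finset.mem_filter] at this
      exact this.2.1 rfl
  have h2 : ((W.filter fun u => u ≠ v ∧ ¬ G.Adj v u).card : ℝ)
      < ((univ.filter fun u => ¬ G.Adj v u).card : ℝ) := by exact_mod_cast h1
  have h3 := hG v
  have hr0 : (0 : ℝ) < r := by exact_mod_cast hr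
  have h4 : (r : ℝ) * ((W.filter fun u => u ≠ v ∧ ¬ G.Adj v u).card : ℝ) < W.card := by nlinarith
  exact_mod_cast h4

lemma fin_clique {n r : ℕ} (G : SimpleGraph (Fin n)) (b : ℝ) (hG : FewNon G b) (hb0 : 0 ≤ b)
    (C : Finset (Fin n)) (hC : ((r : ℝ) - 1) * b + C.card < n) (v : Fin n) (hv : v ∉ C) (j : ℕ) :
    j + 1 ≤ r → ∃ K : Finset (Fin n), G.IsNClique (j + 1) K ∧ v ∈ K ∧ Disjoint K C := by
  induction j with
  | zero =>
    intro _
    exact ⟨{v}, by simp [SimpleGraph.isNClique_iff], by simp, by simpa using hv⟩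
  | succ j ih =>
    intro hj
    obtain ⟨K, h1, h2, h3⟩ := ih (by omega)
    have hex : ∃ u, u ∉ C ∧ ∀ x ∈ K, G.Adj u x := by
      by_contra hcon
      push Not at hcon
      have hsub : (univ : Finset (Fin n)) ⊆ C ∪ K.biUnion fun x => univ.filter fun u => ¬ G.Adj x u := by
        intro u _
        rw [Finset.mem_union]
        by_cases hu : u ∈ C
        · exact Or.inl hu
        · obtain ⟨x, hx, hxu⟩ := hcon u hu
          exact Or.inr (Finset.mem_biUnion.2 ⟨x, hx, Finset.mem_filter.2 ⟨Finset.mem_univ _,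
            fun h => hxu h.symm⟩⟩)
      have h4 := (Finset.card_le_card hsub).trans ((Finset.card_union_le _ _).trans
        (Nat.add_le_add_left Finset.card_biUnion_le _))
      rw [Finset.card_univ, Fintype.card_fin] at h4
      have h5 : (n : ℝ) ≤ C.card + ∑ x ∈ K, ((univ.filter fun u => ¬ G.Adj x u).card : ℝ) := by
        exact_mod_cast h4
      have h6 : ∑ x ∈ K, ((univ.filter fun u => ¬ G.Adj x u).card : ℝ) ≤ ∑ x ∈ K, b :=
        Finset.sum_le_sum fun x _ => hG x
      rw [Finset.sum_const, nsmul_eq_mul, h1.card_eq] at h6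
      have h7 : ((j + 1 : ℕ) : ℝ) ≤ (r : ℝ) - 1 := by
        have : ((j + 1 + 1 : ℕ) : ℝ) ≤ r := by exact_mod_cast hj
        push_cast at this ⊢
        linarith
      have h8 := mul_le_mul_of_nonneg_right h7 hb0
      linarith
    obtain ⟨u, hu, hux⟩ := hex
    refine ⟨insert u K, h1.insert hux, Finset.mem_insert_of_mem h2, ?_⟩
    rw [Finset.disjoint_insert_left]
    exact ⟨hu, h3⟩

lemma fin_cover {n r : ℕ} (hr : 1 ≤ r) (G : SimpleGraph (Fin n)) (b : ℝ) (hG : FewNon G b)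
    (hb0 : 0 ≤ b) (B : Finset (Fin n)) :
    ((r : ℝ) - 1) * b + (r * B.card : ℕ) < n → 
    ∃ C T, B ⊆ C ∧ C.card ≤ r * B.card ∧ IsKrTilingOn G r T C := by
  induction B using Finset.induction_on with
  | empty =>
    intro _
    exact ⟨∅, ∅, by simp, by simp, by simp, by simp, by simp⟩
  | insert v B hv ih =>
    intro hB
    rw [Finset.card_insert_of_notMem hv] at hB ⊢
    have hle : ((r * B.card : ℕ) : ℝ) ≤ (r * (B.card + 1) : ℕ) := by
      exact_mod_cast Nat.mul_le_mul_left _ (by omega)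
    obtain ⟨C, T, h1, h2, h3⟩ := ih (by linarith)
    by_cases hvC : v ∈ C
    · refine ⟨C, T, Finset.insert_subset hvC h1, h2.trans (Nat.mul_le_mul_left _ (by omega)), h3⟩
    · have h2' : (C.card : ℝ) ≤ (r * B.card : ℕ) := by exact_mod_cast h2
      obtain ⟨K, k1, k2, k3⟩ := fin_clique (r := r) G b hG hb0 C (by linarith) v hvC (r - 1) (by omega)
      rw [Nat.sub_add_cancel hr] at k1
      have hK : IsKrTilingOn G r {K} K := ⟨by simpa using k1, by simp, by simp⟩
      refine ⟨C ∪ K, T ∪ {K}, ?_, ?_, (tl_union hr h3 hK k3.symm).1⟩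
      · exact Finset.insert_subset (Finset.mem_union_right _ k2) (h1.trans Finset.subset_union_left)
      · have := Finset.card_union_le C K
        rw [k1.card_eq] at this
        rw [mul_add]; omega

lemma fin_case_one {n r q N : ℕ} (hr : 1 ≤ r) (hq : 1 ≤ q) (G : SimpleGraph (Fin n)) (b : ℝ)
    (hG : FewNon G b) (f : Sym2 (Fin n) → Fin q) (c : Fin q) (W : Finset (Fin n))
    (A B : Finset (Finset (Fin n))) (hA : IsKrTilingOn G r A W) (hB : IsKrTilingOn G r B W)
    (hAB : tilingColorCount f B c + N ≤ tilingColorCount f A c) (hn : r ∣ n)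
    (hW : r * b + W.card ≤ n) (γ : ℝ) (hγ : 0 < γ) (hN : γ * n ≤ N) :
    ∃ T : Finset (Finset (Fin n)), IsKrTiling G r T ∧ ∃ c : Fin q,
      ((1 : ℝ) / q + γ / (q * r)) * (tilingEdgeCount T : ℝ) ≤ (tilingColorCount f T c : ℝ) := by
  have hWle : W.card ≤ n := by simpa using Finset.card_le_univ W
  have hWd : r ∣ W.card := ⟨A.card, by rw [← (tl_edge hA).2, mul_comm]⟩
  have hcc : (univ \ W).card = n - W.card := by
    rw [Finset.card_sdiff_of_subset (Finset.subset_univ _), Finset.card_univ, Fintype.card_fin]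
  obtain ⟨T₀, hT₀⟩ := fin_tile hr G b hG (univ \ W) (by rw [hcc]; exact Nat.dvd_sub hn hWd) (by
    rw [hcc, Nat.cast_sub hWle]; linarith)
  obtain ⟨hTA, dA⟩ := tl_union hr hA hT₀ Finset.disjoint_sdiff
  obtain ⟨hTB, dB⟩ := tl_union hr hB hT₀ Finset.disjoint_sdiff
  rw [Finset.union_sdiff_of_subset (Finset.subset_univ _)] at hTA hTB
  by_contra hcon
  push Not at hcon
  have e1 := hcon _ hTA c
  have e2 := hcon _ hTB
  have cA := tl_color_union f dA c
  have cB := tl_color_union f dB c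
  have eA := tl_edge hTA
  have eB := tl_edge hTB
  have sB := tl_color_sum f (B ∪ T₀)
  rw [Finset.card_univ, Fintype.card_fin] at eA eB
  have hcards : (A ∪ T₀).card = (B ∪ T₀).card :=
    Nat.eq_of_mul_eq_mul_right hr (eA.2.trans eB.2.symm)
  have hEE : tilingEdgeCount (A ∪ T₀) = tilingEdgeCount (B ∪ T₀) := by rw [eA.1, eB.1, hcards]
  rw [hEE] at e1
  set E : ℝ := (tilingEdgeCount (B ∪ T₀) : ℝ) with hE
  have hEn : E ≤ n * r := by
    have h1 : r.choose 2 ≤ r * r := by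
      have := Nat.choose_le_pow r 2
      rw [pow_two] at this
      exact this
    have h2 : tilingEdgeCount (B ∪ T₀) ≤ n * r := by
      rw [eB.1]
      have h3 := Nat.mul_le_mul_left (B ∪ T₀).card h1
      rw [← mul_assoc, eB.2] at h3
      exact h3
    rw [hE]; exact_mod_cast h2
  have hq0 : (0 : ℝ) < q := by exact_mod_cast hq
  have hr0 : (0 : ℝ) < r := by exact_mod_cast hr
  set t : ℝ := ((1 : ℝ) / q + γ / (q * r)) * E with ht
  have hqt : q * t = E + γ / r * E := by rw [ht]; field_simp
  have hsum : E ≤ (tilingColorCount f (B ∪ T₀) c : ℝ) + (q - 1) * t := by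
    have h1 : E = ∑ c', (tilingColorCount f (B ∪ T₀) c' : ℝ) := by rw [hE, ← sB]; push_cast; rfl
    rw [h1, ← Finset.add_sum_erase _ _ (Finset.mem_univ c)]
    have h2 : ∑ c' ∈ univ.erase c, (tilingColorCount f (B ∪ T₀) c' : ℝ) ≤ ∑ c' ∈ univ.erase c, t :=
      Finset.sum_le_sum fun c' _ => (e2 c').le
    rw [Finset.sum_const, nsmul_eq_mul, Finset.card_erase_of_mem (Finset.mem_univ _),
      Finset.card_univ, Fintype.card_fin, Nat.cast_sub hq, Nat.cast_one] at h2
    linarith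
  have hAB' : (tilingColorCount f (B ∪ T₀) c : ℝ) + N ≤ tilingColorCount f (A ∪ T₀) c := by
    exact_mod_cast (by omega)
  have h5 : γ / r * E ≤ γ * n := by
    calc γ / r * E ≤ γ / r * (n * r) := mul_le_mul_of_nonneg_left hEn (by positivity)
      _ = γ * n := by field_simp
  linarith

end Final


section Final
open scoped Classical

def delS (G : SimpleGraph V) (S : Finset V) : SimpleGraph V where
  Adj a b := G.Adj a b ∧ a ∉ S ∧ b ∉ S
  symm := ⟨fun _ _ h => ⟨h.1.symm, h.2.2, h.2.1⟩⟩
  loopless := ⟨fun _ h => h.1.ne rfl⟩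

lemma tiling_mono [DecidableEq V] {G₁ G₂ : SimpleGraph V} (h : G₁ ≤ G₂) {r : ℕ}
    {T : Finset (Finset V)} {W : Finset V} (hT : IsKrTilingOn G₁ r T W) : IsKrTilingOn G₂ r T W :=
  ⟨fun K hK => (hT.1 K hK).mono h, hT.2⟩

lemma no_template {n q r : ℕ} (hr : 2 ≤ r) (G G₁ : SimpleGraph (Fin n)) (f : Sym2 (Fin n) → Fin q)
    (S : Finset (Fin n)) (hS : ∀ c W A B, IsSw G f r c W A B → ¬ Disjoint S W)
    (hlift : ∀ (ι : Type) (I : Finset ι) (y : ι → Fin n), I.card ≤ 3 * r → 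
        (∀ a ∈ I, ∃ z, G₁.Adj (y a) z) →
        ∃ x : ι → Fin n, Set.InjOn x I ∧ ∀ a ∈ I, ∀ b ∈ I, G₁.Adj (y a) (y b) →
          (delS G S).Adj (x a) (x b) ∧ f s(x a, x b) = f s(y a, y b)) :
    ¬ HasKrTemplate G₁ f r := by
  rintro ⟨K, k, w, hK, hk, -, hKw', hw, hbal⟩
  have hIc : (tmI K k).card ≤ 3 * r := by
    refine (tmI_card K k).trans ?_
    rw [hK.card_eq]
    have : r - 2 + 2 = r := by omega
    rw [this]
    exact Nat.mul_le_mul_right _ (by omega)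
  have hnb : ∀ a ∈ tmI K k, ∃ b ∈ tmI K k, G₁.Adj (tmY w a) (tmY w b) := by
    intro a ha
    simp only [tmI, Finset.mem_image, Finset.mem_union, Finset.mem_product,
        Finset.mem_range] at ha
    rcases ha with ⟨⟨i, u⟩, ⟨hi, hu⟩, rfl⟩ | ⟨j, hj, rfl⟩
    · refine ⟨Sum.inr 0, ?_, ?_⟩
      · simp only [tmI, Finset.mem_image, Finset.mem_union, Finset.mem_product, Finset.mem_range]
        exact Or.inr ⟨0, by omega, rfl⟩
      · exact hKw' 0 (by omega) u hu
    · refine ⟨Sum.inr ((j + 1) % (2 * k)), ?_, ?_⟩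
      · simp only [tmI, Finset.mem_image, Finset.mem_union, Finset.mem_product, Finset.mem_range]
        exact Or.inr ⟨_, Nat.mod_lt _ (by omega), rfl⟩
      · exact hw j hj
  obtain ⟨x, hx1, hx2⟩ := hlift _ (tmI K k) (tmY w) hIc (fun a ha => by
    obtain ⟨b, _, hb⟩ := hnb a ha
    exact ⟨_, hb⟩)
  obtain ⟨c, A, B, h1, h2, h3, h4⟩ := tm_switch (G := delS G S) f hr K k w hk hK hKw' hw hbal x hx1 hx2
  have hle : delS G S ≤ G := fun u v h => h.1
  refine hS c _ A B ⟨h1, tiling_mono hle h2, tiling_mono hle h3, h4⟩ ?_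
  rw [Finset.disjoint_right]
  intro v hv
  obtain ⟨a, ha, rfl⟩ := Finset.mem_image.1 hv
  obtain ⟨b, hb, hab⟩ := hnb a ha
  exact (hx2 a ha b hb hab).1.2.1

lemma template_mono {q r : ℕ} {G₁ G₂ : SimpleGraph V} (h : G₁ ≤ G₂) {f : Sym2 V → Fin q}
    (ht : HasKrTemplate G₁ f r) : HasKrTemplate G₂ f r := by
  obtain ⟨K, k, w, h1, h2, h3, h4, h5, h6⟩ := ht
  exact ⟨K, k, w, h1.mono h, h2, h3, fun i hi x hx => h (h4 i hi x hx), fun i hi => h (h5 i hi), h6⟩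

lemma fin_case_two {n r q : ℕ} (hr : 3 ≤ r) (hn0 : 0 < n) (G : SimpleGraph (Fin n)) [DecidableRel G.Adj]
    (ξ : ℝ) (hξ : 0 < ξ) (hdeg : (((r : ℝ) - 1) / r + ξ) * n ≤ G.minDegree)
    (f : Sym2 (Fin n) → Fin q) (S : Finset (Fin n)) (G₁ : SimpleGraph (Fin n)) (hG₁ : G₁ ≤ delS G S)
    (hnt : ¬ HasKrTemplate G₁ f r)
    (hS : (S.card : ℝ) ≤ ξ ^ 2 / (64 * r) * n)
    (hdel : ((univ.filter fun p : Fin n × Fin n => (delS G S).Adj p.1 p.2 ∧ ¬ G₁.Adj p.1 p.2).card : ℝ)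
        ≤ ξ ^ 2 / (32 * r) * (n : ℝ) ^ 2) :
    ∃ (U : Finset (Fin n)) (G' : SimpleGraph (Fin n)),
            G' ≤ G ∧
            (∀ u v, G'.Adj u v → u ∈ U ∧ v ∈ U) ∧
            (1 - ξ) * n ≤ (U.card : ℝ) ∧
            (∀ v ∈ U,
              (G.minDegree : ℝ) - ξ * n ≤ (({u | G'.Adj v u} : Set (Fin n)).ncard : ℝ)) ∧
            ¬ HasKrTemplate G' f r ∧
            ∃ T' : Finset (Finset (Fin n)), IsKrTilingOn G r T' (Finset.univ \ U) := by
  have hr0 : (0 : ℝ) < r := by exact_mod_cast (by omega : 0 < r)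
  have hn0' : (0 : ℝ) < n := by exact_mod_cast hn0
  set lost : Fin n → ℝ := fun v => ((univ.filter fun u => G.Adj v u ∧ ¬ G₁.Adj v u).card : ℝ) with hlost
  -- total loss
  have htot : ∑ v, lost v ≤ ξ ^ 2 / (16 * r) * (n : ℝ) ^ 2 := by
    have h1 : ∑ v, lost v
        = ((univ.filter fun p : Fin n × Fin n => G.Adj p.1 p.2 ∧ ¬ G₁.Adj p.1 p.2).card : ℝ) := by
      rw [Finset.card_filter, Fintype.sum_prod_type]
      push_cast
      refine Finset.sum_congr rfl fun v _ => ?_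
      rw [hlost]
      simp only [Finset.card_filter]
      push_cast
      rfl
    have hsub : (univ.filter fun p : Fin n × Fin n => G.Adj p.1 p.2 ∧ ¬ G₁.Adj p.1 p.2) ⊆
        (univ.filter fun p : Fin n × Fin n => (delS G S).Adj p.1 p.2 ∧ ¬ G₁.Adj p.1 p.2) ∪
        (S ×ˢ univ ∪ univ ×ˢ S) := by
      intro p hp
      rw [Finset.mem_filter] at hp
      simp only [Finset.mem_union, Finset.mem_filter, Finset.mem_product, Finset.mem_univ, true_and,
        and_true]
      by_cases a1 : p.1 ∈ S
      · exact Or.inr (Or.inl a1)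
      by_cases a2 : p.2 ∈ S
      · exact Or.inr (Or.inr a2)
      exact Or.inl ⟨⟨hp.2.1, a1, a2⟩, hp.2.2⟩
    have h2 := (Finset.card_le_card hsub).trans ((Finset.card_union_le _ _).trans
      (Nat.add_le_add_left (Finset.card_union_le _ _) _))
    rw [Finset.card_product, Finset.card_product, Finset.card_univ, Fintype.card_fin] at h2
    have h3 : ((univ.filter fun p : Fin n × Fin n => G.Adj p.1 p.2 ∧ ¬ G₁.Adj p.1 p.2).card : ℝ) ≤
        ((univ.filter fun p : Fin n × Fin n =>
          (delS G S).Adj p.1 p.2 ∧ ¬ G₁.Adj p.1 p.2).card : ℝ) + (S.card * n + n * S.card) := by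
      exact_mod_cast h2
    rw [h1]
    refine h3.trans ?_
    have h4 := mul_le_mul_of_nonneg_right hS hn0'.le
    have h5 : ξ ^ 2 / (16 * r) * (n : ℝ) ^ 2
        = ξ ^ 2 / (32 * r) * (n : ℝ) ^ 2 + 2 * (ξ ^ 2 / (64 * r) * n * n) := by field_simp; ring
    rw [h5]
    linarith
  set B : Finset (Fin n) := univ.filter fun v => ξ / 4 * n < lost v with hB
  have hBc : (r : ℝ) * B.card ≤ ξ / 4 * n := by
    have h1 : ∑ v ∈ B, ξ / 4 * n ≤ ∑ v, lost v :=
      (Finset.sum_le_sum fun v hv => (Finset.mem_filter.1 hv).2.le).trans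
        (Finset.sum_le_sum_of_subset_of_nonneg (Finset.subset_univ _) fun v _ _ => by
          rw [hlost]; positivity)
    rw [Finset.sum_const, nsmul_eq_mul] at h1
    have h2 := h1.trans htot
    have h3 : ξ ^ 2 / (16 * r) * (n : ℝ) ^ 2 = (ξ / 4 * n / r) * (ξ / 4 * n) := by field_simp; ring
    rw [h3] at h2
    have h4 := le_of_mul_le_mul_right h2 (by positivity)
    rw [le_div_iff₀ hr0] at h4
    linarith
  set b : ℝ := n - (((r : ℝ) - 1) / r + ξ) * n with hb
  have hfew : FewNon G b := fewNon_of G _ hdeg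
  have hb0 : 0 ≤ b := le_trans (by positivity) (hfew ⟨0, hn0⟩)
  have hrb : (r : ℝ) * b = n - r * ξ * n := by rw [hb]; field_simp; ring
  have hr3 : (3 : ℝ) ≤ r := by exact_mod_cast hr
  have hξn : 0 < ξ * n := by positivity
  obtain ⟨C, T, c1, c2, c3⟩ := fin_cover (r := r) (by omega) G b hfew hb0 B (by
    push_cast
    have : 3 * (ξ * n) ≤ r * (ξ * n) := mul_le_mul_of_nonneg_right hr3 hξn.le
    nlinarith)
  have c2' : (C.card : ℝ) ≤ ξ / 4 * n := by
    have : (C.card : ℝ) ≤ r * B.card := by exact_mod_cast c2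
    linarith
  let G' : SimpleGraph (Fin n) :=
    { Adj := fun u v => G₁.Adj u v ∧ u ∉ C ∧ v ∉ C
      symm := ⟨fun _ _ h => ⟨h.1.symm, h.2.2, h.2.1⟩⟩
      loopless := ⟨fun _ h => h.1.ne rfl⟩ }
  have hG'1 : G' ≤ G₁ := fun u v h => h.1
  refine ⟨univ \ C, G', fun u v h => (hG₁ h.1).1, ?_, ?_, ?_, fun h => hnt (template_mono hG'1 h), T, ?_⟩
  · intro u v h
    simp only [Finset.mem_sdiff, Finset.mem_univ, true_and]
    exact h.2
  · rw [Finset.card_sdiff_of_subset (Finset.subset_univ _), Finset.card_univ, Fintype.card_fin,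
      Nat.cast_sub (by simpa using Finset.card_le_univ C)]
    linarith
  · intro v hv
    have hvC : v ∉ C := (Finset.mem_sdiff.1 hv).2
    have hvB : v ∉ B := fun h => hvC (c1 h)
    have hl : lost v ≤ ξ / 4 * n := by
      by_contra h
      exact hvB (Finset.mem_filter.2 ⟨Finset.mem_univ _, not_le.1 h⟩)
    have hset : ({u | G'.Adj v u} : Set (Fin n)).ncard = (univ.filter fun u => G'.Adj v u).card := by
      rw [← Set.ncard_coe_finset]
      congr 1
      ext u
      simp
    rw [hset]
    have h1 : (univ.filter fun u => G.Adj v u).card = G.degree v := by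
      rw [← SimpleGraph.card_neighborFinset_eq_degree, SimpleGraph.neighborFinset_eq_filter]
    have hsub : (univ.filter fun u => G.Adj v u) ⊆ (univ.filter fun u => G'.Adj v u) ∪
        ((univ.filter fun u => G.Adj v u ∧ ¬ G₁.Adj v u) ∪ C) := by
      intro u hu
      rw [Finset.mem_filter] at hu
      simp only [Finset.mem_union, Finset.mem_filter, Finset.mem_univ, true_and]
      by_cases a1 : G₁.Adj v u
      · by_cases a2 : u ∈ C
        · exact Or.inr (Or.inr a2)
        · exact Or.inl ⟨a1, hvC, a2⟩
      · exact Or.inr (Or.inl ⟨hu.2, a1⟩)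
    have h2 := (Finset.card_le_card hsub).trans ((Finset.card_union_le _ _).trans
      (Nat.add_le_add_left (Finset.card_union_le _ _) _))
    rw [h1] at h2
    have h3 : (G.degree v : ℝ) ≤ ((univ.filter fun u => G'.Adj v u).card : ℝ) +
        (((univ.filter fun u => G.Adj v u ∧ ¬ G₁.Adj v u).card : ℝ) + C.card) := by
      exact_mod_cast h2
    have h4 : (G.minDegree : ℝ) ≤ G.degree v := by exact_mod_cast G.minDegree_le_degree v
    have hl' : ((univ.filter fun u => G.Adj v u ∧ ¬ G₁.Adj v u).card : ℝ) ≤ ξ / 4 * n := by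
      refine le_trans (le_of_eq ?_) hl
      rw [hlost]
    linarith
  · rw [Finset.sdiff_sdiff_eq_self (Finset.subset_univ _)]
    exact c3

end Final

/-- **Lemma (cleaning lemma).** For `r ≥ 3`, `q ≥ 2`, `ξ > 0` there are `ζ > 0` and `n₀`
such that for every `q`-edge-colored `n`-vertex graph (`n ≥ n₀`, `r ∣ n`) with
`δ(G) ≥ ((r−1)/r + ξ)n`, either (1) some `K_r`-tiling has a color on at least a
`(1/q + ζ)`-fraction of its edges, or (2) there is a subgraph `G'` on a vertex set `U` with
`|U| ≥ (1−ξ)n`, minimum degree at least `δ(G) − ξn`, no `K_r`-template, and such that the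
removed vertices span a `K_r`-tiling in `G`. -/
theorem cleaning_lemma (r q : ℕ) (hr : 3 ≤ r) (hq : 2 ≤ q) (ξ : ℝ) (hξ : 0 < ξ) :
    ∃ ζ : ℝ, 0 < ζ ∧ ∃ n₀ : ℕ, ∀ n : ℕ, n₀ ≤ n → r ∣ n →
      ∀ (G : SimpleGraph (Fin n)) [DecidableRel G.Adj],
        (((r : ℝ) - 1) / r + ξ) * n ≤ G.minDegree →
        ∀ f : Sym2 (Fin n) → Fin q,
          (∃ T : Finset (Finset (Fin n)), IsKrTiling G r T ∧
            ∃ c : Fin q,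
              ((1 : ℝ) / q + ζ) * (tilingEdgeCount T : ℝ) ≤ (tilingColorCount f T c : ℝ)) ∨
          (∃ (U : Finset (Fin n)) (G' : SimpleGraph (Fin n)),
            G' ≤ G ∧
            (∀ u v, G'.Adj u v → u ∈ U ∧ v ∈ U) ∧
            (1 - ξ) * n ≤ (U.card : ℝ) ∧
            (∀ v ∈ U,
              (G.minDegree : ℝ) - ξ * n ≤ (({u | G'.Adj v u} : Set (Fin n)).ncard : ℝ)) ∧
            ¬ HasKrTemplate G' f r ∧
            ∃ T' : Finset (Finset (Fin n)), IsKrTilingOn G r T' (Finset.univ \ U)) := by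
  classical
  have hr0 : (0 : ℝ) < r := by exact_mod_cast (by omega : 0 < r)
  have hr3 : (3 : ℝ) ≤ r := by exact_mod_cast hr
  have hq0 : (0 : ℝ) < q := by exact_mod_cast (by omega : 0 < q)
  have hq1 : (1 : ℝ) ≤ q := by exact_mod_cast (by omega : 1 ≤ q)
  obtain ⟨γ, hγdef⟩ : ∃ γ : ℝ, γ = ξ ^ 2 / (384 * q * r ^ 2) := ⟨_, rfl⟩
  have hγ : 0 < γ := by rw [hγdef]; positivity
  obtain ⟨n₁, hn₁⟩ := rem_main q (3 * r) (ξ ^ 2 / (32 * r)) (by positivity)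
  refine ⟨γ / (q * r), by positivity, max n₁ (⌈1 / γ⌉₊ + 1), ?_⟩
  intro n hn hrn G _ hdeg f
  have hnn₁ : n₁ ≤ n := (le_max_left _ _).trans hn
  have hnn₂ : ⌈1 / γ⌉₊ + 1 ≤ n := (le_max_right _ _).trans hn
  have hn0 : 0 < n := by omega
  have hn0' : (0 : ℝ) < n := by exact_mod_cast hn0
  have hγn : 1 ≤ γ * n := by
    have h1 : 1 / γ ≤ n := (Nat.le_ceil _).trans (by exact_mod_cast (by omega : ⌈1 / γ⌉₊ ≤ n))
    rw [div_le_iff₀ hγ] at h1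
    linarith
  obtain ⟨N, hNdef⟩ : ∃ N : ℕ, N = ⌈γ * n⌉₊ := ⟨_, rfl⟩
  have hN1 : γ * n ≤ N := by rw [hNdef]; exact Nat.le_ceil _
  have hN2 : (N : ℝ) ≤ 2 * (γ * n) := by
    have := Nat.ceil_lt_add_one (show 0 ≤ γ * n by positivity)
    rw [hNdef]; linarith
  have hfew := fewNon_of G _ hdeg
  have hb0 : 0 ≤ (n : ℝ) - (((r : ℝ) - 1) / r + ξ) * n :=
    le_trans (by positivity) (hfew ⟨0, hn0⟩)
  have hrb : (r : ℝ) * ((n : ℝ) - (((r : ℝ) - 1) / r + ξ) * n) = n - r * ξ * n := by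
    field_simp; ring
  have hξr : r * ξ ≤ 1 := by
    have h1 : 0 ≤ (n : ℝ) - r * ξ * n := by rw [← hrb]; positivity
    by_contra hc
    push Not at hc
    nlinarith
  have hξ1 : ξ ≤ 1 := by nlinarith
  -- the key size estimate
  have hsize : (q : ℝ) * (3 * r * N) ≤ ξ ^ 2 / (64 * r) * n := by
    have e : (q : ℝ) * (3 * r * (2 * (γ * n))) = ξ ^ 2 / (64 * r) * n := by
      rw [hγdef]; field_simp; norm_num
    rw [← e]
    gcongr
  by_cases hcase : ∃ c : Fin q, ∃ W A B, W.card ≤ 3 * r * N ∧ IsKrTilingOn G r A W ∧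
      IsKrTilingOn G r B W ∧ tilingColorCount f B c + N ≤ tilingColorCount f A c
  · left
    obtain ⟨c, W, A, B, hW, hA, hB, hAB⟩ := hcase
    refine fin_case_one (by omega) (by omega) G _ hfew f c W A B hA hB hAB hrn ?_ γ hγ hN1
    rw [hrb]
    have hW' : (W.card : ℝ) ≤ 3 * r * N := by exact_mod_cast hW
    have h1 : (3 * r * N : ℝ) ≤ q * (3 * r * N) := le_mul_of_one_le_left (by positivity) hq1
    have h2 : ξ ^ 2 / (64 * r) * n ≤ r * ξ * n := by
      have : ξ ^ 2 / (64 * r) ≤ r * ξ := by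
        rw [div_le_iff₀ (by positivity)]
        nlinarith [mul_pos hr0 hξ, mul_pos hr0 (mul_pos hr0 hξ)]
      exact mul_le_mul_of_nonneg_right this hn0'.le
    linarith
  · right
    have hsw : ∀ c : Fin q, ∃ S : Finset (Fin n), S.card ≤ 3 * r * N ∧
        ∀ W A B, IsSw G f r c W A B → ¬ Disjoint S W := by
      intro c
      rcases sw_iter G f (by omega : 1 ≤ r) c N with h | h
      · exact absurd ⟨c, h⟩ hcase
      · exact h
    choose S hSc hSd using hsw
    obtain ⟨S', hS'⟩ : ∃ S' : Finset (Fin n), S' = univ.biUnion S := ⟨_, rfl⟩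
    have hS'c : (S'.card : ℝ) ≤ ξ ^ 2 / (64 * r) * n := by
      refine le_trans ?_ hsize
      have h1 : S'.card ≤ q * (3 * r * N) := by
        rw [hS']
        refine (Finset.card_biUnion_le_card_mul _ _ _ fun c _ => hSc c).trans ?_
        simp
      exact_mod_cast h1
    obtain ⟨G₁, hG₁, hdel, hlift⟩ := hn₁ (Fin n) (by simpa using hnn₁) (delS G S') f
    refine fin_case_two hr hn0 G ξ hξ hdeg f S' G₁ hG₁ ?_ hS'c ?_
    · refine no_template (by omega) G G₁ f S' ?_ hlift
      intro c W A B hsw hd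
      refine hSd c W A B hsw (Finset.disjoint_of_subset_left ?_ hd)
      rw [hS']
      exact Finset.subset_biUnion_of_mem S (Finset.mem_univ c)
    · rw [Fintype.card_fin] at hdel
      refine le_trans (le_of_eq ?_) hdel
      congr!
end
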